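/- Let Ω be a bounded Lipschitz domain in ℝ^N (N ≥ 2), let ω, ω' be open subsets of ℝ^N with closure(ω') ⊂ ω, and let x₀ ∈ Ω ∖ closure(ω). Then there is a constant C = C(Ω, ω, ω', x₀) such that for every positive harmonic function h in Ω vanishing on ω ∩ ∂Ω and every measurable set A ⊂ ω': ∫_A (h(x)/δ_Ω(x))² dx ≤ C · h(x₀) · ^Ω R̂_h^A(x₀). -/

import Mathlib

open MeasureTheory Metric Set Filter Topology
open scoped ENNReal NNReal

noncomputable section

namespace Anc

abbrev ES (N : ℕ) := EuclideanSpace ℝ (Fin N)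

/-- `δ_Ω(x)`: the distance from `x` to the complement of `Ω`. -/
def dista {N : ℕ} (Ω : Set (ES N)) (x : ES N) : ℝ := infDist x Ωᶜ

/-- Pointwise Laplacian (junk values where the derivatives do not exist). -/
def lap {N : ℕ} (u : ES N → ℝ) (x : ES N) : ℝ :=
  ∑ i : Fin N,
    fderiv ℝ (fun y => fderiv ℝ u y (EuclideanSpace.single i 1)) x (EuclideanSpace.single i 1)

/-- Smooth compactly supported test functions in `Ω`. -/
def IsTestFun {N : ℕ} (Ω : Set (ES N)) (φ : ES N → ℝ) : Prop :=
  ContDiff ℝ (⊤ : ℕ∞) φ ∧ IsCompact (tsupport φ) ∧ tsupport φ ⊆ Ω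

/-- `u` is a continuous weak solution of `Δu - V·u = 0` in `Ω` (i.e. `L_V`-harmonic). -/
def LVHarmonic {N : ℕ} (Ω : Set (ES N)) (V u : ES N → ℝ) : Prop :=
  ContinuousOn u Ω ∧ LocallyIntegrableOn u Ω ∧
    LocallyIntegrableOn (fun x => V x * u x) Ω ∧
    ∀ φ, IsTestFun Ω φ → ∫ x in Ω, u x * lap φ x = ∫ x in Ω, V x * u x * φ x

/-- `s` is `L_V`-superharmonic in `Ω` (weakly, `Δs - V·s ≤ 0`, `s` l.s.c.). -/
def LVSuperharmonic {N : ℕ} (Ω : Set (ES N)) (V s : ES N → ℝ) : Prop :=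
  LowerSemicontinuousOn s Ω ∧ LocallyIntegrableOn s Ω ∧
    LocallyIntegrableOn (fun x => V x * s x) Ω ∧
    ∀ φ, IsTestFun Ω φ → (∀ x, 0 ≤ φ x) →
      ∫ x in Ω, s x * lap φ x ≤ ∫ x in Ω, V x * s x * φ x

/-- The class `𝒱(Ω,a)` of nonnegative Borel potentials with `V(x) ≤ a/δ_Ω(x)²`. -/
def VClass {N : ℕ} (Ω : Set (ES N)) (a : ℝ) (V : ES N → ℝ) : Prop :=
  Measurable V ∧ ∀ x ∈ Ω, 0 ≤ V x ∧ V x * dista Ω x ^ 2 ≤ a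

/-- Lipschitz domain: open, connected, and near every boundary point, after an
orthogonal change of coordinates, the domain is the region above the graph of a
Lipschitz function. -/
def IsLipschitzDomain {N : ℕ} (Ω : Set (ES N)) : Prop :=
  IsOpen Ω ∧ IsConnected Ω ∧
    ∀ z ∈ frontier Ω, ∃ (g : ES N ≃ₗᵢ[ℝ] ES N) (i : Fin N) (f : ES N → ℝ)
      (L : ℝ≥0) (ε : ℝ), 0 < ε ∧ LipschitzWith L f ∧
      (∀ x w : ES N, (∀ j, j ≠ i → x j = w j) → f x = f w) ∧
      ∀ x ∈ ball z ε, (x ∈ Ω ↔ f (g x) < g x i)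

/-- `Ω` has a `C^{1,α}` boundary near `y`. -/
def IsC1AlphaNear {N : ℕ} (Ω : Set (ES N)) (α : ℝ) (y : ES N) : Prop :=
  ∃ (g : ES N ≃ₗᵢ[ℝ] ES N) (i : Fin N) (f : ES N → ℝ) (C : ℝ≥0) (ε : ℝ),
    0 < ε ∧ ContDiff ℝ 1 f ∧ HolderWith C α.toNNReal (fderiv ℝ f) ∧
    (∀ x w : ES N, (∀ j, j ≠ i → x j = w j) → f x = f w) ∧
    ∀ x ∈ ball y ε, (x ∈ Ω ↔ f (g x) < g x i)

/-- `K` is the `L_V`-Martin kernel of `Ω` with pole `y ∈ ∂Ω`, normalized at `x₀`: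
the unique positive `L_V`-harmonic function vanishing on `∂Ω ∖ {y}` with `K x₀ = 1`. -/
def IsMartinKernel {N : ℕ} (Ω : Set (ES N)) (V : ES N → ℝ) (x₀ y : ES N)
    (K : ES N → ℝ) : Prop :=
  LVHarmonic Ω V K ∧ (∀ x ∈ Ω, 0 < K x) ∧ K x₀ = 1 ∧
    ∀ z ∈ frontier Ω, z ≠ y → Tendsto K (𝓝[Ω] z) (𝓝 0)

/-- `G` is the `L_V`-Green function of `Ω` with pole `y ∈ Ω`:
positive, vanishing at the boundary, and `L_V G = -δ_y` weakly. -/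
def IsGreenFunction {N : ℕ} (Ω : Set (ES N)) (V : ES N → ℝ) (y : ES N)
    (G : ES N → ℝ) : Prop :=
  ContinuousOn G (Ω \ {y}) ∧ (∀ x ∈ Ω \ {y}, 0 < G x) ∧ LocallyIntegrableOn G Ω ∧
    (∀ z ∈ frontier Ω, Tendsto G (𝓝[Ω \ {y}] z) (𝓝 0)) ∧
    ∀ φ, IsTestFun Ω φ → ∫ x in Ω, G x * (lap φ x - V x * φ x) = -φ y

/-- `y ∈ ∂Ω` is finely regular w.r.t. `V`, `Ky` being the classical Martin kernel at
`y`: the greatest `L_V`-harmonic minorant of `Ky` is positive, equivalently `Ky`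
admits a positive `L_V`-harmonic minorant. -/
def FinelyRegular {N : ℕ} (Ω : Set (ES N)) (V Ky : ES N → ℝ) : Prop :=
  ∃ h, LVHarmonic Ω V h ∧ (∀ x ∈ Ω, 0 < h x) ∧ ∀ x ∈ Ω, h x ≤ Ky x

/-- `h` is the greatest nonnegative `L_V`-harmonic minorant of `w` in `Ω`. -/
def IsGreatestLVHarmMinorant {N : ℕ} (Ω : Set (ES N)) (V w h : ES N → ℝ) : Prop :=
  LVHarmonic Ω V h ∧ (∀ x ∈ Ω, 0 ≤ h x ∧ h x ≤ w x) ∧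
    ∀ g, LVHarmonic Ω V g → (∀ x ∈ Ω, 0 ≤ g x ∧ g x ≤ w x) → ∀ x ∈ Ω, g x ≤ h x

/-- Classical superharmonicity via the sub-mean value property. -/
def IsSuperharmonicOn {N : ℕ} (W : Set (ES N)) (s : ES N → ℝ) : Prop :=
  LowerSemicontinuousOn s W ∧ LocallyIntegrableOn s W ∧
    ∀ x ∈ W, ∀ t > (0:ℝ), closedBall x t ⊆ W → ⨍ z in ball x t, s z ≤ s x

/-- The réduite of `w` over `A` in `W`: infimum of the nonnegative superharmonic
functions in `W` dominating `w` on `A`. -/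
def reduite {N : ℕ} (W : Set (ES N)) (w : ES N → ℝ) (A : Set (ES N)) (x : ES N) : ℝ :=
  sInf {v | ∃ s : ES N → ℝ, IsSuperharmonicOn W s ∧ (∀ z ∈ W, 0 ≤ s z) ∧
    (∀ z ∈ A, w z ≤ s z) ∧ v = s x}

/-- The lower semicontinuous regularization `R̂` of the réduite. -/
def reduiteReg {N : ℕ} (W : Set (ES N)) (w : ES N → ℝ) (A : Set (ES N)) (x : ES N) : ℝ :=
  liminf (reduite W w A) (𝓝[W] x)

/-- Nontangential approach region at `y` with aperture `κ`. -/
def ntRegion {N : ℕ} (Ω : Set (ES N)) (y : ES N) (κ : ℝ) : Set (ES N) :=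
  {x | x ∈ Ω ∧ dist x y ≤ κ * dista Ω x}

/-- `g` tends to `l` nontangentially at `y`. -/
def TendstoNT {N : ℕ} (Ω : Set (ES N)) (g : ES N → ℝ) (y : ES N) (l : Filter ℝ) : Prop :=
  ∀ κ > (0:ℝ), Tendsto g (𝓝[ntRegion Ω y κ] y) l

/-- Truncated cone `{y + t(ν+v) : 0 < t ≤ η, ‖v‖ ≤ η}` with vertex `y`. -/
def truncCone {N : ℕ} (y ν : ES N) (η : ℝ) : Set (ES N) :=
  {x | ∃ (t : ℝ) (v : ES N), 0 < t ∧ t ≤ η ∧ ‖v‖ ≤ η ∧ x = y + t • (ν + v)}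

/-- Last coordinate of a point of `ℝ^{n+1}`. -/
def lastC {n : ℕ} (x : ES (n + 1)) : ℝ := x (Fin.last n)

/-- First `n` coordinates of a point of `ℝ^{n+1}`. -/
def firstC {n : ℕ} (x : ES (n + 1)) : ES n :=
  (EuclideanSpace.equiv (Fin n) ℝ).symm fun i => x i.castSucc

/-- The region `U_f(r,ρ) = {(x',x_N) : |x'| < r, f(x') < x_N < ρ}`. -/
def Ucyl {n : ℕ} (f : ES n → ℝ) (r ρ : ℝ) : Set (ES (n + 1)) :=
  {x | ‖firstC x‖ < r ∧ f (firstC x) < lastC x ∧ lastC x < ρ}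

/-- The cylinder `T(t) = B_{N-1}(0,tr) × (-tρ, tρ)`. -/
def Tcyl (n : ℕ) (r ρ t : ℝ) : Set (ES (n + 1)) :=
  {x | ‖firstC x‖ < t * r ∧ |lastC x| < t * ρ}

/-- The graph part `∂_#U` of the boundary of `U_f(r,ρ)`. -/
def graphBdry {n : ℕ} (f : ES n → ℝ) (r ρ : ℝ) : Set (ES (n + 1)) :=
  frontier (Ucyl f r ρ) ∩ {x | ‖firstC x‖ < r ∧ lastC x = f (firstC x)}

/-- Smooth functions. -/
abbrev Sm {N : ℕ} (f : ES N → ℝ) : Prop := ContDiff ℝ (⊤ : ℕ∞) f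

/-- Smoothness at a point. -/
abbrev SmAt {N : ℕ} (f : ES N → ℝ) (x : ES N) : Prop := ContDiffAt ℝ (⊤ : ℕ∞) f x

/-- Basis vector. -/
abbrev bv {N : ℕ} (i : Fin N) : ES N := EuclideanSpace.single i 1

/-- Partial derivative. -/
def pd {N : ℕ} (i : Fin N) (f : ES N → ℝ) (x : ES N) : ℝ := fderiv ℝ f x (bv i)

lemma lap_eq {N : ℕ} (f : ES N → ℝ) (x : ES N) : lap f x = ∑ i, pd i (pd i f) x := rfl

lemma SmAt.diff {N : ℕ} {f : ES N → ℝ} {x : ES N} (h : SmAt f x) : DifferentiableAt ℝ f x :=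
  h.differentiableAt (by simp)

lemma SmAt.pd {N : ℕ} {f : ES N → ℝ} {x : ES N} (h : SmAt f x) (i : Fin N) : SmAt (pd i f) x := by
  have : ContDiffAt ℝ (⊤ : ℕ∞) (fderiv ℝ f) x := h.fderiv_right (by simp)
  exact this.clm_apply contDiffAt_const

lemma Sm.at {N : ℕ} {f : ES N → ℝ} (h : Sm f) (x : ES N) : SmAt f x := h.contDiffAt

lemma sm_iff {N : ℕ} {f : ES N → ℝ} : Sm f ↔ ∀ x, SmAt f x := contDiff_iff_contDiffAt

lemma Sm.pd {N : ℕ} {f : ES N → ℝ} (h : Sm f) (i : Fin N) : Sm (pd i f) :=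
  sm_iff.2 fun x => (h.at x).pd i

lemma SmAt.lap {N : ℕ} {f : ES N → ℝ} {x : ES N} (h : SmAt f x) : SmAt (lap f) x := by
  have : ContDiffAt ℝ (⊤ : ℕ∞) (fun x => ∑ i, Anc.pd i (Anc.pd i f) x) x :=
    ContDiffAt.sum fun i _ => (h.pd i).pd i
  exact this

lemma Sm.lap {N : ℕ} {f : ES N → ℝ} (h : Sm f) : Sm (lap f) :=
  sm_iff.2 fun x => (h.at x).lap

lemma SmAt.ev {N : ℕ} {f : ES N → ℝ} {x : ES N} (h : SmAt f x) : ∀ᶠ y in 𝓝 x, DifferentiableAt ℝ f y := by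
  have h1 : ContDiffAt ℝ 1 f x := h.of_le (by exact_mod_cast le_top)
  filter_upwards [h1.eventually (by simp)] with y hy
  exact hy.differentiableAt (by simp)

lemma pd_congr {N : ℕ} {f g : ES N → ℝ} {x : ES N} (h : f =ᶠ[𝓝 x] g) (i : Fin N) :
    pd i f =ᶠ[𝓝 x] pd i g := by
  filter_upwards [h.fderiv (𝕜 := ℝ)] with y hy
  simp [pd, hy]

lemma lap_congr {N : ℕ} {f g : ES N → ℝ} {x : ES N} (h : f =ᶠ[𝓝 x] g) : lap f x = lap g x := by
  simp only [lap_eq]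
  exact Finset.sum_congr rfl fun i _ => (pd_congr (pd_congr h i) i).eq_of_nhds

lemma pd_add {N : ℕ} {f g : ES N → ℝ} {x : ES N} (i : Fin N) (hf : DifferentiableAt ℝ f x)
    (hg : DifferentiableAt ℝ g x) : pd i (fun y => f y + g y) x = pd i f x + pd i g x := by
  simp only [pd]
  rw [fderiv_fun_add hf hg]; rfl

lemma pd_cmul {N : ℕ} {f : ES N → ℝ} {x : ES N} (i : Fin N) (c : ℝ) (hf : DifferentiableAt ℝ f x) :
    pd i (fun y => c * f y) x = c * pd i f x := by
  simp only [pd]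
  rw [fderiv_const_mul hf]; rfl

lemma pd_mul {N : ℕ} {f g : ES N → ℝ} {x : ES N} (i : Fin N) (hf : DifferentiableAt ℝ f x)
    (hg : DifferentiableAt ℝ g x) : pd i (fun y => f y * g y) x = f x * pd i g x + g x * pd i f x := by
  simp only [pd]
  rw [fderiv_fun_mul hf hg]; simp

lemma pd_comp {N : ℕ} {f : ES N → ℝ} {Φ : ℝ → ℝ} {x : ES N} (i : Fin N) (hf : DifferentiableAt ℝ f x)
    (hΦ : DifferentiableAt ℝ Φ (f x)) : pd i (fun y => Φ (f y)) x = deriv Φ (f x) * pd i f x := by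
  simp only [pd]
  have := hΦ.hasDerivAt.comp_hasFDerivAt x hf.hasFDerivAt
  have h2 : fderiv ℝ (fun y => Φ (f y)) x = deriv Φ (f x) • fderiv ℝ f x := this.fderiv
  rw [h2]; simp

lemma lap_add {N : ℕ} {f g : ES N → ℝ} {x : ES N} (hf : SmAt f x) (hg : SmAt g x) :
    lap (fun y => f y + g y) x = lap f x + lap g x := by
  simp only [lap_eq, ← Finset.sum_add_distrib]
  refine Finset.sum_congr rfl fun i _ => ?_
  have : pd i (fun y => f y + g y) =ᶠ[𝓝 x] fun y => pd i f y + pd i g y := by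
    filter_upwards [hf.ev, hg.ev] with y h1 h2 using pd_add i h1 h2
  rw [(pd_congr this i).eq_of_nhds, pd_add i (hf.pd i).diff (hg.pd i).diff]

lemma lap_cmul {N : ℕ} {f : ES N → ℝ} {x : ES N} (c : ℝ) (hf : SmAt f x) :
    lap (fun y => c * f y) x = c * lap f x := by
  simp only [lap_eq, Finset.mul_sum]
  refine Finset.sum_congr rfl fun i _ => ?_
  have : pd i (fun y => c * f y) =ᶠ[𝓝 x] fun y => c * pd i f y := by
    filter_upwards [hf.ev] with y h1 using pd_cmul i c h1
  rw [(pd_congr this i).eq_of_nhds, pd_cmul i c (hf.pd i).diff]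

lemma lap_sub {N : ℕ} {f g : ES N → ℝ} {x : ES N} (hf : SmAt f x) (hg : SmAt g x) :
    lap (fun y => f y - g y) x = lap f x - lap g x := by
  have h1 : SmAt (fun y => (-1) * g y) x := contDiffAt_const.mul hg
  have := lap_add hf h1
  rw [lap_cmul _ hg] at this
  simpa [sub_eq_add_neg] using this

/-- Squared norm of the gradient. -/
def gsq {N : ℕ} (f : ES N → ℝ) (x : ES N) : ℝ := ∑ i, (pd i f x) ^ 2

lemma gsq_nonneg {N : ℕ} (f : ES N → ℝ) (x : ES N) : 0 ≤ gsq f x :=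
  Finset.sum_nonneg fun _ _ => sq_nonneg _

lemma lap_comp {N : ℕ} {f : ES N → ℝ} {Φ : ℝ → ℝ} {x : ES N} (hf : SmAt f x)
    (hΦ : ContDiff ℝ (⊤ : ℕ∞) Φ) :
    lap (fun y => Φ (f y)) x = deriv (deriv Φ) (f x) * gsq f x + deriv Φ (f x) * lap f x := by
  simp only [lap_eq, gsq, Finset.mul_sum, ← Finset.sum_add_distrib]
  refine Finset.sum_congr rfl fun i _ => ?_
  have hd : Differentiable ℝ Φ := hΦ.differentiable (by simp)
  have hd2 : ContDiff ℝ (⊤ : ℕ∞) (deriv Φ) := (contDiff_infty_iff_deriv.1 hΦ).2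
  have : pd i (fun y => Φ (f y)) =ᶠ[𝓝 x] fun y => deriv Φ (f y) * pd i f y := by
    filter_upwards [hf.ev] with y h1 using pd_comp i h1 (hd _)
  rw [(pd_congr this i).eq_of_nhds]
  have h3 : SmAt (fun y => deriv Φ (f y)) x := hd2.contDiffAt.comp x hf
  rw [pd_mul (f := fun y => deriv Φ (f y)) i h3.diff (hf.pd i).diff,
    pd_comp i hf.diff (hd2.differentiable (by simp) _)]
  ring

lemma tsupport_pd {N : ℕ} (f : ES N → ℝ) (i : Fin N) : tsupport (pd i f) ⊆ tsupport f := by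
  intro x hx
  by_contra h
  have h0 : f =ᶠ[𝓝 x] fun _ => 0 := notMem_tsupport_iff_eventuallyEq.1 h
  have := pd_congr h0 i
  have h2 : pd i f =ᶠ[𝓝 x] 0 := by
    filter_upwards [this] with y hy
    rw [hy]; simp [pd]
  exact (notMem_tsupport_iff_eventuallyEq.2 h2) hx

lemma tsupport_lap {N : ℕ} (f : ES N → ℝ) : tsupport (lap f) ⊆ tsupport f := by
  intro x hx
  by_contra h
  have h0 : ∀ᶠ y in 𝓝 x, f =ᶠ[𝓝 y] fun _ => 0 :=
    (notMem_tsupport_iff_eventuallyEq.1 h).eventually_nhds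
  have h2 : lap f =ᶠ[𝓝 x] 0 := by
    filter_upwards [h0] with y hy
    rw [lap_congr hy]; simp [lap]
  exact (notMem_tsupport_iff_eventuallyEq.2 h2) hx

lemma pd_affine {N : ℕ} {f : ES N → ℝ} (a : ES N) (t : ℝ) (x : ES N) (i : Fin N)
    (hf : DifferentiableAt ℝ f (a + t • x)) :
    pd i (fun z => f (a + t • z)) x = t * pd i f (a + t • x) := by
  simp only [pd]
  have h1 : HasFDerivAt (fun z : ES N => a + t • z) (t • ContinuousLinearMap.id ℝ (ES N)) x :=
    ((hasFDerivAt_id x).const_smul t).const_add a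
  have := (hf.hasFDerivAt.comp x h1).fderiv
  have h2 : fderiv ℝ (fun z => f (a + t • z)) x = (fderiv ℝ f (a + t • x)).comp (t • ContinuousLinearMap.id ℝ (ES N)) := this
  rw [h2]; simp

lemma lap_affine {N : ℕ} {f : ES N → ℝ} (hf : Sm f) (a : ES N) (t : ℝ) (x : ES N) :
    lap (fun z => f (a + t • z)) x = t ^ 2 * lap f (a + t • x) := by
  simp only [lap_eq, Finset.mul_sum]
  refine Finset.sum_congr rfl fun i _ => ?_
  have h1 : pd i (fun z => f (a + t • z)) = fun z => t * pd i f (a + t • z) := by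
    funext z; exact pd_affine a t z i (hf.at _).diff
  have h2 : Differentiable ℝ (fun z : ES N => a + t • z) := by fun_prop
  have h3 : Differentiable ℝ (pd i f) := (hf.pd i).differentiable (by simp)
  rw [h1, pd_cmul (f := fun z => pd i f (a + t • z)) i t (h3.comp h2 x), pd_affine a t x i (h3 _)]
  ring

/-- integration by parts against a compactly supported function -/
lemma ibp {N : ℕ} {f g : ES N → ℝ} (hf : Sm f) (hg : Sm g) (hc : HasCompactSupport g) (i : Fin N) :
    ∫ x, f x * pd i g x = - ∫ x, pd i f x * g x := by
  have hgi : HasCompactSupport (pd i g) := hc.of_isClosed_subset (isClosed_tsupport _) (tsupport_pd g i)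
  refine integral_mul_fderiv_eq_neg_fderiv_mul_of_integrable ?_ ?_ ?_ ?_ ?_
  · exact ((hf.pd i).continuous.mul hg.continuous).integrable_of_hasCompactSupport hc.mul_left
  · exact (hf.continuous.mul (hg.pd i).continuous).integrable_of_hasCompactSupport hgi.mul_left
  · exact (hf.continuous.mul hg.continuous).integrable_of_hasCompactSupport hc.mul_left
  · exact fun x _ => (hf.at x).diff
  · exact fun x _ => (hg.at x).diff

lemma hcs_pd {N : ℕ} {g : ES N → ℝ} (hc : HasCompactSupport g) (i : Fin N) : HasCompactSupport (pd i g) :=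
  hc.of_isClosed_subset (isClosed_tsupport _) (tsupport_pd g i)

lemma hcs_lap {N : ℕ} {g : ES N → ℝ} (hc : HasCompactSupport g) : HasCompactSupport (lap g) :=
  hc.of_isClosed_subset (isClosed_tsupport _) (tsupport_lap g)

/-- first Green identity -/
lemma green1 {N : ℕ} {f g : ES N → ℝ} (hf : Sm f) (hg : Sm g) (hc : HasCompactSupport g) :
    ∫ x, ∑ i, pd i f x * pd i g x = - ∫ x, lap f x * g x := by
  rw [integral_finsetSum]
  · simp only [lap_eq, Finset.sum_mul]
    rw [integral_finsetSum, ← Finset.sum_neg_distrib]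
    · exact Finset.sum_congr rfl fun i _ => ibp (hf.pd i) hg hc i
    · intro i _
      exact (((hf.pd i).pd i).continuous.mul hg.continuous).integrable_of_hasCompactSupport hc.mul_left
  · intro i _
    exact ((hf.pd i).continuous.mul (hg.pd i).continuous).integrable_of_hasCompactSupport
      (hcs_pd hc i).mul_left

lemma green1' {N : ℕ} {f g : ES N → ℝ} (hf : Sm f) (hg : Sm g) (hc : HasCompactSupport g) :
    ∫ x, ∑ i, pd i f x * pd i g x = - ∫ x, f x * lap g x := by
  rw [integral_finsetSum]
  · simp only [lap_eq, Finset.mul_sum]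
    rw [integral_finsetSum, ← Finset.sum_neg_distrib]
    · refine Finset.sum_congr rfl fun i _ => ?_
      rw [ibp hf (hg.pd i) (hcs_pd hc i) i, neg_neg]
    · intro i _
      exact (hf.continuous.mul ((hg.pd i).pd i).continuous).integrable_of_hasCompactSupport
        (hcs_pd (hcs_pd hc i) i).mul_left
  · intro i _
    exact ((hf.pd i).continuous.mul (hg.pd i).continuous).integrable_of_hasCompactSupport
      (hcs_pd hc i).mul_left

lemma green2 {N : ℕ} {f g : ES N → ℝ} (hf : Sm f) (hg : Sm g) (hc : HasCompactSupport g) :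
    ∫ x, lap f x * g x = ∫ x, f x * lap g x := by
  have := (green1 hf hg hc).symm.trans (green1' hf hg hc)
  linarith

/-- smooth primitive -/
lemma exists_primitive (σ : ℝ → ℝ) (hσ : ContDiff ℝ (⊤ : ℕ∞) σ) :
    ∃ Φ : ℝ → ℝ, ContDiff ℝ (⊤ : ℕ∞) Φ ∧ deriv Φ = σ ∧ Φ 0 = 0 := by
  have hd : ∀ x, HasDerivAt (fun u => ∫ t in (0:ℝ)..u, σ t) (σ x) x := fun x =>
    intervalIntegral.integral_hasDerivAt_right (hσ.continuous.intervalIntegrable _ _)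
      (hσ.continuous.stronglyMeasurableAtFilter _ _) hσ.continuous.continuousAt
  have he : deriv (fun u => ∫ t in (0:ℝ)..u, σ t) = σ := funext fun x => (hd x).deriv
  refine ⟨fun u => ∫ t in (0:ℝ)..u, σ t, ?_, he, by simp⟩
  rw [contDiff_infty_iff_deriv]
  exact ⟨fun x => (hd x).differentiableAt, by rw [he]; exact hσ⟩

/-- cut off a locally smooth function to a globally smooth compactly supported one -/
lemma exists_cutoff {N : ℕ} {f : ES N → ℝ} {V K : Set (ES N)} (hV : IsOpen V) (hK : IsCompact K)
    (hKV : K ⊆ V) (hf : ∀ x ∈ V, SmAt f x) :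
    ∃ F : ES N → ℝ, Sm F ∧ HasCompactSupport F ∧ tsupport F ⊆ V ∧ ∃ W, IsOpen W ∧ K ⊆ W ∧ W ⊆ V ∧ EqOn F f W := by
  obtain ⟨K', hK', hKK', hK'V⟩ := exists_compact_between hK hV hKV
  obtain ⟨K2, hK2, hKK2, hK2V⟩ := exists_compact_between hK' hV hK'V
  obtain ⟨χ, hχ, hχr, hχs, hχ1⟩ := exists_contMDiff_support_eq_eq_one_iff (modelWithCornersSelf ℝ (ES N))
    (isOpen_interior (s := K2)) hK'.isClosed hKK2
  have hχ' : Sm χ := by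
    have := hχ.contDiff
    exact this
  have hts : tsupport χ ⊆ K2 := by
    rw [tsupport, hχs]; exact closure_minimal interior_subset hK2.isClosed
  have hts2 : tsupport (fun x => χ x * f x) ⊆ tsupport χ := tsupport_mul_subset_left
  refine ⟨fun x => χ x * f x, ?_, ?_, (hts2.trans hts).trans hK2V, interior K', isOpen_interior, hKK', interior_subset.trans hK'V, ?_⟩
  · refine sm_iff.2 fun x => ?_
    by_cases hx : x ∈ V
    · exact (hχ'.at x).mul (hf x hx)
    · have : x ∉ tsupport (fun x => χ x * f x) := fun h => hx (hK2V (hts (hts2 h)))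
      have h0 := notMem_tsupport_iff_eventuallyEq.1 this
      exact (contDiffAt_const (c := (0:ℝ))).congr_of_eventuallyEq h0
  · exact hK2.of_isClosed_subset (isClosed_tsupport _) (hts2.trans hts)
  · intro x hx
    have : χ x = 1 := (hχ1 x).1 (interior_subset hx)
    simp [this]

/-- A radial averaging kernel `ρ` with potential `K`, `-∇K = ρ z`. -/
structure IsKer {N : ℕ} (K ρ : ES N → ℝ) : Prop where
  lip : ∃ C, LipschitzWith C K
  Kn : ∀ z, 0 ≤ K z
  Ks : ∀ z, 1 < ‖z‖ → K z = 0
  ρn : ∀ z, 0 ≤ ρ z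
  ρm : Measurable ρ
  ρb : ∃ B, ∀ z, ρ z ≤ B
  ρs : ∀ z, 1 ≤ ‖z‖ → ρ z = 0
  der : ∀ᵐ z, ∀ i : Fin N, lineDeriv ℝ K z (bv i) = - (ρ z * z i)

/-- averages -/
def mn {N : ℕ} (ρ : ES N → ℝ) (t : ℝ) (f : ES N → ℝ) (x : ES N) : ℝ := ∫ z, ρ z * f (x + t • z)

lemma fderiv_eq_sum {N : ℕ} (f : ES N → ℝ) (x z : ES N) : fderiv ℝ f x z = ∑ i, z i * pd i f x := by
  have : z = ∑ i, z i • bv i := by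
    ext j
    simp [Finset.sum_apply, bv, Pi.single_apply]
  conv_lhs => rw [this]
  simp [pd]

lemma IsKer.ρle {N : ℕ} {K ρ : ES N → ℝ} (h : IsKer K ρ) : ∃ B, 0 ≤ B ∧ ∀ z, ρ z ≤ (closedBall (0 : ES N) 1).indicator (fun _ => B) z := by
  obtain ⟨B, hB⟩ := h.ρb
  have hB0 : 0 ≤ B := (h.ρn 0).trans (hB 0)
  refine ⟨B, hB0, fun z => ?_⟩
  by_cases hz : z ∈ closedBall (0 : ES N) 1
  · rw [indicator_of_mem hz]; exact hB z
  · rw [indicator_of_notMem hz, h.ρs z]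
    simp at hz; exact hz.le

lemma IsKer.Kcs {N : ℕ} {K ρ : ES N → ℝ} (h : IsKer K ρ) : HasCompactSupport K := by
  refine HasCompactSupport.intro (isCompact_closedBall (0 : ES N) 1) fun z hz => h.Ks z ?_
  simpa using hz

lemma IsKer.Kcont {N : ℕ} {K ρ : ES N → ℝ} (h : IsKer K ρ) : Continuous K := by
  obtain ⟨C, hC⟩ := h.lip
  exact hC.continuous

lemma IsKer.ρcs {N : ℕ} {K ρ : ES N → ℝ} (h : IsKer K ρ) : HasCompactSupport ρ := by
  refine HasCompactSupport.intro (isCompact_closedBall (0 : ES N) 1) fun z hz => h.ρs z ?_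
  simp at hz; exact hz.le

lemma integrable_ind {N : ℕ} (B : ℝ) (r : ℝ) : Integrable (fun z => (closedBall (0 : ES N) r).indicator (fun _ => B) z) :=
  (integrable_indicator_iff measurableSet_closedBall).2
    (integrableOn_const (isCompact_closedBall _ _).measure_lt_top.ne)

lemma IsKer.int_mul {N : ℕ} {K ρ : ES N → ℝ} (h : IsKer K ρ) {g : ES N → ℝ} (hg : AEStronglyMeasurable g) {C : ℝ} 
    (hC : ∀ z, ‖z‖ < 1 → |g z| ≤ C) : Integrable (fun z => ρ z * g z) := by
  obtain ⟨B, hB0, hB⟩ := h.ρle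
  have := ((integrable_ind (N := N) B 1).mul_const |C|)
  refine this.mono' (h.ρm.aestronglyMeasurable.mul hg) (Eventually.of_forall fun z => ?_)
  rw [norm_mul, Real.norm_of_nonneg (h.ρn z), Real.norm_eq_abs]
  by_cases hz : ‖z‖ < 1
  · exact mul_le_mul (hB z) ((hC z hz).trans (le_abs_self _)) (abs_nonneg _) ((h.ρn z).trans (hB z))
  · rw [h.ρs z (not_lt.1 hz), zero_mul]
    exact mul_nonneg ((h.ρn z).trans (hB z)) (abs_nonneg _)

lemma IsKer.int_cont {N : ℕ} {K ρ : ES N → ℝ} (h : IsKer K ρ) {g : ES N → ℝ} (hg : Continuous g) :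
    Integrable (fun z => ρ z * g z) := by
  obtain ⟨C, hC⟩ := (isCompact_closedBall (0 : ES N) 1).exists_bound_of_continuousOn hg.continuousOn
  refine h.int_mul hg.aestronglyMeasurable (C := C) fun z hz => ?_
  exact hC z (by simpa using hz.le)

lemma mn_deriv {N : ℕ} {K ρ : ES N → ℝ} (h : IsKer K ρ) {f : ES N → ℝ} (hf : Sm f)
    (hc : HasCompactSupport f) (x : ES N) (t : ℝ) :
    HasDerivAt (fun t => mn ρ t f x) (t * mn K t (lap f) x) t := by
  have key : t * mn K t (lap f) x = ∫ z, ρ z * fderiv ℝ f (x + t • z) z := by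
    have e1 : ∀ i : Fin N, ∫ z, ρ z * z i * pd i f (x + t • z) = ∫ z, t * (K z * pd i (pd i f) (x + t • z)) := by
      intro i
      obtain ⟨C, hC⟩ := h.lip
      obtain ⟨D, hD⟩ := (hf.pd i).lipschitzWith_of_hasCompactSupport (hcs_pd hc i) (by simp)
      have haff : LipschitzWith ‖t‖₊ (fun z : ES N => x + t • z) := by
        refine LipschitzWith.of_dist_le_mul fun a b => ?_
        simp [dist_smul₀]
      have hg := hD.comp haff
      have := hg.integral_lineDeriv_mul_eq (μ := volume) hC h.Kcs (bv i)
      have e2 : ∫ z, ρ z * z i * pd i f (x + t • z) = ∫ z, lineDeriv ℝ K z (-(bv i)) * (pd i f ∘ fun z => x + t • z) z := by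
        refine integral_congr_ae ?_
        filter_upwards [h.der] with z hz
        rw [lineDeriv_neg, hz i]
        simp
      rw [e2, ← this]
      congr 1; funext z
      have h2 : Differentiable ℝ (fun z : ES N => x + t • z) := by fun_prop
      have h3 : Differentiable ℝ (pd i f) := (hf.pd i).differentiable (by simp)
      have hd : DifferentiableAt ℝ (pd i f ∘ fun z => x + t • z) z := h3.comp h2 z
      rw [hd.lineDeriv_eq_fderiv]
      have := pd_affine x t z i (h3 (x + t • z))
      have e3 : fderiv ℝ (pd i f ∘ fun z => x + t • z) z (bv i) = t * pd i (pd i f) (x + t • z) := this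
      rw [e3]; ring
    have e4 : ∀ z, ρ z * fderiv ℝ f (x + t • z) z = ∑ i, ρ z * z i * pd i f (x + t • z) := by
      intro z
      rw [fderiv_eq_sum, Finset.mul_sum]
      exact Finset.sum_congr rfl fun i _ => by ring
    simp_rw [e4]
    have haffc : Continuous (fun z : ES N => x + t • z) := by fun_prop
    rw [integral_finsetSum]
    · simp_rw [e1]
      rw [← integral_finsetSum]
      · rw [mn, ← integral_const_mul]
        congr 1; funext z
        rw [lap_eq, Finset.mul_sum, Finset.mul_sum]
      · intro i _
        refine Integrable.const_mul ?_ _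
        exact (h.Kcont.mul (((hf.pd i).pd i).continuous.comp haffc)).integrable_of_hasCompactSupport
          h.Kcs.mul_right
    · intro i _
      have : Continuous fun z : ES N => z i * pd i f (x + t • z) := by
        have := (hf.pd i).continuous.comp haffc
        have h2 : Continuous fun z : ES N => z i := by fun_prop
        exact h2.mul this
      simpa [mul_assoc] using h.int_cont this
  rw [key]
  obtain ⟨M, hM⟩ : ∃ M, ∀ y, ‖fderiv ℝ f y‖ ≤ M := by
    have h1 : Continuous (fderiv ℝ f) := hf.continuous_fderiv (by simp)
    exact h1.bounded_above_of_compact_support (hc.fderiv ℝ)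
  obtain ⟨B, hB0, hB⟩ := h.ρle
  have hM0 : 0 ≤ M := (norm_nonneg _).trans (hM 0)
  have hfc : Continuous (fderiv ℝ f) := hf.continuous_fderiv (by simp)
  refine (hasDerivAt_integral_of_dominated_loc_of_deriv_le (F := fun t z => ρ z * f (x + t • z)) (F' := fun t z => ρ z * fderiv ℝ f (x + t • z) z)
    (bound := fun z => (closedBall (0 : ES N) 1).indicator (fun _ => B) z * M) (s := univ) (Filter.univ_mem) ?_ ?_ ?_ ?_ ?_ ?_).2
  · refine Eventually.of_forall fun s => h.ρm.aestronglyMeasurable.mul ?_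
    exact (hf.continuous.comp (by fun_prop)).aestronglyMeasurable
  · exact h.int_cont (hf.continuous.comp (by fun_prop))
  · refine h.ρm.aestronglyMeasurable.mul ?_
    have : Continuous fun z : ES N => fderiv ℝ f (x + t • z) z :=
      (hfc.comp (by fun_prop)).clm_apply continuous_id
    exact this.aestronglyMeasurable
  · refine Eventually.of_forall fun z s _ => ?_
    rw [norm_mul, Real.norm_of_nonneg (h.ρn z)]
    by_cases hz : 1 ≤ ‖z‖
    · rw [h.ρs z hz, zero_mul]
      exact mul_nonneg ((h.ρn z).trans (hB z)) hM0
    · refine mul_le_mul (hB z) ?_ (norm_nonneg _) ((h.ρn z).trans (hB z))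
      calc ‖fderiv ℝ f (x + s • z) z‖ ≤ ‖fderiv ℝ f (x + s • z)‖ * ‖z‖ := ContinuousLinearMap.le_opNorm _ _
        _ ≤ M * 1 := mul_le_mul (hM _) (not_le.1 hz).le (norm_nonneg _) hM0
        _ = M := mul_one M
  · exact (integrable_ind B 1).mul_const M
  · refine Eventually.of_forall fun z s _ => ?_
    have h1 : HasDerivAt (fun s : ℝ => x + s • z) z s := by
      simpa using ((hasDerivAt_id s).smul_const z).const_add x
    exact ((hf.at _).diff.hasFDerivAt.comp_hasDerivAt s h1).const_mul (ρ z)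

/-- sub mean value property -/
lemma mn_sub {N : ℕ} {K ρ : ES N → ℝ} (h : IsKer K ρ) {f : ES N → ℝ} {V : Set (ES N)} (hV : IsOpen V)
    {x : ES N} {r : ℝ} (hr : 0 < r) (hsub : closedBall x r ⊆ V) (hf : ∀ y ∈ V, SmAt f y)
    (hl : ∀ y ∈ closedBall x r, 0 ≤ lap f y) :
    f x * ∫ z, ρ z ≤ mn ρ r f x := by
  obtain ⟨F, hF, hFc, -, W, hW, hKW, -, hFW⟩ := exists_cutoff hV (isCompact_closedBall x r) hsub hf
  have hlF : ∀ y ∈ closedBall x r, 0 ≤ lap F y := by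
    intro y hy
    rw [lap_congr (hFW.eventuallyEq_of_mem (hW.mem_nhds (hKW hy)))]
    exact hl y hy
  have hmono : MonotoneOn (fun t => mn ρ t F x) (Icc 0 r) := by
    refine monotoneOn_of_deriv_nonneg (convex_Icc 0 r) ?_ ?_ ?_
    · exact fun t _ => (mn_deriv h hF hFc x t).continuousAt.continuousWithinAt
    · exact fun t _ => (mn_deriv h hF hFc x t).differentiableAt.differentiableWithinAt
    · intro t ht
      rw [interior_Icc] at ht
      rw [(mn_deriv h hF hFc x t).deriv]
      refine mul_nonneg ht.1.le (integral_nonneg fun z => ?_)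
      by_cases hz : 1 < ‖z‖
      · simp [h.Ks z hz]
      · refine mul_nonneg (h.Kn z) (hlF _ ?_)
        simp [norm_smul, abs_of_pos ht.1]
        nlinarith [ht.1, ht.2, not_lt.1 hz, norm_nonneg z]
  have := hmono (left_mem_Icc.2 hr.le) (right_mem_Icc.2 hr.le) hr.le
  have e0 : mn ρ 0 F x = f x * ∫ z, ρ z := by
    simp only [mn, zero_smul, add_zero]
    rw [integral_mul_const, hFW (hKW (mem_closedBall_self hr.le)), mul_comm]
  have e1 : mn ρ r F x = mn ρ r f x := by
    refine integral_congr_ae (Eventually.of_forall fun z => ?_)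
    by_cases hz : 1 ≤ ‖z‖
    · simp [h.ρs z hz]
    · simp only
      rw [hFW (hKW _)]
      simp [norm_smul, abs_of_pos hr]
      nlinarith [not_le.1 hz]
  simp only at this
  rw [e0, e1] at this
  exact this

lemma mn_neg {N : ℕ} {ρ : ES N → ℝ} {f : ES N → ℝ} (r : ℝ) (x : ES N) : mn ρ r (fun y => -1 * f y) x = - mn ρ r f x := by
  simp only [mn]
  rw [← integral_neg]
  congr 1; funext z; ring

/-- super mean value property -/
lemma mn_super {N : ℕ} {K ρ : ES N → ℝ} (h : IsKer K ρ) {f : ES N → ℝ} {V : Set (ES N)} (hV : IsOpen V)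
    {x : ES N} {r : ℝ} (hr : 0 < r) (hsub : closedBall x r ⊆ V) (hf : ∀ y ∈ V, SmAt f y)
    (hl : ∀ y ∈ closedBall x r, lap f y ≤ 0) :
    mn ρ r f x ≤ f x * ∫ z, ρ z := by
  have := mn_sub h (f := fun y => -1 * f y) hV hr hsub (fun y hy => contDiffAt_const.mul (hf y hy)) (fun y hy => by
    rw [lap_cmul _ (hf y (hsub hy))]; linarith [hl y hy])
  rw [mn_neg] at this
  linarith

/-- converse: super mean value implies nonpositive Laplacian. -/
lemma lap_nonpos_of_mn {N : ℕ} {K ρ : ES N → ℝ} (h : IsKer K ρ) (hK : 0 < K 0) {f : ES N → ℝ} (hf : Sm f)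
    {x : ES N} {r : ℝ} (hr : 0 < r) (hm : ∀ t, 0 < t → t < r → mn ρ t f x ≤ f x * ∫ z, ρ z) : lap f x ≤ 0 := by
  by_contra hcon
  push Not at hcon
  obtain ⟨F, hF, hFc, -, W, hW, hKW, -, hFW⟩ := exists_cutoff isOpen_univ (isCompact_closedBall x r) (subset_univ _) (fun y _ => hf.at y)
  have hlap : ∀ y ∈ closedBall x r, lap F y = lap f y := fun y hy => 
    lap_congr (hFW.eventuallyEq_of_mem (hW.mem_nhds (hKW hy)))
  have hpos : ∀ᶠ y in 𝓝 x, 0 < lap f y := (hf.lap.continuous.tendsto x).eventually (lt_mem_nhds hcon)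
  obtain ⟨s, hs, hsp⟩ := Metric.eventually_nhds_iff_ball.1 hpos
  set q := min (r/2) (s/2) with hq
  have hq0 : 0 < q := by positivity
  have hqr : q < r := (min_le_left _ _).trans_lt (by linarith)
  have hqs : q < s := (min_le_right _ _).trans_lt (by linarith)
  have hstrict : StrictMonoOn (fun t => mn ρ t F x) (Icc 0 q) := by
    refine strictMonoOn_of_deriv_pos (convex_Icc 0 q) ?_ ?_
    · exact fun t _ => (mn_deriv h hF hFc x t).continuousAt.continuousWithinAt
    · intro t ht
      rw [interior_Icc] at ht
      rw [(mn_deriv h hF hFc x t).deriv]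
      have hcont : Continuous fun z : ES N => K z * lap F (x + t • z) :=
        h.Kcont.mul (hF.lap.continuous.comp (by fun_prop))
      have hmem : ∀ z : ES N, ¬ 1 < ‖z‖ → dist (x + t • z) x ≤ q := by
        intro z hz
        simp [norm_smul, abs_of_pos ht.1]
        nlinarith [ht.1, ht.2, not_lt.1 hz, norm_nonneg z]
      refine mul_pos ht.1 (hcont.integral_pos_of_hasCompactSupport_nonneg_nonzero h.Kcs.mul_right (x := 0) (fun z => ?_) ?_)
      · by_cases hz : 1 < ‖z‖
        · simp [h.Ks z hz]
        · refine mul_nonneg (h.Kn z) ?_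
          have := hmem z hz
          rw [hlap _ (mem_closedBall.2 (by linarith))]
          exact (hsp _ (mem_ball.2 (by linarith))).le
      · simp only [smul_zero, add_zero]
        rw [hlap x (mem_closedBall_self hr.le)]
        exact (mul_pos hK hcon).ne'
  have := hstrict (left_mem_Icc.2 hq0.le) (right_mem_Icc.2 hq0.le) hq0
  have e0 : mn ρ 0 F x = f x * ∫ z, ρ z := by
    simp only [mn, zero_smul, add_zero]
    rw [integral_mul_const, hFW (hKW (mem_closedBall_self hr.le)), mul_comm]
  have e1 : mn ρ q F x = mn ρ q f x := by
    refine integral_congr_ae (Eventually.of_forall fun z => ?_)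
    by_cases hz : 1 ≤ ‖z‖
    · simp [h.ρs z hz]
    · simp only
      rw [hFW (hKW _)]
      simp [norm_smul, abs_of_pos hq0]
      nlinarith [not_le.1 hz]
  simp only at this
  rw [e0, e1] at this
  linarith [hm q hq0 hqr]


lemma mn_eq {N : ℕ} (ρ f : ES N → ℝ) {t : ℝ} (ht : 0 < t) (x : ES N) :
    mn ρ t f x = (t ^ N)⁻¹ * ∫ y, ρ (t⁻¹ • (y - x)) * f y := by
  have h1 := Measure.integral_comp_smul (μ := (volume : Measure (ES N))) (fun y => ρ (t⁻¹ • (x + y - x)) * f (x + y)) t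
  have h2 := integral_add_left_eq_self (μ := (volume : Measure (ES N))) (fun y => ρ (t⁻¹ • (y - x)) * f y) x
  rw [h2] at h1
  simp only [finrank_euclideanSpace, Fintype.card_fin, smul_eq_mul] at h1
  rw [abs_of_pos (by positivity)] at h1
  rw [← h1, mn]
  congr 1; funext z
  simp [smul_smul, ht.ne']

/-- ball kernel -/
def bρ (N : ℕ) : ES N → ℝ := (ball (0 : ES N) 1).indicator (fun _ => 1)

def bK (N : ℕ) (z : ES N) : ℝ := max ((1 - ‖z‖ ^ 2) / 2) 0

lemma lineDeriv_normsq {N : ℕ} (a b : ℝ) (z : ES N) (i : Fin N) :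
    HasLineDerivAt ℝ (fun z : ES N => a + b * ‖z‖ ^ 2) (2 * b * z i) z (bv i) := by
  have h := ((hasStrictFDerivAt_norm_sq z).hasFDerivAt.const_mul b).const_add a
  have h2 := h.hasLineDerivAt (bv i)
  have e : (b • (2 • (innerSL ℝ) z)) (bv i) = 2 * b * z i := by
    simp [bv, EuclideanSpace.inner_single_right]
    ring
  rw [← e]; exact h2

lemma isKer_ball (N : ℕ) : IsKer (bK N) (bρ N) where
  lip := by
    refine ⟨1, LipschitzWith.of_dist_le_mul fun z w => ?_⟩
    have e : ∀ z : ES N, bK N z = (1 - (min ‖z‖ 1) ^ 2) / 2 := by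
      intro z
      rw [bK]
      rcases le_total ‖z‖ 1 with h | h
      · rw [min_eq_left h, max_eq_left]
        have := norm_nonneg z
        nlinarith
      · rw [min_eq_right h, max_eq_right] <;> nlinarith
    rw [e, e]
    have h1 : |min ‖z‖ 1 - min ‖w‖ 1| ≤ |‖z‖ - ‖w‖| := by
      have := abs_min_sub_min_le_max ‖z‖ 1 ‖w‖ 1
      simpa using this
    have h2 : |‖z‖ - ‖w‖| ≤ dist z w := by rw [dist_eq_norm]; exact abs_norm_sub_norm_le z w
    have a1 : 0 ≤ min ‖z‖ 1 := by positivity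
    have a2 : 0 ≤ min ‖w‖ 1 := by positivity
    have b1 : min ‖z‖ 1 ≤ 1 := min_le_right _ _
    have b2 : min ‖w‖ 1 ≤ 1 := min_le_right _ _
    have h3 := h1.trans h2
    rw [Real.dist_eq, NNReal.coe_one, one_mul]
    have : (1 - (min ‖z‖ 1) ^ 2) / 2 - (1 - (min ‖w‖ 1) ^ 2) / 2 = - ((min ‖z‖ 1 - min ‖w‖ 1) * ((min ‖z‖ 1 + min ‖w‖ 1) / 2)) := by ring
    rw [this, abs_neg, abs_mul]
    have h4 : |(min ‖z‖ 1 + min ‖w‖ 1) / 2| ≤ 1 := by rw [abs_le]; constructor <;> linarith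
    calc _ ≤ dist z w * 1 := mul_le_mul h3 h4 (abs_nonneg _) dist_nonneg
      _ = _ := mul_one _
  Kn := fun z => le_max_right _ _
  Ks := fun z hz => max_eq_right (by nlinarith)
  ρn := fun z => indicator_nonneg (fun _ _ => zero_le_one) z
  ρm := measurable_const.indicator measurableSet_ball
  ρb := ⟨1, fun z => indicator_le_self' (fun _ _ => zero_le_one) z⟩
  ρs := fun z hz => indicator_of_notMem (by simpa using hz) _
  der := by
    rcases Nat.eq_zero_or_pos N with rfl | hN
    · exact Eventually.of_forall fun z i => i.elim0
    have : Nontrivial (ES N) := by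
      have : Nonempty (Fin N) := ⟨⟨0, hN⟩⟩
      infer_instance
    have h0 : (volume : Measure (ES N)) (sphere 0 1) = 0 := Measure.addHaar_sphere _ _ _
    have h1 : ∀ᵐ z : ES N, z ∉ sphere (0 : ES N) 1 := measure_eq_zero_iff_ae_notMem.1 h0
    filter_upwards [h1] with z hz i
    have hz' : ‖z‖ ≠ 1 := by simpa using hz
    rcases lt_or_gt_of_ne hz' with h | h
    · have hev : bK N =ᶠ[𝓝 z] fun z => 1/2 + (-(1/2)) * ‖z‖ ^ 2 := by
        filter_upwards [(continuous_norm.tendsto z).eventually (gt_mem_nhds h)] with y hy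
        rw [bK, max_eq_left]; ring
        have := norm_nonneg y
        nlinarith
      have := (lineDeriv_normsq (1/2) (-(1/2)) z i).congr_of_eventuallyEq hev
      rw [this.lineDeriv, bρ, indicator_of_mem (by simpa using h)]
      ring
    · have hev : bK N =ᶠ[𝓝 z] fun _ => 0 := by
        filter_upwards [(continuous_norm.tendsto z).eventually (lt_mem_nhds h)] with y hy
        rw [bK, max_eq_right]
        nlinarith
      have := ((hasFDerivAt_const (𝕜 := ℝ) (0:ℝ) z).hasLineDerivAt (bv i)).congr_of_eventuallyEq hev
      rw [this.lineDeriv, bρ, indicator_of_notMem (by simpa using h.le)]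
      simp

lemma bK_zero (N : ℕ) : 0 < bK N 0 := by simp [bK]

/-- volume of the unit ball -/
def vb (N : ℕ) : ℝ := volume.real (ball (0 : ES N) 1)

lemma vb_pos (N : ℕ) : 0 < vb N :=
  ENNReal.toReal_pos (measure_ball_pos _ _ one_pos).ne' measure_ball_lt_top.ne

lemma int_bρ (N : ℕ) : ∫ z, bρ N z = vb N := by
  rw [bρ, integral_indicator measurableSet_ball]
  simp [vb]

lemma vol_ball {N : ℕ} (x : ES N) {t : ℝ} (ht : 0 < t) : volume.real (ball x t) = t ^ N * vb N := by
  rw [Measure.real, Measure.addHaar_ball_of_pos _ _ ht, ENNReal.toReal_mul, vb, Measure.real]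
  simp [ENNReal.toReal_ofReal, ht.le]

lemma mn_ball {N : ℕ} (f : ES N → ℝ) {t : ℝ} (ht : 0 < t) (x : ES N) :
    mn (bρ N) t f x = (t ^ N)⁻¹ * ∫ y in ball x t, f y := by
  rw [mn_eq _ _ ht, ← integral_indicator measurableSet_ball]
  congr 2; funext y
  by_cases hy : y ∈ ball x t
  · rw [indicator_of_mem hy, bρ, indicator_of_mem, one_mul]
    rw [mem_ball, dist_eq_norm] at hy
    simp [norm_smul, abs_of_pos ht]
    rw [inv_mul_lt_one₀ ht]; exact hy
  · rw [indicator_of_notMem hy, bρ, indicator_of_notMem, zero_mul]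
    rw [mem_ball, dist_eq_norm] at hy
    simp [norm_smul, abs_of_pos ht]
    rw [one_le_inv_mul₀ ht]; exact not_lt.1 hy

lemma avg_ball {N : ℕ} (f : ES N → ℝ) {t : ℝ} (ht : 0 < t) (x : ES N) :
    mn (bρ N) t f x = vb N * ⨍ y in ball x t, f y := by
  rw [mn_ball f ht, setAverage_eq, vol_ball x ht]
  have := vb_pos N
  simp; field_simp

lemma exists_mol (N : ℕ) : ∃ K ρ : ES N → ℝ, IsKer K ρ ∧ Sm ρ ∧ ∫ z, ρ z = 1 ∧ (∀ z, ρ (-z) = ρ z) ∧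
    (∀ z, ‖z‖ < 1 → 0 < ρ z) ∧ Sm K := by
  obtain ⟨E, hE, hE', hE0⟩ := exists_primitive expNegInvGlue expNegInvGlue.contDiff
  have hEd : ∀ s, HasDerivAt E (expNegInvGlue s) s := fun s => by
    rw [← hE']; exact (hE.differentiable (by simp) s).hasDerivAt
  have hEm : Monotone E := monotone_of_deriv_nonneg (hE.differentiable (by simp)) (fun s => by
    rw [hE']; exact expNegInvGlue.nonneg s)
  have hEneg : ∀ s ≤ 0, E s = 0 := by
    intro s hs
    have := constant_of_has_deriv_right_zero (f := E) (a := s) (b := 0) hE.continuous.continuousOn (fun y hy => ?_) 0 (right_mem_Icc.2 hs)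
    · rw [← this, hE0]
    · have := (hEd y).hasDerivWithinAt (s := Ici y)
      rwa [expNegInvGlue.zero_of_nonpos hy.2.le] at this
  set r₀ : ES N → ℝ := fun z => expNegInvGlue (1 - ‖z‖ ^ 2) with hr₀
  have hns : Sm (fun z : ES N => 1 - ‖z‖ ^ 2) := contDiff_const.sub (contDiff_norm_sq ℝ)
  have hr₀s : Sm r₀ := expNegInvGlue.contDiff.comp hns
  have hr0 : ∀ z : ES N, 1 ≤ ‖z‖ → r₀ z = 0 := fun z hz => expNegInvGlue.zero_of_nonpos (by nlinarith)
  have hrp : ∀ z : ES N, ‖z‖ < 1 → 0 < r₀ z := fun z hz => expNegInvGlue.pos_of_pos (by nlinarith [norm_nonneg z])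
  have hcs : HasCompactSupport r₀ := by
    refine HasCompactSupport.intro (isCompact_closedBall (0 : ES N) 1) fun z hz => hr0 z ?_
    simp at hz; exact hz.le
  have hI : 0 < ∫ z, r₀ z := hr₀s.continuous.integral_pos_of_hasCompactSupport_nonneg_nonzero hcs
    (fun z => expNegInvGlue.nonneg _) (x := 0) (hrp 0 (by simp)).ne'
  set c := (∫ z, r₀ z)⁻¹ with hc
  have hc0 : 0 < c := inv_pos.2 hI
  have hKs : Sm (fun z : ES N => c / 2 * E (1 - ‖z‖ ^ 2)) := contDiff_const.mul (hE.comp hns)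
  have hK0 : ∀ z : ES N, 1 < ‖z‖ → c / 2 * E (1 - ‖z‖ ^ 2) = 0 := fun z hz => by
    rw [hEneg _ (by nlinarith), mul_zero]
  have hKcs : HasCompactSupport (fun z : ES N => c / 2 * E (1 - ‖z‖ ^ 2)) := by
    refine HasCompactSupport.intro (isCompact_closedBall (0 : ES N) 1) fun z hz => hK0 z ?_
    simpa using hz
  refine ⟨fun z => c / 2 * E (1 - ‖z‖ ^ 2), fun z => c * r₀ z, ⟨?_, ?_, hK0, ?_, ?_, ?_, ?_, ?_⟩, contDiff_const.mul hr₀s, ?_, ?_, ?_, hKs⟩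
  · exact hKs.lipschitzWith_of_hasCompactSupport hKcs (by simp)
  · intro z
    refine mul_nonneg (by positivity) ?_
    rcases le_total 0 (1 - ‖z‖ ^ 2) with h | h
    · rw [← hE0]; exact hEm h
    · rw [hEneg _ h]
  · exact fun z => mul_nonneg hc0.le (expNegInvGlue.nonneg _)
  · exact (contDiff_const.mul hr₀s : Sm _).continuous.measurable
  · obtain ⟨B, hB⟩ := (contDiff_const.mul hr₀s : Sm (fun z => c * r₀ z)).continuous.bounded_above_of_compact_support hcs.mul_left
    exact ⟨B, fun z => (le_abs_self _).trans (hB z)⟩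
  · intro z hz
    simp only [hr0 z hz, mul_zero]
  · refine Eventually.of_forall fun z i => ?_
    have h1 := lineDeriv_normsq 1 (-1) z i
    have h2 : HasDerivAt (fun t : ℝ => c / 2 * E (1 + -1 * ‖z + t • bv i‖ ^ 2)) (c / 2 * (expNegInvGlue (1 + -1 * ‖z + (0:ℝ) • bv i‖ ^ 2) * (2 * -1 * z i))) 0 :=
      ((hEd _).comp (0:ℝ) h1).const_mul _
    have h3 : HasLineDerivAt ℝ (fun z : ES N => c / 2 * E (1 - ‖z‖ ^ 2)) (-(c * r₀ z * z i)) z (bv i) := by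
      unfold HasLineDerivAt
      have e1 : (fun t : ℝ => c / 2 * E (1 + -1 * ‖z + t • bv i‖ ^ 2)) = fun t : ℝ => c / 2 * E (1 - ‖z + t • bv i‖ ^ 2) := by
        funext t; congr 2; ring
      have e2 : c / 2 * (expNegInvGlue (1 + -1 * ‖z + (0:ℝ) • bv i‖ ^ 2) * (2 * -1 * z i)) = -(c * r₀ z * z i) := by
        simp [hr₀, ← sub_eq_add_neg]; ring
      rw [e1, e2] at h2
      exact h2
    exact h3.lineDeriv
  · rw [integral_const_mul, hc, inv_mul_cancel₀ hI.ne']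
  · intro z; simp [hr₀]
  · intro z hz; exact mul_pos hc0 (hrp z hz)

def rK (N : ℕ) : ES N → ℝ := (exists_mol N).choose
def rho (N : ℕ) : ES N → ℝ := (exists_mol N).choose_spec.choose
lemma rho_spec (N : ℕ) : IsKer (rK N) (rho N) ∧ Sm (rho N) ∧ ∫ z, rho N z = 1 ∧ (∀ z, rho N (-z) = rho N z) ∧
    (∀ z, ‖z‖ < 1 → 0 < rho N z) ∧ Sm (rK N) := (exists_mol N).choose_spec.choose_spec
lemma rho_ker (N : ℕ) : IsKer (rK N) (rho N) := (rho_spec N).1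
lemma rho_sm (N : ℕ) : Sm (rho N) := (rho_spec N).2.1
lemma rho_int (N : ℕ) : ∫ z, rho N z = 1 := (rho_spec N).2.2.1
lemma rho_even {N : ℕ} (z : ES N) : rho N (-z) = rho N z := (rho_spec N).2.2.2.1 z
lemma rho_pos {N : ℕ} (z : ES N) (hz : ‖z‖ < 1) : 0 < rho N z := (rho_spec N).2.2.2.2.1 z hz


/-- bounded measurable compactly supported functions -/
structure BM {N : ℕ} (f : ES N → ℝ) : Prop where
  meas : Measurable f
  bdd : ∃ C, ∀ x, |f x| ≤ C
  supp : ∃ R : ℝ, ∀ x, R < ‖x‖ → f x = 0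

lemma BM.integrable {N : ℕ} {f : ES N → ℝ} (h : BM f) : Integrable f := by
  obtain ⟨C, hC⟩ := h.bdd
  obtain ⟨R, hR⟩ := h.supp
  refine (integrable_ind C R).mono' h.meas.aestronglyMeasurable (Eventually.of_forall fun z => ?_)
  by_cases hz : z ∈ closedBall (0 : ES N) R
  · rw [indicator_of_mem hz]; exact hC z
  · rw [indicator_of_notMem hz, hR z (by simpa using hz)]; simp

lemma BM.of_cs {N : ℕ} {f : ES N → ℝ} (h : Continuous f) (hc : HasCompactSupport f) : BM f := by
  refine ⟨h.measurable, h.bounded_above_of_compact_support hc, ?_⟩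
  obtain ⟨R, hR⟩ := hc.isBounded.subset_closedBall (0 : ES N)
  refine ⟨R, fun x hx => image_eq_zero_of_notMem_tsupport fun hx' => ?_⟩
  have := hR hx'
  simp at this; linarith

lemma IsKer.int_bm {N : ℕ} {K ρ : ES N → ℝ} (h : IsKer K ρ) {f : ES N → ℝ} (hf : BM f) (t : ℝ) (x : ES N) :
    Integrable (fun z => ρ z * f (x + t • z)) := by
  obtain ⟨C, hC⟩ := hf.bdd
  exact h.int_mul (hf.meas.comp (by fun_prop)).aestronglyMeasurable (C := C) fun z _ => hC _

/-- mollification -/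
def ml {N : ℕ} (ε : ℝ) (f : ES N → ℝ) (x : ES N) : ℝ := mn (rho N) ε f x

lemma mn_sm {N : ℕ} {ρ : ES N → ℝ} (hρ : Sm ρ) (hρc : HasCompactSupport ρ) (he : ∀ z, ρ (-z) = ρ z) {f : ES N → ℝ}
    (hf : LocallyIntegrable f) {ε : ℝ} (hε : 0 < ε) : Sm (mn ρ ε f) := by
  have hcs : HasCompactSupport (fun w : ES N => ρ (ε⁻¹ • w)) := hρc.comp_smul (inv_pos.2 hε).ne'
  have hk : ContDiff ℝ (⊤ : ℕ∞) (fun w : ES N => ρ (ε⁻¹ • w)) := hρ.comp (contDiff_const_smul _)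
  have := hcs.contDiff_convolution_right (ContinuousLinearMap.mul ℝ ℝ) (μ := volume) hf hk
  have h2 : Sm (fun x => (ε ^ N)⁻¹ * (convolution f (fun w : ES N => ρ (ε⁻¹ • w)) (ContinuousLinearMap.mul ℝ ℝ) volume) x) :=
    contDiff_const.mul this
  convert h2 using 1
  funext x
  rw [mn_eq _ _ hε, convolution]
  congr 2; funext y
  rw [ContinuousLinearMap.mul_apply', mul_comm, ← he, ← smul_neg, neg_sub]

lemma ml_sm {N : ℕ} {f : ES N → ℝ} (hf : LocallyIntegrable f) {ε : ℝ} (hε : 0 < ε) : Sm (ml ε f) :=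
  mn_sm (rho_sm N) (rho_ker N).ρcs rho_even hf hε

lemma mn_pd {N : ℕ} {K ρ : ES N → ℝ} (h : IsKer K ρ) {f : ES N → ℝ} (hf : Sm f)
    (hc : HasCompactSupport f) (t : ℝ) (i : Fin N) (x : ES N) :
    pd i (mn ρ t f) x = mn ρ t (pd i f) x := by
  obtain ⟨M, hM⟩ : ∃ M, ∀ y, ‖fderiv ℝ f y‖ ≤ M := by
    have h1 : Continuous (fderiv ℝ f) := hf.continuous_fderiv (by simp)
    exact h1.bounded_above_of_compact_support (hc.fderiv ℝ)
  obtain ⟨B, hB0, hB⟩ := h.ρle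
  have hM0 : 0 ≤ M := (norm_nonneg _).trans (hM 0)
  have hfc : Continuous (fderiv ℝ f) := hf.continuous_fderiv (by simp)
  have hmeas : AEStronglyMeasurable (fun z : ES N => ρ z • fderiv ℝ f (x + t • z)) :=
    h.ρm.aestronglyMeasurable.smul (hfc.comp (by fun_prop : Continuous fun z : ES N => x + t • z)).aestronglyMeasurable
  have hbd : ∀ z y : ES N, ‖ρ z • fderiv ℝ f (y + t • z)‖ ≤ (closedBall (0 : ES N) 1).indicator (fun _ => B) z * M := by
    intro z y
    rw [norm_smul, Real.norm_of_nonneg (h.ρn z)]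
    exact mul_le_mul (hB z) (hM _) (norm_nonneg _) ((h.ρn z).trans (hB z))
  have hbi := (integrable_ind (N := N) B 1).mul_const M
  have key := hasFDerivAt_integral_of_dominated_of_fderiv_le (𝕜 := ℝ) (μ := (volume : Measure (ES N)))
    (F := fun x z => ρ z * f (x + t • z)) (F' := fun x z => ρ z • fderiv ℝ f (x + t • z))
    (bound := fun z => (closedBall (0 : ES N) 1).indicator (fun _ => B) z * M) (x₀ := x) (s := univ) Filter.univ_mem
    (Eventually.of_forall fun y => h.ρm.aestronglyMeasurable.mul (hf.continuous.comp (by fun_prop)).aestronglyMeasurable)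
    (h.int_cont (hf.continuous.comp (by fun_prop))) hmeas
    (Eventually.of_forall fun z y _ => hbd z y) hbi
    (Eventually.of_forall fun z y _ => by
      have h1 : HasFDerivAt (fun y : ES N => y + t • z) (ContinuousLinearMap.id ℝ (ES N)) y := (hasFDerivAt_id y).add_const _
      have h2 := (hf.at (y + t • z)).diff.hasFDerivAt.comp y h1
      simpa using h2.const_mul (ρ z))
  have e : fderiv ℝ (mn ρ t f) x = ∫ z, ρ z • fderiv ℝ f (x + t • z) := key.fderiv
  have hitg : Integrable (fun z : ES N => ρ z • fderiv ℝ f (x + t • z)) :=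
    hbi.mono' hmeas (Eventually.of_forall fun z => hbd z x)
  rw [pd, e, ContinuousLinearMap.integral_apply hitg]
  rfl

lemma ml_lap {N : ℕ} {f : ES N → ℝ} (hf : Sm f) (hc : HasCompactSupport f) (ε : ℝ) (x : ES N) :
    lap (ml ε f) x = ml ε (lap f) x := by
  have e : ∀ i : Fin N, pd i (ml ε f) = ml ε (pd i f) := fun i => funext fun y => mn_pd (rho_ker N) hf hc ε i y
  have e2 : ∀ i : Fin N, pd i (ml ε (pd i f)) x = ml ε (pd i (pd i f)) x := fun i => mn_pd (rho_ker N) (hf.pd i) (hcs_pd hc i) ε i x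
  simp only [lap_eq]
  simp_rw [e, e2, ml, mn]
  rw [← integral_finsetSum]
  · congr 1; funext z
    rw [lap_eq, Finset.mul_sum]
  · intro i _
    exact (rho_ker N).int_cont ((((hf.pd i).pd i).continuous).comp (by fun_prop))

lemma ml_congr {N : ℕ} {f g : ES N → ℝ} {ε : ℝ} (hε : 0 < ε) {x : ES N} (h : ∀ y ∈ ball x ε, f y = g y) :
    ml ε f x = ml ε g x := by
  refine integral_congr_ae (Eventually.of_forall fun z => ?_)
  by_cases hz : 1 ≤ ‖z‖
  · simp [(rho_ker N).ρs z hz]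
  · simp only
    rw [h]
    simp [norm_smul, abs_of_pos hε]
    nlinarith [not_le.1 hz]

lemma ball_sub_of_closedBall {N : ℕ} {x : ES N} {ε : ℝ} {W : Set (ES N)} (hε : 0 ≤ ε) (hW : IsOpen W) (h : closedBall x ε ⊆ W) :
    ∃ r > 0, closedBall x (ε + r) ⊆ W := by
  obtain ⟨r, hr, h2⟩ := (isCompact_closedBall x ε).exists_cthickening_subset_open hW h
  refine ⟨r, hr, ?_⟩
  rwa [cthickening_closedBall hr.le hε, add_comm] at h2

lemma ml_lap_loc {N : ℕ} {f : ES N → ℝ} {V : Set (ES N)} (hV : IsOpen V) {ε : ℝ} (hε : 0 < ε) {x : ES N} (hx : closedBall x ε ⊆ V)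
    (hf : ∀ y ∈ V, SmAt f y) : lap (ml ε f) x = ml ε (lap f) x := by
  obtain ⟨F, hF, hFc, -, W, hW, hKW, -, hFW⟩ := exists_cutoff hV (isCompact_closedBall x ε) hx hf
  obtain ⟨r, hr, hrW⟩ := ball_sub_of_closedBall hε.le hW hKW
  have e1 : ml ε f =ᶠ[𝓝 x] ml ε F := by
    filter_upwards [ball_mem_nhds x hr] with y hy
    refine ml_congr hε fun w hw => (hFW (hrW ?_)).symm
    have := dist_triangle w y x
    simp at hy hw ⊢; linarith
  rw [lap_congr e1, ml_lap hF hFc]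
  refine ml_congr hε fun y hy => ?_
  exact lap_congr (hFW.eventuallyEq_of_mem (hW.mem_nhds (hKW (ball_subset_closedBall hy))))

/-- symmetry of mollification -/
lemma ml_symm {N : ℕ} {f φ : ES N → ℝ} (hf : Integrable f) (hφ : BM φ) {ε : ℝ} (hε : 0 < ε) :
    ∫ x, ml ε f x * φ x = ∫ x, f x * ml ε φ x := by
  have hk : Integrable (fun w : ES N => rho N (ε⁻¹ • w)) := by
    have : Integrable (rho N) := (rho_sm N).continuous.integrable_of_hasCompactSupport (rho_ker N).ρcs
    exact this.comp_smul (inv_pos.2 hε).ne'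
  obtain ⟨C, hC⟩ := hφ.bdd
  have h1 := hf.convolution_integrand (ContinuousLinearMap.mul ℝ ℝ) hk
  have h2 : Integrable (fun p : ES N × ES N => f p.2 * rho N (ε⁻¹ • (p.1 - p.2)) * φ p.1) (volume.prod volume) := by
    refine Integrable.mul_bdd (c := C) h1 ?_ ?_
    · exact (hφ.meas.comp measurable_fst).aestronglyMeasurable
    · exact Eventually.of_forall fun p => hC p.1
  have h3 := integral_integral_swap (f := fun x y => f y * rho N (ε⁻¹ • (x - y)) * φ x) h2
  have e1 : ∀ x, ml ε f x * φ x = (ε ^ N)⁻¹ * ∫ y, f y * rho N (ε⁻¹ • (x - y)) * φ x := by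
    intro x
    rw [integral_mul_const, ← mul_assoc, ml, mn_eq _ _ hε]
    congr 3; funext y
    rw [mul_comm, ← rho_even, ← smul_neg, neg_sub]
  have e2 : ∀ y, f y * ml ε φ y = (ε ^ N)⁻¹ * ∫ x, f y * rho N (ε⁻¹ • (x - y)) * φ x := by
    intro y
    simp_rw [mul_assoc]
    rw [integral_const_mul, ml, mn_eq _ _ hε]
    ring
  simp_rw [e1, e2]
  rw [integral_const_mul, integral_const_mul, h3]

/-- kernels commute -/
lemma mn_comm {N : ℕ} {K ρ K' ρ' : ES N → ℝ} (h : IsKer K ρ) (h' : IsKer K' ρ') {f : ES N → ℝ} (hf : BM f) (s t : ℝ) (x : ES N) :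
    mn ρ s (mn ρ' t f) x = mn ρ' t (mn ρ s f) x := by
  obtain ⟨C, hC⟩ := hf.bdd
  have i1 : Integrable ρ := by simpa using h.int_cont (g := fun _ => 1) continuous_const
  have i2 : Integrable ρ' := by simpa using h'.int_cont (g := fun _ => 1) continuous_const
  have h2 : Integrable (fun p : ES N × ES N => ρ p.1 * ρ' p.2 * f (x + s • p.1 + t • p.2)) (volume.prod volume) := by
    refine Integrable.mul_bdd (c := C) (i1.mul_prod i2) ?_ ?_
    · exact (hf.meas.comp (by fun_prop)).aestronglyMeasurable
    · exact Eventually.of_forall fun p => hC _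
  have h3 := integral_integral_swap (f := fun z w => ρ z * ρ' w * f (x + s • z + t • w)) h2
  simp only [mn]
  simp_rw [← integral_const_mul, ← mul_assoc]
  rw [h3]
  congr 1; funext w; congr 1; funext z
  rw [mul_comm (ρ z), add_right_comm]

lemma ml_le {N : ℕ} {f : ES N → ℝ} {ε : ℝ} (hε : 0 < ε) {x : ES N} {a : ℝ} (hi : Integrable (fun z => rho N z * f (x + ε • z)))
    (h : ∀ y ∈ ball x ε, f y ≤ a) : ml ε f x ≤ a := by
  have : a = ∫ z, rho N z * a := by rw [integral_mul_const, rho_int, one_mul]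
  rw [this]
  have i1 : Integrable (rho N) := by simpa using (rho_ker N).int_cont (g := fun _ => 1) continuous_const
  refine integral_mono hi (i1.mul_const a) fun z => ?_
  by_cases hz : 1 ≤ ‖z‖
  · simp [(rho_ker N).ρs z hz]
  · refine mul_le_mul_of_nonneg_left (h _ ?_) ((rho_ker N).ρn z)
    simp [norm_smul, abs_of_pos hε]
    nlinarith [not_le.1 hz]

lemma le_ml {N : ℕ} {f : ES N → ℝ} {ε : ℝ} (hε : 0 < ε) {x : ES N} {a : ℝ} (hi : Integrable (fun z => rho N z * f (x + ε • z)))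
    (h : ∀ y ∈ ball x ε, a ≤ f y) : a ≤ ml ε f x := by
  have := ml_le (f := fun y => -1 * f y) (a := -a) hε (x := x) (by
    have := hi.neg
    refine this.congr (Eventually.of_forall fun z => ?_)
    simp) (fun y hy => by linarith [h y hy])
  rw [ml, mn_neg] at this
  rw [ml]; linarith

lemma ml_bm {N : ℕ} {f : ES N → ℝ} (hf : BM f) {ε : ℝ} (hε : 0 < ε) : BM (ml ε f) := by
  obtain ⟨C, hC⟩ := hf.bdd
  obtain ⟨R, hR⟩ := hf.supp
  refine ⟨(ml_sm hf.integrable.locallyIntegrable hε).continuous.measurable, ⟨C, fun x => abs_le.2 ⟨?_, ?_⟩⟩, R + ε, fun x hx => ?_⟩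
  · exact le_ml hε ((rho_ker N).int_bm hf _ _) fun y _ => (abs_le.1 (hC y)).1
  · exact ml_le hε ((rho_ker N).int_bm hf _ _) fun y _ => (abs_le.1 (hC y)).2
  · have : ml ε f x = ml ε (fun _ => 0) x := ml_congr hε fun y hy => hR y ?_
    · rw [this]; simp [ml, mn]
    · have h1 := norm_sub_norm_le x y
      rw [mem_ball, dist_comm, dist_eq_norm] at hy
      linarith

lemma ml_tsupport {N : ℕ} {f : ES N → ℝ} {ε : ℝ} (hε : 0 < ε) : tsupport (ml ε f) ⊆ cthickening ε (tsupport f) := by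
  refine closure_minimal (fun x hx => ?_) isClosed_cthickening
  by_contra hcon
  apply hx
  have : ml ε f x = ml ε (fun _ => 0) x := ml_congr hε fun y hy => image_eq_zero_of_notMem_tsupport fun hy' => hcon ?_
  · rw [this]; simp [ml, mn]
  · refine mem_cthickening_of_dist_le x y ε _ hy' ?_
    rw [dist_comm]; exact (mem_ball.1 hy).le

lemma ml_hcs {N : ℕ} {f : ES N → ℝ} (hc : HasCompactSupport f) {ε : ℝ} (hε : 0 < ε) : HasCompactSupport (ml ε f) :=
  hc.isCompact.cthickening.of_isClosed_subset (isClosed_tsupport _) (ml_tsupport hε)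

lemma exists_bump {N : ℕ} (x : ES N) {r : ℝ} (hr : 0 < r) : ∃ φ : ES N → ℝ, Sm φ ∧ HasCompactSupport φ ∧ tsupport φ ⊆ closedBall x r ∧
    (∀ y, 0 ≤ φ y) ∧ φ x = 1 := by
  let b : ContDiffBump x := ⟨r / 2, r, by positivity, by linarith⟩
  refine ⟨b, b.contDiff, b.hasCompactSupport, b.tsupport_eq.subset, fun y => b.nonneg, b.one_of_mem_closedBall (mem_closedBall_self (by positivity))⟩

/-- distributional sign implies sign after mollification -/
lemma ml_lap_nonneg {N : ℕ} {f : ES N → ℝ} (hf : BM f) {D : Set (ES N)} (hD : IsOpen D)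
    (h : ∀ ψ, IsTestFun D ψ → (∀ y, 0 ≤ ψ y) → 0 ≤ ∫ y, f y * lap ψ y) {ε : ℝ} (hε : 0 < ε) {x : ES N}
    (hx : closedBall x ε ⊆ D) : 0 ≤ lap (ml ε f) x := by
  by_contra hcon
  push Not at hcon
  have hs := ml_sm hf.integrable.locallyIntegrable hε
  have hev : ∀ᶠ y in 𝓝 x, lap (ml ε f) y < 0 := (hs.lap.continuous.tendsto x).eventually (gt_mem_nhds hcon)
  obtain ⟨r₁, hr₁, h1⟩ := Metric.eventually_nhds_iff_ball.1 hev
  obtain ⟨r₂, hr₂, h2⟩ := ball_sub_of_closedBall hε.le hD hx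
  set r := min (r₁ / 2) r₂ with hr
  have hr0 : 0 < r := by positivity
  have hrr1 : r < r₁ := (min_le_left _ _).trans_lt (by linarith)
  obtain ⟨φ, hφ, hφc, hφs, hφ0, hφx⟩ := exists_bump x hr0
  have e1 : ∫ y, lap (ml ε f) y * φ y = ∫ y, f y * lap (ml ε φ) y := by
    rw [green2 hs hφ hφc, ml_symm hf.integrable (BM.of_cs hφ.lap.continuous (hcs_lap hφc)) hε]
    simp_rw [ml_lap hφ hφc]
  have hφi : LocallyIntegrable φ := hφ.continuous.locallyIntegrable
  have h3 : 0 ≤ ∫ y, f y * lap (ml ε φ) y := by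
    refine h _ ⟨ml_sm hφi hε, ml_hcs hφc hε, ?_⟩ fun y => ?_
    · refine (ml_tsupport hε).trans ((cthickening_subset_of_subset _ hφs).trans ?_)
      rw [cthickening_closedBall hε.le hr0.le]
      refine (closedBall_subset_closedBall ?_).trans h2
      have := min_le_right (r₁/2) r₂
      linarith
    · exact le_ml hε ((rho_ker N).int_bm (BM.of_cs hφ.continuous hφc) _ _) fun y _ => hφ0 y
  have h4 : 0 < ∫ y, -(lap (ml ε f) y * φ y) := by
    refine Continuous.integral_pos_of_hasCompactSupport_nonneg_nonzero (x := x) (hs.lap.continuous.mul hφ.continuous).neg hφc.mul_left.neg ?_ ?_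
    · intro y
      by_cases hy : y ∈ closedBall x r
      · have := h1 y (mem_ball.2 ((mem_closedBall.1 hy).trans_lt hrr1))
        show 0 ≤ -(lap (ml ε f) y * φ y)
        nlinarith [hφ0 y]
      · have : φ y = 0 := image_eq_zero_of_notMem_tsupport fun h => hy (hφs h)
        simp [this]
    · rw [hφx]; simp; exact hcon.ne
  rw [integral_neg, e1] at h4
  linarith


lemma ml_tendsto {N : ℕ} {f : ES N → ℝ} (hf : BM f) {x : ES N} (hx : ContinuousAt f x) :
    Tendsto (fun ε => ml ε f x) (𝓝[>] 0) (𝓝 (f x)) := by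
  rw [Metric.tendsto_nhds]
  intro η hη
  obtain ⟨r, hr, h⟩ := Metric.eventually_nhds_iff_ball.1 (Metric.tendsto_nhds.1 hx (η / 2) (by positivity))
  filter_upwards [Ioo_mem_nhdsGT hr] with ε hε
  have h1 : ∀ y ∈ ball x ε, |f y - f x| ≤ η / 2 := fun y hy => by
    have := h y (ball_subset_ball hε.2.le hy)
    rw [Real.dist_eq] at this; exact this.le
  rw [Real.dist_eq, abs_lt]
  have a1 := ml_le hε.1 ((rho_ker N).int_bm hf ε x) (a := f x + η / 2) fun y hy => by linarith [(abs_le.1 (h1 y hy)).2]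
  have a2 := le_ml hε.1 ((rho_ker N).int_bm hf ε x) (a := f x - η / 2) fun y hy => by linarith [(abs_le.1 (h1 y hy)).1]
  constructor <;> linarith

lemma BM.neg {N : ℕ} {f : ES N → ℝ} (hf : BM f) : BM (fun y => -1 * f y) := by
  obtain ⟨C, hC⟩ := hf.bdd
  obtain ⟨R, hR⟩ := hf.supp
  exact ⟨hf.meas.const_mul _, ⟨C, fun x => by simpa using hC x⟩, R, fun x hx => by simp [hR x hx]⟩

lemma weyl {N : ℕ} {f : ES N → ℝ} (hf : BM f) {D : Set (ES N)} (hD : IsOpen D)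
    (h : ∀ ψ, IsTestFun D ψ → ∫ y, f y * lap ψ y = 0) :
    ∃ F : ES N → ℝ, (∀ x ∈ D, SmAt F x ∧ lap F x = 0) ∧ ∀ᵐ x, x ∈ D → f x = F x := by
  have hli := hf.integrable.locallyIntegrable
  have ha : ∀ ε > 0, ∀ x, closedBall x ε ⊆ D → lap (ml ε f) x = 0 := by
    intro ε hε x hx
    refine le_antisymm ?_ (ml_lap_nonneg hf hD (fun ψ hψ _ => (h ψ hψ).ge) hε hx)
    have := ml_lap_nonneg hf.neg hD (fun ψ hψ _ => by
      simp_rw [mul_assoc]; rw [integral_const_mul, h ψ hψ, mul_zero]) hε hx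
    have e : ml ε (fun y => -1 * f y) = fun y => -1 * ml ε f y := by
      funext y; rw [ml, mn_neg, ml]; ring
    rw [e, lap_cmul _ ((ml_sm hli hε).at x)] at this
    linarith
  have hb : ∀ ε > 0, ∀ r > 0, ∀ x, closedBall x (ε + r) ⊆ D → ml r (ml ε f) x = ml ε f x := by
    intro ε hε r hr x hx
    have hl : ∀ y ∈ closedBall x r, lap (ml ε f) y = 0 := fun y hy => ha ε hε y
      ((closedBall_subset_closedBall' (by linarith [mem_closedBall.1 hy])).trans hx)
    have h1 := mn_sub (rho_ker N) isOpen_univ hr (subset_univ _) (fun y _ => (ml_sm hli hε).at y) (fun y hy => (hl y hy).ge)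
    have h2 := mn_super (rho_ker N) isOpen_univ hr (subset_univ _) (fun y _ => (ml_sm hli hε).at y) (fun y hy => (hl y hy).le)
    rw [rho_int, mul_one] at h1 h2
    exact le_antisymm h2 h1
  have hc : ∀ ε > 0, ∀ r > 0, ∀ x, closedBall x (ε + r) ⊆ D → ml r f x = ml ε f x := by
    intro ε hε r hr x hx
    rw [← hb ε hε r hr x hx, ← hb r hr ε hε x (by rwa [add_comm])]
    exact mn_comm (rho_ker N) (rho_ker N) hf ε r x
  set F : ES N → ℝ := fun x => limUnder (𝓝[>] (0:ℝ)) (fun ε => ml ε f x) with hF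
  have hd : ∀ r > 0, ∀ x, closedBall x (2 * r) ⊆ D → F x = ml r f x := by
    intro r hr x hx
    refine Tendsto.limUnder_eq (tendsto_const_nhds.congr' ?_)
    filter_upwards [Ioo_mem_nhdsGT hr] with ε hε
    exact hc ε hε.1 r hr x ((closedBall_subset_closedBall (by linarith [hε.2])).trans hx)
  have hsm : ∀ x ∈ D, SmAt F x ∧ lap F x = 0 := by
    intro x hx
    obtain ⟨s, hs, hsD⟩ := Metric.isOpen_iff.1 hD x hx
    have hev : F =ᶠ[𝓝 x] ml (s / 4) f := by
      filter_upwards [ball_mem_nhds x (by positivity : 0 < s / 4)] with y hy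
      refine hd _ (by positivity) y (Subset.trans (fun w hw => ?_) hsD)
      have := dist_triangle w y x
      simp at hy hw ⊢; linarith
    have h1 := (ml_sm hli (by positivity : 0 < s / 4)).at x
    refine ⟨h1.congr_of_eventuallyEq hev, ?_⟩
    rw [lap_congr hev]
    exact ha _ (by positivity) x ((closedBall_subset_ball (by linarith)).trans hsD)
  refine ⟨F, hsm, ?_⟩
  have hFc : ContinuousOn F D := fun x hx => (hsm x hx).1.continuousAt.continuousWithinAt
  have key := hD.ae_eq_zero_of_integral_contDiff_smul_eq_zero (μ := volume) (f := fun x => f x - F x)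
    ((hli.locallyIntegrableOn D).sub (hFc.locallyIntegrableOn hD.measurableSet)) (fun φ hφ hφc hφD => ?_)
  · filter_upwards [key] with x hx hxD
    linarith [hx hxD]
  obtain ⟨r, hr, hrD⟩ := hφc.isCompact.exists_cthickening_subset_open hD hφD
  have hφbm := BM.of_cs hφ.continuous hφc
  obtain ⟨C, hC⟩ := hφbm.bdd
  have e1 : ∀ ε, 0 < ε → ε ≤ r / 2 → ∫ x, φ x * F x = ∫ x, f x * ml ε φ x := by
    intro ε hε hεr
    rw [← ml_symm hf.integrable hφbm hε]
    congr 1; funext x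
    by_cases hx : x ∈ tsupport φ
    · rw [hd ε hε x, mul_comm]
      refine Subset.trans (fun w hw => mem_cthickening_of_dist_le w x r _ hx ?_) hrD
      simp at hw; linarith
    · rw [image_eq_zero_of_notMem_tsupport hx]; simp
  have h1 : Tendsto (fun ε => ∫ x, f x * ml ε φ x) (𝓝[>] 0) (𝓝 (∫ x, f x * φ x)) := by
    refine tendsto_integral_filter_of_dominated_convergence (fun x => ‖f x‖ * C) ?_ ?_ (hf.integrable.norm.mul_const C) ?_
    · filter_upwards [self_mem_nhdsWithin] with ε hε
      exact (hf.meas.mul (ml_bm hφbm hε).meas).aestronglyMeasurable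
    · filter_upwards [self_mem_nhdsWithin] with ε hε
      refine Eventually.of_forall fun x => ?_
      rw [norm_mul]
      refine mul_le_mul_of_nonneg_left ?_ (norm_nonneg _)
      rw [Real.norm_eq_abs, abs_le]
      exact ⟨le_ml hε ((rho_ker N).int_bm hφbm _ _) fun y _ => (abs_le.1 (hC y)).1,
        ml_le hε ((rho_ker N).int_bm hφbm _ _) fun y _ => (abs_le.1 (hC y)).2⟩
    · exact Eventually.of_forall fun x => (ml_tendsto hφbm hφ.continuous.continuousAt).const_mul _
  have h2 : ∫ x, φ x * F x = ∫ x, f x * φ x := by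
    refine tendsto_nhds_unique (tendsto_const_nhds.congr' ?_) h1
    filter_upwards [Ioo_mem_nhdsGT (by positivity : 0 < r / 2)] with ε hε
    exact e1 ε hε.1 hε.2.le
  have hFφ : Continuous fun x => φ x * F x := by
    rw [continuous_iff_continuousAt]
    intro x
    by_cases hx : x ∈ tsupport φ
    · exact hφ.continuous.continuousAt.mul (hsm x (hφD hx)).1.continuousAt
    · have : (fun x => φ x * F x) =ᶠ[𝓝 x] fun _ => 0 := by
        filter_upwards [notMem_tsupport_iff_eventuallyEq.1 hx] with y hy
        simp [hy]
      exact continuousAt_const.congr this.symm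
  have i1 : Integrable fun x => φ x * F x := hFφ.integrable_of_hasCompactSupport hφc.mul_right
  have i2 : Integrable fun x => f x * φ x := by
    exact hf.integrable.mul_bdd (c := C) hφbm.meas.aestronglyMeasurable (Eventually.of_forall fun x => hC x)
  simp only [smul_eq_mul, mul_sub]
  rw [integral_sub _ i1, h2, sub_eq_zero]
  · congr 1; funext x; ring
  · simpa [mul_comm] using i2

lemma meas_ind {N : ℕ} {f : ES N → ℝ} {s : Set (ES N)} (hf : ContinuousOn f s) (hs : MeasurableSet s) :
    Measurable (s.indicator f) := by
  classical
  rw [← piecewise_eq_indicator]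
  exact hf.measurable_piecewise continuousOn_const hs

/-- smooth harmonic -/
def Harm {N : ℕ} (D : Set (ES N)) (u : ES N → ℝ) : Prop := ∀ x ∈ D, SmAt u x ∧ lap u x = 0

lemma harm_of_LV {N : ℕ} {Ω : Set (ES N)} (hΩ : IsOpen Ω) {h : ES N → ℝ} (hh : LVHarmonic Ω (fun _ => 0) h) : Harm Ω h := by
  intro x hx
  obtain ⟨s, hs, hsD⟩ := Metric.nhds_basis_closedBall.mem_iff.1 (hΩ.mem_nhds hx)
  have hc : ContinuousOn h (closedBall x s) := hh.1.mono hsD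
  have hbm : BM ((closedBall x s).indicator h) := by
    obtain ⟨C, hC⟩ := (isCompact_closedBall x s).exists_bound_of_continuousOn hc
    refine ⟨?_, ⟨|C|, fun y => ?_⟩, ‖x‖ + s, fun y hy => ?_⟩
    · exact meas_ind hc measurableSet_closedBall
    · by_cases hy : y ∈ closedBall x s
      · rw [indicator_of_mem hy]; exact (hC y hy).trans (le_abs_self _)
      · rw [indicator_of_notMem hy]; simp
    · refine indicator_of_notMem (fun h => ?_) _
      have := norm_sub_norm_le y x
      rw [mem_closedBall, dist_eq_norm] at h; linarith
  obtain ⟨F, hF, hae⟩ := weyl hbm (isOpen_ball (x := x) (ε := s)) (fun ψ hψ => by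
    have h1 := hh.2.2.2 ψ ⟨hψ.1, hψ.2.1, hψ.2.2.trans (ball_subset_closedBall.trans hsD)⟩
    simp only [zero_mul, integral_zero] at h1
    rw [← h1, ← integral_indicator hΩ.measurableSet]
    congr 1; funext y
    by_cases hy : y ∈ tsupport (lap ψ)
    · have hy2 := hψ.2.2 (tsupport_lap ψ hy)
      have hy3 := ball_subset_closedBall hy2
      rw [indicator_of_mem hy3, indicator_of_mem (hsD hy3)]
    · have := image_eq_zero_of_notMem_tsupport hy
      by_cases hy2 : y ∈ Ω <;> simp [this, hy2])
  have heq : EqOn h F (ball x s) := by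
    refine Measure.eqOn_open_of_ae_eq (μ := volume) ?_ isOpen_ball (hh.1.mono (ball_subset_closedBall.trans hsD)) (fun y hy => (hF y hy).1.continuousAt.continuousWithinAt)
    rw [Filter.EventuallyEq, ae_restrict_iff' measurableSet_ball]
    filter_upwards [hae] with y hy hyb
    rw [← hy hyb, indicator_of_mem (ball_subset_closedBall hyb)]
  have hev := heq.eventuallyEq_of_mem (ball_mem_nhds x hs)
  have h2 := hF x (mem_ball_self hs)
  exact ⟨h2.1.congr_of_eventuallyEq hev, by rw [lap_congr hev]; exact h2.2⟩

/-- smooth truncations -/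
structure Trunc (κ : ℝ) (σ Φ Ψ : ℝ → ℝ) : Prop where
  sσ : ContDiff ℝ (⊤ : ℕ∞) σ
  sΦ : ContDiff ℝ (⊤ : ℕ∞) Φ
  sΨ : ContDiff ℝ (⊤ : ℕ∞) Ψ
  dΦ : deriv Φ = σ
  dΨ : deriv Ψ = fun t => σ t ^ 2
  σ0 : ∀ t, 0 ≤ σ t
  σ1 : ∀ t, σ t ≤ 1
  σd : ∀ t, 0 ≤ deriv σ t
  σz : ∀ t, t ≤ κ → σ t = 0
  Φz : ∀ t, t ≤ κ → Φ t = 0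
  Ψz : ∀ t, t ≤ κ → Ψ t = 0
  Φl : ∀ t, t - 2 * κ ≤ Φ t
  Φ0 : ∀ t, 0 ≤ Φ t
  Φu : ∀ t, Φ t ≤ max t 0
  Ψm : Monotone Ψ

lemma const_of_deriv {Φ : ℝ → ℝ} {κ : ℝ} (hκ : 0 ≤ κ) (hd : Differentiable ℝ Φ) (h0 : Φ 0 = 0)
    (hz : ∀ t, t ≤ κ → deriv Φ t = 0) : ∀ t, t ≤ κ → Φ t = 0 := by
  intro t ht
  have := (convex_Iic κ).is_const_of_fderivWithin_eq_zero (𝕜 := ℝ) (f := Φ) hd.differentiableOn ?_ ht (show (0:ℝ) ∈ Iic κ from hκ)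
  · rw [this, h0]
  · intro x hx
    rw [(hd x).fderivWithin ((uniqueDiffOn_Iic κ) x hx)]
    ext
    simp [hz x hx]

lemma exists_trunc {κ : ℝ} (hκ : 0 < κ) : ∃ σ Φ Ψ, Trunc κ σ Φ Ψ := by
  set σ : ℝ → ℝ := fun t => Real.smoothTransition ((t - κ) / κ) with hσ
  have sσ : ContDiff ℝ (⊤ : ℕ∞) σ := by
    apply Real.smoothTransition.contDiff.comp
    fun_prop
  have mσ : Monotone σ := by
    intro a b hab
    apply Real.smoothTransition.monotone
    gcongr
  have σz : ∀ t, t ≤ κ → σ t = 0 := fun t ht => Real.smoothTransition.zero_of_nonpos (div_nonpos_of_nonpos_of_nonneg (by linarith) hκ.le)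
  have σ0 : ∀ t, 0 ≤ σ t := fun t => Real.smoothTransition.nonneg _
  have σ1 : ∀ t, σ t ≤ 1 := fun t => Real.smoothTransition.le_one _
  have σo : ∀ t, 2 * κ ≤ t → σ t = 1 := fun t ht => Real.smoothTransition.one_of_one_le (by rw [le_div_iff₀ hκ]; linarith)
  obtain ⟨Φ, sΦ, dΦ, Φ00⟩ := exists_primitive _ sσ
  obtain ⟨Ψ, sΨ, dΨ, Ψ00⟩ := exists_primitive _ (sσ.pow 2)
  have dfΦ : Differentiable ℝ Φ := sΦ.differentiable (by simp)
  have dfΨ : Differentiable ℝ Ψ := sΨ.differentiable (by simp)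
  have Φz := const_of_deriv hκ.le dfΦ Φ00 (fun t ht => by rw [dΦ]; exact σz t ht)
  have mΦ : Monotone Φ := monotone_of_deriv_nonneg dfΦ (fun t => by rw [dΦ]; exact σ0 t)
  have Φ0 : ∀ t, 0 ≤ Φ t := fun t => by
    rcases le_total t κ with h | h
    · rw [Φz t h]
    · rw [← Φz κ le_rfl]; exact mΦ h
  refine ⟨σ, Φ, Ψ, sσ, sΦ, sΨ, dΦ, dΨ, σ0, σ1, fun t => mσ.deriv_nonneg, σz, Φz,
    const_of_deriv hκ.le dfΨ Ψ00 (fun t ht => by rw [dΨ]; simp [σz t ht]), ?_, Φ0, ?_, ?_⟩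
  · intro t
    rcases le_total t (2 * κ) with h | h
    · exact (sub_nonpos.2 h).trans (Φ0 t)
    · have := Convex.mul_sub_le_image_sub_of_le_deriv (convex_Ici (2 * κ)) dfΦ.continuous.continuousOn dfΦ.differentiableOn
        (C := 1) (fun x hx => by rw [dΦ, σo x (interior_subset hx)]) (2 * κ) (self_mem_Ici) t h h
      linarith [Φ0 (2 * κ)]
  · intro t
    rcases le_total t 0 with h | h
    · rw [Φz t (h.trans hκ.le)]; exact le_max_right _ _
    · have := Convex.image_sub_le_mul_sub_of_deriv_le (convex_Ici (0:ℝ)) dfΦ.continuous.continuousOn dfΦ.differentiableOn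
        (C := 1) (fun x hx => by rw [dΦ]; exact σ1 x) 0 (self_mem_Ici) t h h
      rw [max_eq_left h]; linarith
  · exact monotone_of_deriv_nonneg dfΨ (fun t => by rw [dΨ]; positivity)

/-- sub-mean property w.r.t. the smooth kernel -/
def SubM {N : ℕ} (D : Set (ES N)) (p : ES N → ℝ) : Prop :=
  ∀ x t, 0 < t → closedBall x t ⊆ D → p x ≤ ml t p x

/-- positive part extended by zero -/
def pext {N : ℕ} (Ω : Set (ES N)) (w : ES N → ℝ) (x : ES N) : ℝ := Ω.indicator (fun y => max (w y) 0) x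

lemma pext_nonneg {N : ℕ} (Ω : Set (ES N)) (w : ES N → ℝ) (x : ES N) : 0 ≤ pext Ω w x :=
  indicator_nonneg (fun _ _ => le_max_right _ _) _

lemma pext_of_mem {N : ℕ} {Ω : Set (ES N)} (w : ES N → ℝ) {x : ES N} (h : x ∈ Ω) : pext Ω w x = max (w x) 0 :=
  indicator_of_mem h _

lemma pext_of_notMem {N : ℕ} {Ω : Set (ES N)} (w : ES N → ℝ) {x : ES N} (h : x ∉ Ω) : pext Ω w x = 0 :=
  indicator_of_notMem h _

lemma ml_int_cont {N : ℕ} {D : Set (ES N)} {p : ES N → ℝ} (hp : ContinuousOn p D) {x : ES N} {t : ℝ} (ht : 0 < t)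
    (hx : closedBall x t ⊆ D) : Integrable (fun z => rho N z * p (x + t • z)) := by
  have hm : Measurable ((closedBall x t).indicator p) := meas_ind (hp.mono hx) isClosed_closedBall.measurableSet
  obtain ⟨C, hC⟩ := (isCompact_closedBall x t).exists_bound_of_continuousOn (hp.mono hx)
  have hi := (rho_ker N).int_mul (g := fun z => (closedBall x t).indicator p (x + t • z))
    (hm.comp (by fun_prop)).aestronglyMeasurable (C := C) (fun z hz => by
      have : x + t • z ∈ closedBall x t := by
        simp [norm_smul, abs_of_pos ht]; nlinarith
      rw [indicator_of_mem this]; exact hC _ this)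
  refine hi.congr (Eventually.of_forall fun z => ?_)
  by_cases hz : ‖z‖ ≤ 1
  · have : x + t • z ∈ closedBall x t := by
      simp [norm_smul, abs_of_pos ht]; nlinarith
    simp only [indicator_of_mem this]
  · simp [(rho_ker N).ρs z (by linarith [not_le.1 hz])]

lemma ml_mono_cb {N : ℕ} {f g : ES N → ℝ} {x : ES N} {t : ℝ} (ht : 0 < t)
    (hf : Integrable (fun z => rho N z * f (x + t • z))) (hg : Integrable (fun z => rho N z * g (x + t • z)))
    (h : ∀ y ∈ ball x t, f y ≤ g y) : ml t f x ≤ ml t g x := by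
  refine integral_mono hf hg fun z => ?_
  by_cases hz : ‖z‖ < 1
  · have : x + t • z ∈ ball x t := by
      simp [norm_smul, abs_of_pos ht]; nlinarith
    exact mul_le_mul_of_nonneg_left (h _ this) ((rho_ker N).ρn z)
  · simp [(rho_ker N).ρs z (by linarith)]

lemma pext_sub {N : ℕ} {Ω D : Set (ES N)} (hΩ : IsOpen Ω) (hD : IsOpen D) {w : ES N → ℝ}
    (hw : ∀ x ∈ Ω ∩ D, SmAt w x ∧ 0 ≤ lap w x)
    (hb : ∀ z ∈ frontier Ω ∩ D, ∀ κ > 0, ∀ᶠ x in 𝓝[Ω] z, w x < κ) :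
    ContinuousOn (pext Ω w) D ∧ SubM D (pext Ω w) := by
  have hev : ∀ x ∈ D, x ∉ Ω → ∀ κ > 0, ∀ᶠ y in 𝓝 x, pext Ω w y < κ := by
    intro x hx hxΩ κ hκ
    by_cases hc : x ∈ closure Ω
    · have hf : x ∈ frontier Ω := by rw [hΩ.frontier_eq]; exact ⟨hc, hxΩ⟩
      have := eventually_nhdsWithin_iff.1 (hb x ⟨hf, hx⟩ κ hκ)
      filter_upwards [this] with y hy
      by_cases hyΩ : y ∈ Ω
      · rw [pext_of_mem w hyΩ]; exact max_lt (hy hyΩ) hκ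
      · rw [pext_of_notMem w hyΩ]; exact hκ
    · have : (closure Ω)ᶜ ∈ 𝓝 x := isClosed_closure.isOpen_compl.mem_nhds hc
      filter_upwards [this] with y hy
      rw [pext_of_notMem w (fun h => hy (subset_closure h))]; exact hκ
  have hcont : ContinuousOn (pext Ω w) D := by
    intro x hx
    apply ContinuousAt.continuousWithinAt
    by_cases hxΩ : x ∈ Ω
    · have : ContinuousAt (fun y => max (w y) 0) x := (hw x ⟨hxΩ, hx⟩).1.diff.continuousAt.max continuousAt_const
      refine this.congr ?_
      filter_upwards [hΩ.mem_nhds hxΩ] with y hy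
      rw [pext_of_mem w hy]
    · rw [ContinuousAt, pext_of_notMem w hxΩ, Metric.tendsto_nhds]
      intro κ hκ
      filter_upwards [hev x hx hxΩ κ hκ] with y hy
      rw [Real.dist_eq, sub_zero, abs_of_nonneg (pext_nonneg _ _ _)]; exact hy
  refine ⟨hcont, ?_⟩
  intro x t ht hxt
  have hxD : x ∈ D := hxt (mem_closedBall_self ht.le)
  have hitg := ml_int_cont hcont ht hxt
  refine le_of_forall_pos_le_add fun κ hκ => ?_
  obtain ⟨σ, Φ, Ψ, T⟩ := exists_trunc (half_pos hκ)
  set q : ES N → ℝ := fun y => Φ (pext Ω w y) with hq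
  have hΦw : ∀ y ∈ Ω, q y = Φ (w y) := by
    intro y hy
    simp only [hq, pext_of_mem w hy]
    rcases le_total (w y) 0 with h | h
    · rw [max_eq_right h, T.Φz 0 (by linarith), T.Φz _ (by linarith)]
    · rw [max_eq_left h]
  have hqs : ∀ y ∈ D, SmAt q y ∧ 0 ≤ lap q y := by
    intro y hy
    by_cases hyΩ : y ∈ Ω
    · have he : q =ᶠ[𝓝 y] fun y => Φ (w y) := by
        filter_upwards [hΩ.mem_nhds hyΩ] with u hu using hΦw u hu
      obtain ⟨h1, h2⟩ := hw y ⟨hyΩ, hy⟩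
      refine ⟨(T.sΦ.contDiffAt.comp y h1).congr_of_eventuallyEq he, ?_⟩
      rw [lap_congr he, lap_comp h1 T.sΦ, T.dΦ]
      have := gsq_nonneg w y
      have := T.σd (w y)
      have := T.σ0 (w y)
      positivity
    · have he : q =ᶠ[𝓝 y] fun y => 0 := by
        filter_upwards [hev y hy hyΩ (κ/2) (by positivity)] with u hu using T.Φz _ hu.le
      refine ⟨contDiffAt_const.congr_of_eventuallyEq he, ?_⟩
      rw [lap_congr he]; simp [lap]
  have h1 := mn_sub (rho_ker N) hD ht hxt (fun y hy => (hqs y hy).1) (fun y hy => (hqs y (hxt hy)).2)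
  rw [rho_int, mul_one] at h1
  have h2 : ml t q x ≤ ml t (pext Ω w) x := by
    refine ml_mono_cb ht (ml_int_cont (fun y hy => (hqs y hy).1.diff.continuousAt.continuousWithinAt) ht hxt) hitg ?_
    intro y _
    have := T.Φu (pext Ω w y)
    rwa [max_eq_left (pext_nonneg _ _ _)] at this
  have h3 := T.Φl (pext Ω w x)
  have h4 : q x ≤ ml t q x := h1
  simp only [hq] at h4 h2
  linarith

/-- boundary chart at `z` -/
structure Chart {N : ℕ} (Ω : Set (ES N)) (r Λ : ℝ) (z e : ES N) (t : ES N → ℝ) : Prop where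
  ne : ‖e‖ = 1
  lip : ∀ x y, |t x - t y| ≤ Λ * ‖x - y‖
  tr : ∀ x (τ : ℝ), t (x + τ • e) = t x + τ
  iff : ∀ x ∈ ball z r, (x ∈ Ω ↔ 0 < t x)

lemma Chart.mono {N : ℕ} {Ω : Set (ES N)} {r Λ r' Λ' : ℝ} {z z' e : ES N} {t : ES N → ℝ} (h : Chart Ω r Λ z e t)
    (hb : ball z' r' ⊆ ball z r) (hΛ : Λ ≤ Λ') : Chart Ω r' Λ' z' e t :=
  ⟨h.ne, fun x y => (h.lip x y).trans (by gcongr), h.tr, fun x hx => h.iff x (hb hx)⟩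

lemma Chart.cont {N : ℕ} {Ω : Set (ES N)} {r Λ : ℝ} {z e : ES N} {t : ES N → ℝ} (h : Chart Ω r Λ z e t) : Continuous t := by
  have : LipschitzWith (Real.toNNReal Λ) t := LipschitzWith.of_dist_le_mul fun x y => by
    rw [Real.dist_eq, dist_eq_norm]
    refine (h.lip x y).trans ?_
    gcongr
    exact Real.le_coe_toNNReal Λ
  exact this.continuous

lemma exists_charts {N : ℕ} {Ω : Set (ES N)} (hΩ : IsLipschitzDomain Ω) (hbd : Bornology.IsBounded Ω) :
    ∃ r Λ : ℝ, 0 < r ∧ 1 ≤ Λ ∧ ∀ z ∈ frontier Ω, ∃ e t, Chart Ω r Λ z e t := by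
  have hc : IsCompact (frontier Ω) := hbd.isCompact_closure.of_isClosed_subset isClosed_frontier frontier_subset_closure
  refine hc.induction_on (p := fun S => ∃ r Λ : ℝ, 0 < r ∧ 1 ≤ Λ ∧ ∀ z ∈ S, ∃ e t, Chart Ω r Λ z e t) ?_ ?_ ?_ ?_
  · exact ⟨1, 1, by norm_num, le_rfl, by simp⟩
  · rintro S T hST ⟨r, Λ, hr, hΛ, h⟩
    exact ⟨r, Λ, hr, hΛ, fun z hz => h z (hST hz)⟩
  · rintro S T ⟨r, Λ, hr, hΛ, h⟩ ⟨r', Λ', hr', hΛ', h'⟩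
    refine ⟨min r r', max Λ Λ', lt_min hr hr', hΛ.trans (le_max_left _ _), ?_⟩
    rintro z (hz | hz)
    · obtain ⟨e, t, H⟩ := h z hz
      exact ⟨e, t, H.mono (ball_subset_ball (min_le_left _ _)) (le_max_left _ _)⟩
    · obtain ⟨e, t, H⟩ := h' z hz
      exact ⟨e, t, H.mono (ball_subset_ball (min_le_right _ _)) (le_max_right _ _)⟩
  · intro z hz
    obtain ⟨g, i, f, L, ε, hε, hL, hi, hf⟩ := hΩ.2.2 z hz
    refine ⟨ball z (ε/2), mem_nhdsWithin_of_mem_nhds (ball_mem_nhds _ (by positivity)), ε/2, 1 + L, by positivity, by simp, ?_⟩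
    intro z' hz'
    refine ⟨g.symm (bv i), fun x => g x i - f (g x), ?_, ?_, ?_, ?_⟩
    · simp
    · intro x y
      have h1 : |g x i - g y i| ≤ ‖x - y‖ := by
        have := EuclideanSpace.norm_eq (g x - g y)
        have h2 : ‖g x - g y‖ = ‖x - y‖ := by rw [← map_sub]; exact g.norm_map _
        rw [← h2]
        simpa using PiLp.norm_apply_le (g x - g y) i
      have h3 : |f (g x) - f (g y)| ≤ L * ‖x - y‖ := by
        have h2 : ‖g x - g y‖ = ‖x - y‖ := by rw [← map_sub]; exact g.norm_map _
        have := hL.dist_le_mul (g x) (g y)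
        rwa [Real.dist_eq, dist_eq_norm, h2] at this
      calc |g x i - f (g x) - (g y i - f (g y))| = |(g x i - g y i) - (f (g x) - f (g y))| := by ring_nf
        _ ≤ |g x i - g y i| + |f (g x) - f (g y)| := abs_sub _ _
        _ ≤ _ := by linarith
    · intro x τ
      have h1 : g (x + τ • g.symm (bv i)) = g x + τ • bv i := by simp
      have h2 : f (g x + τ • bv i) = f (g x) := hi _ _ fun j hj => by simp [hj]
      simp only [h1, h2]
      simp; ring
    · intro x hx
      have : x ∈ ball z ε := by
        rw [mem_ball] at *
        linarith [dist_triangle x z' z]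
      rw [hf x this]; simp

lemma exists_nearest {N : ℕ} {Ω : Set (ES N)} (hΩ : IsOpen Ω) (hne : Ωᶜ.Nonempty) {x : ES N} (hx : x ∈ Ω) :
    ∃ z ∈ frontier Ω, ‖x - z‖ = dista Ω x := by
  obtain ⟨z, hz, h⟩ := hΩ.isClosed_compl.exists_infDist_eq_dist hne x
  refine ⟨z, ?_, by rw [dista, h, dist_eq_norm]⟩
  rw [hΩ.frontier_eq]
  refine ⟨?_, hz⟩
  by_contra hc
  have hpos : 0 < ‖x - z‖ := norm_pos_iff.2 (sub_ne_zero.2 (by rintro rfl; exact hz hx))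
  obtain ⟨ε, hε, hb⟩ := Metric.isOpen_iff.1 isClosed_closure.isOpen_compl z hc
  set s : ℝ := min (1/2) (ε / (2 * ‖x - z‖)) with hs
  have hs0 : 0 < s := by positivity
  have hs1 : s ≤ 1/2 := min_le_left _ _
  have hsε : s * ‖x - z‖ < ε := by
    have : s ≤ ε / (2 * ‖x - z‖) := min_le_right _ _
    rw [le_div_iff₀ (by positivity)] at this
    nlinarith
  have h1 : z + s • (x - z) ∈ ball z ε := by
    simp [norm_smul, abs_of_pos hs0, hsε]
  have h2 : z + s • (x - z) ∈ Ωᶜ := fun hh => hb h1 (subset_closure hh)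
  have h3 := infDist_le_dist_of_mem (x := x) h2
  rw [h, dist_eq_norm, dist_eq_norm] at h3
  have : x - (z + s • (x - z)) = (1 - s) • (x - z) := by module
  rw [this, norm_smul, Real.norm_eq_abs, abs_of_pos (by linarith)] at h3
  nlinarith

lemma dista_pos {N : ℕ} {Ω : Set (ES N)} (hΩ : IsOpen Ω) (hne : Ωᶜ.Nonempty) {x : ES N} (hx : x ∈ Ω) : 0 < dista Ω x :=
  (hΩ.isClosed_compl.notMem_iff_infDist_pos hne).1 (by simpa using hx)

lemma dista_nonneg {N : ℕ} (Ω : Set (ES N)) (x : ES N) : 0 ≤ dista Ω x := infDist_nonneg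

lemma dista_lip {N : ℕ} (Ω : Set (ES N)) (x y : ES N) : dista Ω x ≤ dista Ω y + ‖x - y‖ := by
  rw [← dist_eq_norm]; exact infDist_le_infDist_add_dist

lemma dista_ball {N : ℕ} {Ω : Set (ES N)} {x : ES N} : ball x (dista Ω x) ⊆ Ω := by
  intro y hy
  by_contra h
  have := infDist_le_dist_of_mem (x := x) (show y ∈ Ωᶜ from h)
  rw [mem_ball, dist_comm] at hy
  exact absurd hy (not_lt.2 this)

lemma dista_mem {N : ℕ} {Ω : Set (ES N)} {x : ES N} (h : 0 < dista Ω x) : x ∈ Ω :=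
  dista_ball (mem_ball_self h)

lemma dista_le {N : ℕ} {Ω : Set (ES N)} {x y : ES N} (h : y ∉ Ω) : dista Ω x ≤ ‖x - y‖ := by
  have := infDist_le_dist_of_mem (x := x) (show y ∈ Ωᶜ from h)
  rwa [dist_eq_norm] at this

lemma dista_cont {N : ℕ} (Ω : Set (ES N)) : Continuous (dista Ω) := continuous_infDist_pt _

lemma Chart.le_dista {N : ℕ} {Ω : Set (ES N)} {r Λ : ℝ} {z e : ES N} {t : ES N → ℝ} (h : Chart Ω r Λ z e t)
    (hr : 0 < r) (hΛ : 1 ≤ Λ) (hne : Ωᶜ.Nonempty) (hz : z ∉ Ω) {x : ES N} (hx : x ∈ ball z (r/2)) :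
    t x ≤ Λ * dista Ω x := by
  have hz0 : t z ≤ 0 := by
    have := h.iff z (mem_ball_self hr)
    by_contra hh
    exact hz (this.2 (not_le.1 hh))
  rw [← div_le_iff₀' (by linarith), dista, le_infDist hne]
  intro q hq
  rw [div_le_iff₀' (by linarith)]
  rw [mem_ball] at hx
  by_cases hqz : q ∈ ball z r
  · have h1 : t q ≤ 0 := by
      by_contra hh
      exact hq ((h.iff q hqz).2 (not_le.1 hh))
    have := h.lip x q
    rw [dist_eq_norm]
    linarith [le_abs_self (t x - t q)]
  · rw [mem_ball, not_lt] at hqz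
    have h1 := h.lip x z
    rw [← dist_eq_norm] at h1
    have h2 := dist_triangle q x z
    rw [dist_comm q x] at h2
    have : t x ≤ Λ * dist x z := by linarith [le_abs_self (t x - t z)]
    refine this.trans ?_
    gcongr
    linarith

/-- geometric package -/
structure Geo {N : ℕ} (Ω : Set (ES N)) (r c : ℝ) : Prop where
  op : IsOpen Ω
  ne : Ωᶜ.Nonempty
  bd : Bornology.IsBounded Ω
  conn : IsConnected Ω
  r0 : 0 < r
  c0 : 0 < c
  c1 : c ≤ 1
  ext : ∀ z ∈ frontier Ω, ∀ s, 0 < s → s ≤ r → ∃ y, ball y (c * s) ⊆ ball z s \ Ω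
  int : ∀ x ∈ Ω, dista Ω x < r → ∃ e : ES N, ‖e‖ = 1 ∧ ∀ τ, 0 ≤ τ → τ ≤ r →
    x + τ • e ∈ Ω ∧ c * (dista Ω x + τ) ≤ dista Ω (x + τ • e)

lemma compl_ne {N : ℕ} (hN : 2 ≤ N) {Ω : Set (ES N)} (hbd : Bornology.IsBounded Ω) : Ωᶜ.Nonempty := by
  by_contra h
  rw [not_nonempty_iff_eq_empty, compl_empty_iff] at h
  have : Nontrivial (ES N) := by
    have : Nonempty (Fin N) := ⟨⟨0, by omega⟩⟩
    infer_instance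
  rw [h] at hbd
  exact NormedSpace.unbounded_univ ℝ (ES N) hbd

lemma exists_geo {N : ℕ} (hN : 2 ≤ N) {Ω : Set (ES N)} (hΩ : IsLipschitzDomain Ω) (hbd : Bornology.IsBounded Ω) :
    ∃ r c, Geo Ω r c := by
  obtain ⟨r, Λ, hr, hΛ, h⟩ := exists_charts hΩ hbd
  have hne := compl_ne hN hbd
  have hop := hΩ.1
  have hfr : ∀ z ∈ frontier Ω, z ∉ Ω := fun z hz => by rw [hop.frontier_eq] at hz; exact hz.2
  refine ⟨r / (4 * (1 + Λ)), 1 / (4 * Λ), hop, hne, hbd, hΩ.2.1, by positivity, by positivity, ?_, ?_, ?_⟩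
  · rw [div_le_one (by positivity)]; linarith
  · intro z hz s hs hsr
    obtain ⟨e, t, H⟩ := h z hz
    rw [le_div_iff₀ (by positivity)] at hsr
    have hz0 : t z ≤ 0 := by
      by_contra hh
      exact hfr z hz ((H.iff z (mem_ball_self hr)).2 (not_le.1 hh))
    refine ⟨z + (-(s/2)) • e, fun y hy => ?_⟩
    rw [mem_ball, dist_eq_norm] at hy
    have h1 : 1 / (4 * Λ) * s ≤ s / 4 := by
      rw [div_mul_eq_mul_div, div_le_div_iff₀ (by positivity) (by positivity)]; nlinarith
    have h2 : ‖y - z‖ ≤ ‖y - (z + (-(s/2)) • e)‖ + s / 2 := by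
      have : y - z = (y - (z + (-(s/2)) • e)) + (-(s/2)) • e := by module
      calc ‖y - z‖ ≤ ‖y - (z + (-(s/2)) • e)‖ + ‖(-(s/2)) • e‖ := by rw [this]; exact norm_add_le _ _
        _ = _ := by rw [norm_smul, H.ne, Real.norm_eq_abs, abs_neg, abs_of_pos (by positivity)]; ring
    have hyz : y ∈ ball z s := by rw [mem_ball, dist_eq_norm]; linarith
    refine ⟨hyz, fun hyΩ => ?_⟩
    have h3 := (H.iff y (ball_subset_ball (by nlinarith) hyz)).1 hyΩ
    have h4 := H.lip y (z + (-(s/2)) • e)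
    rw [H.tr] at h4
    have h5 : Λ * ‖y - (z + (-(s/2)) • e)‖ ≤ s / 4 := by
      calc Λ * ‖y - (z + (-(s/2)) • e)‖ ≤ Λ * (1 / (4 * Λ) * s) := by gcongr
        _ = s / 4 := by field_simp
    linarith [le_abs_self (t y - (t z + -(s/2)))]
  · intro x hx hxr
    obtain ⟨z, hz, hxz⟩ := exists_nearest hop hne hx
    obtain ⟨e, t, H⟩ := h z hz
    have hxr0 := hxr
    rw [lt_div_iff₀ (by positivity)] at hxr
    have hd := dista_pos hop hne hx
    have hz0 : t z ≤ 0 := by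
      by_contra hh
      exact hfr z hz ((H.iff z (mem_ball_self hr)).2 (not_le.1 hh))
    have ht0 : 0 < t x := (H.iff x (by rw [mem_ball, dist_eq_norm, hxz]; nlinarith)).1 hx
    have ht1 : t x ≤ Λ * dista Ω x := by
      have := H.lip x z
      rw [hxz] at this
      linarith [le_abs_self (t x - t z)]
    have ht2 : dista Ω x ≤ t x := by
      have h1 : x + (-(t x)) • e ∉ Ω := by
        intro hh
        have := (H.iff _ ?_).1 hh
        · rw [H.tr] at this; linarith
        · rw [mem_ball, dist_eq_norm]
          have : x + (-(t x)) • e - z = (x - z) + (-(t x)) • e := by module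
          rw [this]
          refine (norm_add_le _ _).trans_lt ?_
          rw [norm_smul, H.ne, Real.norm_eq_abs, abs_neg, abs_of_pos ht0, hxz]
          nlinarith
      have := dista_le (x := x) h1
      have e1 : x - (x + (-(t x)) • e) = t x • e := by module
      rwa [e1, norm_smul, H.ne, Real.norm_eq_abs, abs_of_pos ht0, mul_one] at this
    refine ⟨e, H.ne, fun τ hτ hτr => ?_⟩
    rw [le_div_iff₀ (by positivity)] at hτr
    have hb : x + τ • e ∈ ball z (r/2) := by
      rw [mem_ball, dist_eq_norm]
      have : x + τ • e - z = (x - z) + τ • e := by module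
      rw [this]
      refine (norm_add_le _ _).trans_lt ?_
      rw [norm_smul, H.ne, Real.norm_eq_abs, abs_of_nonneg hτ, hxz]
      nlinarith
    refine ⟨(H.iff _ (ball_subset_ball (by linarith) hb)).2 (by rw [H.tr]; linarith), ?_⟩
    have h6 := H.le_dista hr hΛ hne (hfr z hz) hb
    rw [H.tr] at h6
    rw [div_mul_eq_mul_div, div_le_iff₀ (by positivity)]
    have := dista_nonneg Ω (x + τ • e)
    nlinarith

lemma fderiv_sq_le {N : ℕ} (F : ES N → ℝ) (x e : ES N) (he : ‖e‖ = 1) : (fderiv ℝ F x e) ^ 2 ≤ gsq F x := by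
  rw [fderiv_eq_sum]
  refine (Finset.sum_mul_sq_le_sq_mul_sq _ _ _).trans ?_
  have : ∑ i, e i ^ 2 = 1 := by
    have := EuclideanSpace.norm_sq_eq e
    rw [he] at this
    simpa using this.symm
  rw [this, one_mul]; rfl

lemma tsupport_div {N : ℕ} (F t : ES N → ℝ) : tsupport (fun x => F x / t x) ⊆ tsupport F :=
  closure_mono fun x hx => by
    simp only [Function.mem_support] at *
    intro h; simp [h] at hx

lemma cont_div {N : ℕ} {F t : ES N → ℝ} (hF : Continuous F) (ht : Continuous t) (h : ∀ x ∈ tsupport F, 0 < t x) :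
    Continuous (fun x => F x / t x) :=
  continuous_of_tsupport fun x hx => hF.continuousAt.div ht.continuousAt (h x (tsupport_div F t hx)).ne'

lemma hcs_div {N : ℕ} {F t : ES N → ℝ} (hc : HasCompactSupport F) : HasCompactSupport (fun x => F x / t x) :=
  hc.of_isClosed_subset (isClosed_tsupport _) (tsupport_div F t)

lemma int_sq {N : ℕ} {F : ES N → ℝ} (hF : Continuous F) (hc : HasCompactSupport F) : Integrable (fun x => F x ^ 2) := by
  simp only [pow_two]
  exact (hF.mul hF).integrable_of_hasCompactSupport hc.mul_left

lemma gsq_int {N : ℕ} {F : ES N → ℝ} (hF : Sm F) (hc : HasCompactSupport F) : Integrable (gsq F) := by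
  have : Integrable (fun x => ∑ i, (pd i F x) ^ 2) :=
    integrable_finsetSum _ fun i _ => int_sq (hF.pd i).continuous (hcs_pd hc i)
  exact this

lemma hardy1 {N : ℕ} {F : ES N → ℝ} (hF : Sm F) (hc : HasCompactSupport F) {e : ES N} (he : ‖e‖ = 1) {t : ES N → ℝ}
    (ht : Continuous t) (htr : ∀ x (τ : ℝ), t (x + τ • e) = t x + τ) (hpos : ∀ x ∈ tsupport F, 0 < t x) :
    ∫ x, (F x / t x) ^ 2 ≤ 4 * ∫ x, gsq F x := by
  have hca := cont_div hF.continuous ht hpos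
  have hsa := hcs_div (t := t) hc
  have hcF' : Continuous (fun x => fderiv ℝ F x e) := by
    have := hF.continuous_fderiv (by simp)
    exact this.clm_apply continuous_const
  have i1 : Integrable (fun x => fderiv ℝ F x e * (F x / t x)) :=
    (hcF'.mul hca).integrable_of_hasCompactSupport hsa.mul_left
  have i2 := int_sq hca hsa
  have key := integral_bilinear_hasLineDerivAt_right_eq_neg_left_of_integrable (μ := volume) (f := F) (f' := fun x => fderiv ℝ F x e)
    (g := fun x => F x / t x) (g' := fun x => (fderiv ℝ F x e * t x - F x) / t x ^ 2) (v := e) (B := ContinuousLinearMap.mul ℝ ℝ)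
    i1 ?_ ?_ ?_ ?_
  · simp only [ContinuousLinearMap.mul_apply'] at key
    have e1 : (fun x => F x * ((fderiv ℝ F x e * t x - F x) / t x ^ 2)) = fun x => fderiv ℝ F x e * (F x / t x) - (F x / t x) ^ 2 := by
      funext x
      by_cases h : x ∈ tsupport F
      · have := (hpos x h).ne'
        field_simp
      · simp [image_eq_zero_of_notMem_tsupport h]
    rw [e1, integral_sub i1 i2] at key
    have h3 : ∫ x, fderiv ℝ F x e * (F x / t x) ≤ ∫ x, ((1/4) * (F x / t x) ^ 2 + gsq F x) := by
      refine integral_mono i1 ((i2.const_mul _).add (gsq_int hF hc)) fun x => ?_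
      have := fderiv_sq_le F x e he
      simp only
      nlinarith [sq_nonneg (fderiv ℝ F x e - (1/2) * (F x / t x))]
    rw [integral_add (i2.const_mul _) (gsq_int hF hc), integral_const_mul] at h3
    linarith
  · refine (i1.sub i2).congr (Eventually.of_forall fun x => ?_)
    simp only [ContinuousLinearMap.mul_apply', Pi.sub_apply]
    by_cases h : x ∈ tsupport F
    · have := (hpos x h).ne'
      field_simp
    · simp [image_eq_zero_of_notMem_tsupport h]
  · exact (hF.continuous.mul hca).integrable_of_hasCompactSupport hsa.mul_left
  · intro x _
    exact (hF.at x).diff.hasFDerivAt.hasLineDerivAt e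
  · intro x hx
    have h1 : HasDerivAt (fun τ : ℝ => F (x + τ • e)) (fderiv ℝ F x e) 0 := (hF.at x).diff.hasFDerivAt.hasLineDerivAt e
    have h2 : HasDerivAt (fun τ : ℝ => t (x + τ • e)) 1 0 := by
      simp only [htr]
      exact (hasDerivAt_id (0:ℝ)).const_add _
    have h3 := h1.div h2 (by simpa using (hpos x hx).ne')
    simp only [zero_smul, add_zero, mul_one] at h3
    exact h3

lemma gsq_mul_le {N : ℕ} {u χ : ES N → ℝ} {x : ES N} (hu : DifferentiableAt ℝ u x) (hχ : DifferentiableAt ℝ χ x) :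
    gsq (fun y => u y * χ y) x ≤ 2 * (χ x) ^ 2 * gsq u x + 2 * (u x) ^ 2 * gsq χ x := by
  simp only [gsq, Finset.mul_sum, ← Finset.sum_add_distrib]
  refine Finset.sum_le_sum fun i _ => ?_
  rw [pd_mul i hu hχ]
  nlinarith [sq_nonneg (u x * pd i χ x - χ x * pd i u x)]

/-- plateau bump -/
lemma exists_plateau {N : ℕ} (z : ES N) {r : ℝ} (hr : 0 < r) : ∃ χ : ES N → ℝ, Sm χ ∧ HasCompactSupport χ ∧ tsupport χ ⊆ closedBall z (2 * r) ∧
    (∀ y, 0 ≤ χ y ∧ χ y ≤ 1) ∧ ∀ y ∈ closedBall z r, χ y = 1 := by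
  let b : ContDiffBump z := ⟨r, 2 * r, hr, by linarith⟩
  refine ⟨b, b.contDiff, b.hasCompactSupport, ?_, fun y => ⟨b.nonneg, b.le_one⟩, fun y hy => b.one_of_mem_closedBall hy⟩
  rw [b.tsupport_eq]

lemma poincare {N : ℕ} (hN : 2 ≤ N) {Ω : Set (ES N)} (hbd : Bornology.IsBounded Ω) :
    ∃ C : ℝ, 0 < C ∧ ∀ u, IsTestFun Ω u → ∫ x, u x ^ 2 ≤ C * ∫ x, gsq u x := by
  obtain ⟨R, hR0, hR⟩ := hbd.subset_closedBall_lt 0 0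
  set i : Fin N := ⟨0, by omega⟩
  refine ⟨4 * (3 * R) ^ 2, by positivity, fun u hu => ?_⟩
  have hb : ∀ x ∈ tsupport u, |x i| ≤ R := fun x hx => by
    have h1 := hR (hu.2.2 hx)
    rw [mem_closedBall, dist_zero_right] at h1
    exact (PiLp.norm_apply_le x i).trans h1
  have h1 := hardy1 hu.1 hu.2.1 (e := bv i) (by simp) (t := fun x => x i + 2 * R) (by fun_prop)
    (fun x τ => by simp; ring) (fun x hx => by have := abs_le.1 (hb x hx); linarith)
  have hpos : ∀ x ∈ tsupport u, 0 < x i + 2 * R := fun x hx => by have := abs_le.1 (hb x hx); linarith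
  have i2 := int_sq (cont_div hu.1.continuous (t := fun x => x i + 2 * R) (by fun_prop) hpos) (hcs_div hu.2.1)
  have h2 : ∫ x, u x ^ 2 ≤ ∫ x, (3 * R) ^ 2 * (u x / (x i + 2 * R)) ^ 2 := by
    refine integral_mono (int_sq hu.1.continuous hu.2.1) (i2.const_mul _) fun x => ?_
    by_cases hx : x ∈ tsupport u
    · have h3 := hpos x hx
      have h4 : x i + 2 * R ≤ 3 * R := by have := abs_le.1 (hb x hx); linarith
      simp only
      rw [div_pow, ← mul_div_assoc, le_div_iff₀ (by positivity), mul_comm]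
      gcongr
    · simp [image_eq_zero_of_notMem_tsupport hx]
  rw [integral_const_mul] at h2
  nlinarith [sq_nonneg (3 * R)]

lemma hardy_local {N : ℕ} {Ω : Set (ES N)} {r Λ : ℝ} {z e : ES N} {t : ES N → ℝ} (h : Chart Ω r Λ z e t)
    (hr : 0 < r) (hΛ : 1 ≤ Λ) (hΩ : IsOpen Ω) (hne : Ωᶜ.Nonempty) (hz : z ∉ Ω) {F : ES N → ℝ} (hF : IsTestFun Ω F)
    (hs : tsupport F ⊆ ball z (r/2)) : ∫ x, (F x / dista Ω x) ^ 2 ≤ 4 * Λ ^ 2 * ∫ x, gsq F x := by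
  have hpos : ∀ x ∈ tsupport F, 0 < t x := fun x hx => (h.iff x (ball_subset_ball (by linarith) (hs hx))).1 (hF.2.2 hx)
  have h1 := hardy1 hF.1 hF.2.1 h.ne h.cont h.tr hpos
  have i1 := int_sq (cont_div hF.1.continuous h.cont hpos) (hcs_div hF.2.1)
  have i2 := int_sq (cont_div hF.1.continuous (dista_cont Ω) fun x hx => dista_pos hΩ hne (hF.2.2 hx)) (hcs_div hF.2.1)
  have h2 : ∫ x, (F x / dista Ω x) ^ 2 ≤ ∫ x, Λ ^ 2 * (F x / t x) ^ 2 := by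
    refine integral_mono i2 (i1.const_mul _) fun x => ?_
    by_cases hx : x ∈ tsupport F
    · have h3 := hpos x hx
      have h4 := dista_pos hΩ hne (hF.2.2 hx)
      have h5 := h.le_dista hr hΛ hne hz (hs hx)
      simp only
      rw [div_pow, div_pow, ← mul_div_assoc, div_le_div_iff₀ (by positivity) (by positivity)]
      have : t x ^ 2 ≤ (Λ * dista Ω x) ^ 2 := by gcongr
      nlinarith [sq_nonneg (F x)]
    · simp [image_eq_zero_of_notMem_tsupport hx]
  rw [integral_const_mul] at h2
  nlinarith [sq_nonneg Λ]

lemma hardy {N : ℕ} (hN : 2 ≤ N) {Ω : Set (ES N)} (hΩ : IsLipschitzDomain Ω) (hbd : Bornology.IsBounded Ω) :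
    ∃ C : ℝ, 0 < C ∧ ∀ u, IsTestFun Ω u → ∫ x, (u x / dista Ω x) ^ 2 ≤ C * ∫ x, gsq u x := by
  obtain ⟨r, Λ, hr, hΛ, hch⟩ := exists_charts hΩ hbd
  have hne := compl_ne hN hbd
  have hop := hΩ.1
  have hfr : ∀ z ∈ frontier Ω, z ∉ Ω := fun z hz => by rw [hop.frontier_eq] at hz; exact hz.2
  obtain ⟨Cp, hCp, hP⟩ := poincare hN hbd
  have hc : IsCompact (frontier Ω) := hbd.isCompact_closure.of_isClosed_subset isClosed_frontier frontier_subset_closure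
  obtain ⟨Z, hZ, hcov⟩ := hc.elim_nhds_subcover (fun z => ball z (r/16)) fun z _ => ball_mem_nhds z (by positivity)
  choose χ hχ1 hχ2 hχ3 hχ4 hχ5 using fun z : ES N => exists_plateau z (r := r/8) (by positivity)
  have hgb : ∀ z, ∃ B, ∀ x, gsq (χ z) x ≤ B := by
    intro z
    have hcg : Continuous (gsq (χ z)) := continuous_finsetSum _ fun i _ => ((hχ1 z).pd i).continuous.pow 2
    have hsg : HasCompactSupport (gsq (χ z)) := by
      refine (hχ2 z).of_isClosed_subset (isClosed_tsupport _) (closure_minimal ?_ (isClosed_tsupport _))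
      intro x hx
      by_contra hh
      apply hx
      have : ∀ i, pd i (χ z) x = 0 := fun i => image_eq_zero_of_notMem_tsupport fun h => hh (tsupport_pd _ i h)
      simp [gsq, this]
    obtain ⟨B, hB⟩ := hsg.exists_bound_of_continuous hcg
    exact ⟨B, fun x => (le_abs_self _).trans (hB x)⟩
  choose B hB using hgb
  have hB0 : ∀ z, 0 ≤ B z := fun z => (gsq_nonneg _ z).trans (hB z z)
  set K : ℝ := (16/r)^2 * Cp + ∑ z ∈ Z, 4 * Λ ^ 2 * (2 + 2 * B z * Cp) with hK
  have hKp : 0 < K := by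
    have : 0 ≤ ∑ z ∈ Z, 4 * Λ ^ 2 * (2 + 2 * B z * Cp) := Finset.sum_nonneg fun z _ => by have := hB0 z; positivity
    positivity
  refine ⟨K, hKp, fun u hu => ?_⟩
  have hus : Sm u := hu.1
  have huc : HasCompactSupport u := hu.2.1
  have hT : ∀ z, IsTestFun Ω (fun y => u y * χ z y) := fun z =>
    ⟨hu.1.mul (hχ1 z), huc.mul_right, (tsupport_mul_subset_left).trans hu.2.2⟩
  have hI : ∀ F, IsTestFun Ω F → Integrable (fun x => (F x / dista Ω x) ^ 2) := fun F hF =>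
    int_sq (cont_div hF.1.continuous (dista_cont Ω) fun x hx => dista_pos hop hne (hF.2.2 hx)) (hcs_div hF.2.1)
  have iu := int_sq hu.1.continuous hu.2.1
  have h1 : ∫ x, (u x / dista Ω x) ^ 2 ≤ ∫ x, ((16/r)^2 * u x ^ 2 + ∑ z ∈ Z, ((u x * χ z x) / dista Ω x) ^ 2) := by
    refine integral_mono (hI u hu) ((iu.const_mul _).add (integrable_finsetSum _ fun z _ => hI _ (hT z))) fun x => ?_
    by_cases hx : x ∈ tsupport u
    · have hxΩ := hu.2.2 hx
      have hd := dista_pos hop hne hxΩ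
      have hs0 : 0 ≤ ∑ z ∈ Z, ((u x * χ z x) / dista Ω x) ^ 2 := Finset.sum_nonneg fun z _ => sq_nonneg _
      simp only
      by_cases hdr : r/16 ≤ dista Ω x
      · have : (u x / dista Ω x) ^ 2 ≤ (16/r)^2 * u x ^ 2 := by
          rw [div_pow, div_pow, div_mul_eq_mul_div, div_le_div_iff₀ (by positivity) (by positivity)]
          have : (r/16)^2 ≤ dista Ω x ^ 2 := by gcongr
          nlinarith [sq_nonneg (u x)]
        linarith
      · obtain ⟨z, hz, hxz⟩ := exists_nearest hop hne hxΩ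
        obtain ⟨w, hw, hzw⟩ := mem_iUnion₂.1 (hcov hz)
        have hxw : x ∈ closedBall w (r/8) := by
          rw [mem_closedBall]; rw [mem_ball] at hzw
          rw [← dist_eq_norm] at hxz
          linarith [dist_triangle x z w, not_le.1 hdr]
        have h2 : (u x / dista Ω x) ^ 2 = ((u x * χ w x) / dista Ω x) ^ 2 := by rw [hχ5 w x hxw, mul_one]
        have h3 := Finset.single_le_sum (f := fun z => ((u x * χ z x) / dista Ω x) ^ 2) (fun z _ => sq_nonneg _) hw
        have h4 : 0 ≤ (16/r)^2 * u x ^ 2 := by positivity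
        linarith
    · simp [image_eq_zero_of_notMem_tsupport hx]
  rw [integral_add (iu.const_mul _) (integrable_finsetSum _ fun z _ => hI _ (hT z)), integral_const_mul,
    integral_finsetSum _ fun z _ => hI _ (hT z)] at h1
  have hPu := hP u hu
  refine h1.trans ?_
  rw [hK, add_mul, Finset.sum_mul]
  have ig := gsq_int hu.1 hu.2.1
  refine add_le_add (by nlinarith [sq_nonneg (16/r)]) (Finset.sum_le_sum fun z hz => ?_)
  obtain ⟨e, t, H⟩ := hch z (hZ z hz)
  have h2 := hardy_local H hr hΛ hop hne (hfr z (hZ z hz)) (hT z) ((tsupport_mul_subset_right).trans ((hχ3 z).trans (closedBall_subset_ball (by linarith))))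
  have h3 : ∫ x, gsq (fun y => u y * χ z y) x ≤ ∫ x, (2 * gsq u x + 2 * B z * u x ^ 2) := by
    refine integral_mono (gsq_int (hT z).1 (hT z).2.1) ((ig.const_mul _).add (iu.const_mul _)) fun x => ?_
    refine (gsq_mul_le (hus.at x).diff ((hχ1 z).at x).diff).trans ?_
    have g0 := gsq_nonneg u x
    have h5 : χ z x ^ 2 ≤ 1 := by
      have := hχ4 z x
      nlinarith
    have h6 := hB z x
    nlinarith [sq_nonneg (u x), mul_le_mul_of_nonneg_right h5 g0, mul_le_mul_of_nonneg_left h6 (sq_nonneg (u x))]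
  rw [integral_add (ig.const_mul _) (iu.const_mul _), integral_const_mul, integral_const_mul] at h3
  have hBz := hB0 z
  have h4 : 2 * B z * ∫ x, u x ^ 2 ≤ 2 * B z * (Cp * ∫ x, gsq u x) := by gcongr
  calc _ ≤ 4 * Λ ^ 2 * ∫ x, gsq (fun y => u y * χ z y) x := h2
    _ ≤ 4 * Λ ^ 2 * (2 * (∫ x, gsq u x) + 2 * B z * (Cp * ∫ x, gsq u x)) := by gcongr; linarith
    _ = _ := by ring

lemma exists_rho_lower (N : ℕ) : ∃ c, 0 < c ∧ ∀ z, ‖z‖ ≤ 3/4 → c ≤ rho N z := by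
  obtain ⟨z, hz, h⟩ := (isCompact_closedBall (0 : ES N) (3/4)).exists_isMinOn ⟨0, mem_closedBall_self (by norm_num)⟩ (rho_sm N).continuous.continuousOn
  refine ⟨rho N z, rho_pos z ?_, fun y hy => h (by simpa using hy)⟩
  have : ‖z‖ ≤ 3/4 := by simpa using hz
  linarith

/-- gain from the exterior ball -/
lemma ml_gain {N : ℕ} {c0 : ℝ} (hc0 : 0 < c0) (hρ : ∀ z, ‖z‖ ≤ 3/4 → c0 ≤ rho N z) {p : ES N → ℝ} {x y : ES N} {t a M : ℝ}
    (ht : 0 < t) (ha : 0 < a) (hM : 0 ≤ M) (hi : Integrable (fun z => rho N z * p (x + t • z)))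
    (hp : ∀ w ∈ ball x t, p w ≤ M) (hz : ∀ w ∈ ball y (a * t), p w ≤ 0) (hy : ball y (a * t) ⊆ ball x (3/4 * t)) :
    ml t p x ≤ (1 - c0 * (a ^ N * vb N)) * M := by
  have hE : ∀ z, z ∈ ball (t⁻¹ • (y - x)) a → x + t • z ∈ ball y (a * t) := by
    intro z hz
    rw [mem_ball, dist_eq_norm] at *
    have : x + t • z - y = t • (z - t⁻¹ • (y - x)) := by
      rw [smul_sub, smul_smul, mul_inv_cancel₀ ht.ne']; module
    rw [this, norm_smul, Real.norm_eq_abs, abs_of_pos ht, mul_comm]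
    gcongr
  have h1 : ∫ z, (ball (t⁻¹ • (y - x)) a).indicator (fun _ => c0 * M) z ≤ ∫ z, (rho N z * M - rho N z * p (x + t • z)) := by
    refine integral_mono ?_ (((rho_ker N).int_cont continuous_const).sub hi) fun z => ?_
    · exact (integrable_indicator_iff measurableSet_ball).2 (integrableOn_const (measure_ball_lt_top.ne))
    · simp only
      by_cases hzE : z ∈ ball (t⁻¹ • (y - x)) a
      · rw [indicator_of_mem hzE]
        have h2 := hE z hzE
        have h3 := hz _ h2
        have h4 := hy h2
        have h5 : ‖z‖ ≤ 3/4 := by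
          rw [mem_ball, dist_eq_norm, add_sub_cancel_left, norm_smul, Real.norm_eq_abs, abs_of_pos ht, mul_comm] at h4
          exact (lt_of_mul_lt_mul_right h4 ht.le).le
        have h6 := hρ z h5
        nlinarith
      · rw [indicator_of_notMem hzE]
        by_cases hz1 : ‖z‖ < 1
        · have : x + t • z ∈ ball x t := by
            simp [norm_smul, abs_of_pos ht]; nlinarith
          have h7 := hp _ this
          have h8 := (rho_ker N).ρn z
          nlinarith
        · simp [(rho_ker N).ρs z (by linarith)]
  rw [integral_sub ((rho_ker N).int_cont continuous_const) hi, integral_mul_const, rho_int, integral_indicator measurableSet_ball,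
    setIntegral_const, vol_ball _ ha, smul_eq_mul] at h1
  have : ml t p x = ∫ z, rho N z * p (x + t • z) := rfl
  rw [this]
  linarith

lemma decay' {N : ℕ} {Ω : Set (ES N)} {r c : ℝ} (G : Geo Ω r c) : ∃ c', 0 < c' ∧ c' < 1 ∧ ∀ (D : Set (ES N)) (p : ES N → ℝ),
    SubM D p → (∀ x t, 0 < t → closedBall x t ⊆ D → Integrable (fun z => rho N z * p (x + t • z))) → (∀ x, x ∉ Ω → p x = 0) → ∀ x s M, 0 < s → s ≤ r → dista Ω x < s → closedBall x (4 * s) ⊆ D →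
    0 ≤ M → (∀ y ∈ ball x (4 * s), p y ≤ M) → p x ≤ (1 - c') * M := by
  obtain ⟨c0, hc0, hρ⟩ := exists_rho_lower N
  have hv := vb_pos N
  have := G.c0
  set k := c0 * ((c/4) ^ N * vb N) with hk
  have hk0 : 0 < k := by positivity
  refine ⟨min k (1/2), by positivity, by linarith [min_le_right k (1/2)], ?_⟩
  intro D p hp hpc hp0 x s M hs hsr hxs hxD hM hpM
  have hkM : (1 - k) * M ≤ (1 - min k (1/2)) * M := by gcongr; exact min_le_left _ _
  by_cases hx : x ∈ Ω
  · obtain ⟨z, hz, hxz⟩ := exists_nearest G.op G.ne hx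
    obtain ⟨y, hy⟩ := G.ext z hz s hs hsr
    have e : c / 4 * (4 * s) = c * s := by ring
    refine (hp x (4 * s) (by positivity) hxD).trans (le_trans ?_ hkM)
    refine ml_gain hc0 hρ (a := c/4) (y := y) (by positivity) (by positivity) hM (hpc _ _ (by positivity) hxD) hpM ?_ ?_
    · rw [e]; intro w hw; exact (hp0 w (hy hw).2).le
    · rw [e]; intro w hw
      have := (hy hw).1
      rw [mem_ball] at *
      rw [← dist_eq_norm, dist_comm] at hxz
      linarith [dist_triangle w z x]
  · rw [hp0 x hx]
    have : min k (1/2) ≤ 1/2 := min_le_right _ _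
    exact mul_nonneg (by linarith) hM

lemma decay {N : ℕ} {Ω : Set (ES N)} {r c : ℝ} (G : Geo Ω r c) : ∃ c', 0 < c' ∧ c' < 1 ∧ ∀ (D : Set (ES N)) (p : ES N → ℝ),
    SubM D p → ContinuousOn p D → (∀ x, x ∉ Ω → p x = 0) → ∀ x s M, 0 < s → s ≤ r → dista Ω x < s → closedBall x (4 * s) ⊆ D →
    0 ≤ M → (∀ y ∈ ball x (4 * s), p y ≤ M) → p x ≤ (1 - c') * M := by
  obtain ⟨c', h1, h2, h3⟩ := decay' G
  exact ⟨c', h1, h2, fun D p hp hpc => h3 D p hp fun x t ht hx => ml_int_cont hpc ht hx⟩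

lemma ball_int_cont {N : ℕ} {u : ES N → ℝ} {x : ES N} {t : ℝ} (h : ContinuousOn u (closedBall x t)) : IntegrableOn u (ball x t) :=
  (h.integrableOn_compact (isCompact_closedBall x t)).mono_set ball_subset_closedBall

lemma harnack {N : ℕ} {D : Set (ES N)} (hD : IsOpen D) {u : ES N → ℝ} (hu : Harm D u) {x y : ES N} {r : ℝ} (hr : 0 < r)
    (hy : closedBall y (2 * r) ⊆ D) (h0 : ∀ w ∈ closedBall y (2 * r), 0 ≤ u w) (hxy : ‖x - y‖ ≤ r) : u x ≤ 2 ^ N * u y := by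
  have hsub : closedBall x r ⊆ closedBall y (2 * r) := by
    intro w hw
    rw [mem_closedBall, dist_eq_norm] at *
    have := norm_sub_le_norm_sub_add_norm_sub w x y
    linarith
  have hc : ContinuousOn u (closedBall y (2 * r)) := fun w hw => (hu w (hy hw)).1.diff.continuousAt.continuousWithinAt
  have h1 := mn_sub (isKer_ball N) hD hr (hsub.trans hy) (fun w hw => (hu w hw).1) (fun w hw => ((hu w (hy (hsub hw))).2).ge)
  have h2 := mn_super (isKer_ball N) hD (by positivity) hy (fun w hw => (hu w hw).1) (fun w hw => ((hu w (hy hw)).2).le)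
  rw [int_bρ, mn_ball _ (by positivity)] at h1 h2
  have h3 : ∫ w in ball x r, u w ≤ ∫ w in ball y (2 * r), u w := by
    refine setIntegral_mono_set (ball_int_cont hc) ?_ ?_
    · filter_upwards [ae_restrict_mem measurableSet_ball] with w hw using h0 w (ball_subset_closedBall hw)
    · refine Eventually.of_forall (fun w hw => ?_)
      have hw' : dist w x < r := hw
      rw [← dist_eq_norm] at hxy
      have : dist w y < 2 * r := by linarith [dist_triangle w x y]
      exact this
  have hv := vb_pos N
  have h4 : (r ^ N)⁻¹ * ∫ w in ball x r, u w ≤ (r ^ N)⁻¹ * ∫ w in ball y (2 * r), u w := by gcongr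
  have h5 : (r ^ N)⁻¹ * ∫ w in ball y (2 * r), u w = 2 ^ N * (((2 * r) ^ N)⁻¹ * ∫ w in ball y (2 * r), u w) := by
    rw [mul_pow]; field_simp
  rw [h5] at h4
  have h6 : u x * vb N ≤ 2 ^ N * u y * vb N := by
    calc u x * vb N ≤ _ := h1
      _ ≤ _ := h4
      _ ≤ 2 ^ N * (u y * vb N) := by gcongr
      _ = _ := by ring
  exact le_of_mul_le_mul_right h6 hv

lemma chain {N : ℕ} {Ω : Set (ES N)} {r c : ℝ} (G : Geo Ω r c) {x : ES N} {e : ES N} (he : ‖e‖ = 1)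
    (hd : 0 < dista Ω x)
    (hitg : ∀ τ, 0 ≤ τ → τ ≤ r → x + τ • e ∈ Ω ∧ c * (dista Ω x + τ) ≤ dista Ω (x + τ • e))
    {u : ES N → ℝ} (n : ℕ) : ∀ τ : ℝ, 0 ≤ τ → τ ≤ r → dista Ω x + τ ≤ dista Ω x * (1 + c/4) ^ n →
    Harm (Ω ∩ ball x (2 * (dista Ω x + τ))) u → (∀ w ∈ Ω ∩ ball x (2 * (dista Ω x + τ)), 0 ≤ u w) →
    u (x + τ • e) ≤ (2 ^ N) ^ n * u x ∧ u x ≤ (2 ^ N) ^ n * u (x + τ • e) := by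
  have hc := G.c0
  have hc1 := G.c1
  induction n with
  | zero =>
    intro τ h0 hr h
    have : τ = 0 := by simp at h; linarith
    subst this
    simp
  | succ n ih =>
    intro τ h0 hr h hu hu0
    set d := dista Ω x with hdd
    set τ' := max 0 ((d + τ) / (1 + c/4) - d) with hτ'
    have hq : 1 < 1 + c/4 := by linarith
    have h0' : 0 ≤ τ' := le_max_left _ _
    have hle : τ' ≤ τ := by
      refine max_le h0 ?_
      have : (d + τ) / (1 + c/4) ≤ d + τ := div_le_self (by linarith) hq.le
      linarith
    have hstep : d + τ ≤ (1 + c/4) * (d + τ') := by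
      have : (d + τ) / (1 + c/4) - d ≤ τ' := le_max_right _ _
      have h2 : (d + τ) / (1 + c/4) ≤ d + τ' := by linarith
      rw [div_le_iff₀ (by linarith)] at h2
      linarith
    have hn : d + τ' ≤ d * (1 + c/4) ^ n := by
      rcases max_cases 0 ((d + τ) / (1 + c/4) - d) with ⟨h1, _⟩ | ⟨h1, _⟩
      · rw [hτ', h1, add_zero]
        exact le_mul_of_one_le_right hd.le (one_le_pow₀ hq.le)
      · rw [hτ', h1, add_sub_cancel, div_le_iff₀ (by linarith)]
        rw [pow_succ] at h
        linarith
    have hsub : Ω ∩ ball x (2 * (d + τ')) ⊆ Ω ∩ ball x (2 * (d + τ)) :=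
      inter_subset_inter_right _ (ball_subset_ball (by linarith))
    obtain ⟨i1, i2⟩ := ih τ' h0' (hle.trans hr) hn (fun w hw => hu w (hsub hw)) (fun w hw => hu0 w (hsub hw))
    have hop : IsOpen (Ω ∩ ball x (2 * (d + τ))) := G.op.inter isOpen_ball
    set ρ := c/4 * (d + τ') with hρ
    have hρ0 : 0 < ρ := by positivity
    have hcb : ∀ s, τ' ≤ s → s ≤ τ → closedBall (x + s • e) (2 * ρ) ⊆ Ω ∩ ball x (2 * (d + τ)) := by
      intro s hs1 hs2 w hw
      rw [mem_closedBall, dist_eq_norm] at hw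
      have h1 := (hitg s (h0'.trans hs1) (hs2.trans hr)).2
      constructor
      · apply dista_ball (x := x + s • e)
        rw [mem_ball, dist_eq_norm]
        have : c * (d + τ') ≤ c * (d + s) := by gcongr
        have : 0 < c * (d + τ') := by positivity
        linarith
      · rw [mem_ball, dist_eq_norm]
        have h2 : w - x = (w - (x + s • e)) + s • e := by module
        rw [h2]
        refine (norm_add_le _ _).trans_lt ?_
        rw [norm_smul, he, Real.norm_eq_abs, abs_of_nonneg (h0'.trans hs1)]
        have : c * (d + τ') ≤ 1 * (d + τ') := by gcongr
        linarith
    have hnorm : ‖(x + τ • e) - (x + τ' • e)‖ ≤ ρ := by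
      have : (x + τ • e) - (x + τ' • e) = (τ - τ') • e := by module
      rw [this, norm_smul, he, Real.norm_eq_abs, abs_of_nonneg (by linarith)]
      linarith
    have a1 := harnack hop hu hρ0 (hcb τ' le_rfl hle) (fun w hw => hu0 w (hcb τ' le_rfl hle hw)) hnorm
    have a2 := harnack hop hu hρ0 (hcb τ hle le_rfl) (fun w hw => hu0 w (hcb τ hle le_rfl hw)) (by rw [norm_sub_rev]; exact hnorm)
    constructor
    · calc _ ≤ _ := a1
        _ ≤ 2 ^ N * ((2 ^ N) ^ n * u x) := by gcongr
        _ = _ := by rw [pow_succ]; ring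
    · calc _ ≤ _ := i2
        _ ≤ (2 ^ N) ^ n * (2 ^ N * u (x + τ • e)) := by gcongr
        _ = _ := by rw [pow_succ]; ring

/-- positive harmonic functions -/
def PH {N : ℕ} (Ω : Set (ES N)) (h : ES N → ℝ) : Prop := Harm Ω h ∧ ∀ x ∈ Ω, 0 < h x

lemma harnack_pt {N : ℕ} {Ω : Set (ES N)} {r c : ℝ} (G : Geo Ω r c) {x y : ES N} (hy : y ∈ Ω) (hxy : ‖x - y‖ < dista Ω y / 4)
    {h : ES N → ℝ} (hh : PH Ω h) : h x ≤ 2 ^ N * h y ∧ h y ≤ 2 ^ N * h x := by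
  have hd := dista_pos G.op G.ne hy
  have h1 : closedBall y (2 * (dista Ω y / 4)) ⊆ Ω := (closedBall_subset_ball (by linarith)).trans dista_ball
  have hdx : dista Ω y * (3/4) ≤ dista Ω x := by
    have := dista_lip Ω y x
    rw [norm_sub_rev] at this
    linarith
  have h2 : closedBall x (2 * (dista Ω y / 4)) ⊆ Ω := (closedBall_subset_ball (by linarith)).trans dista_ball
  refine ⟨harnack G.op hh.1 (by positivity) h1 (fun w hw => (hh.2 w (h1 hw)).le) hxy.le, 
    harnack G.op hh.1 (by positivity) h2 (fun w hw => (hh.2 w (h2 hw)).le) (by rw [norm_sub_rev]; exact hxy.le)⟩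

lemma harnack_cpt {N : ℕ} {Ω : Set (ES N)} {r c : ℝ} (G : Geo Ω r c) {x₀ : ES N} (hx₀ : x₀ ∈ Ω) {η : ℝ} (hη : 0 < η) :
    ∃ C, 0 < C ∧ ∀ h, PH Ω h → ∀ x, η ≤ dista Ω x → h x ≤ C * h x₀ := by
  have hnb : ∀ x ∈ Ω, ball x (dista Ω x / 4) ∈ 𝓝 x := fun x hx => ball_mem_nhds x (by have := dista_pos G.op G.ne hx; positivity)
  have hloc : ∀ x ∈ Ω, ∃ C, 0 < C ∧ ∀ h, PH Ω h → h x ≤ C * h x₀ := by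
    set S := {x | x ∈ Ω ∧ ∃ C, 0 < C ∧ ∀ h, PH Ω h → h x ≤ C * h x₀} with hS
    set T := {x | x ∈ Ω ∧ ¬ ∃ C, 0 < C ∧ ∀ h, PH Ω h → h x ≤ C * h x₀} with hT
    have hSo : IsOpen S := by
      rw [isOpen_iff_mem_nhds]
      rintro x ⟨hx, C, hC, hb⟩
      filter_upwards [hnb x hx, G.op.mem_nhds hx] with y hy hyΩ
      refine ⟨hyΩ, 2 ^ N * C, by positivity, fun h hh => ?_⟩
      rw [mem_ball, dist_eq_norm] at hy
      have := (harnack_pt G hx hy hh).1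
      calc h y ≤ _ := this
        _ ≤ 2 ^ N * (C * h x₀) := by gcongr; exact hb h hh
        _ = _ := by ring
    have hTo : IsOpen T := by
      rw [isOpen_iff_mem_nhds]
      rintro x ⟨hx, hn⟩
      filter_upwards [hnb x hx, G.op.mem_nhds hx] with y hy hyΩ
      refine ⟨hyΩ, fun ⟨C, hC, hb⟩ => hn ⟨2 ^ N * C, by positivity, fun h hh => ?_⟩⟩
      rw [mem_ball, dist_eq_norm] at hy
      have := (harnack_pt G hx hy hh).2
      calc h x ≤ _ := this
        _ ≤ 2 ^ N * (C * h x₀) := by gcongr; exact hb h hh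
        _ = _ := by ring
    intro x hx
    by_contra hn
    have hsub : Ω ⊆ S ∪ T := fun y hy => by
      by_cases hh : ∃ C, 0 < C ∧ ∀ h, PH Ω h → h y ≤ C * h x₀
      · exact Or.inl ⟨hy, hh⟩
      · exact Or.inr ⟨hy, hh⟩
    obtain ⟨y, _, h1, h2⟩ := G.conn.isPreconnected S T hSo hTo hsub ⟨x₀, hx₀, hx₀, 1, one_pos, fun h _ => by simp⟩ ⟨x, hx, hx, hn⟩
    exact h2.2 h1.2
  have hK : IsCompact {x | η ≤ dista Ω x} := by
    refine G.bd.isCompact_closure.of_isClosed_subset (isClosed_le continuous_const (dista_cont Ω)) fun x hx => subset_closure ?_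
    exact dista_mem (hη.trans_le hx)
  suffices key : ∃ C, 0 < C ∧ ∀ h, PH Ω h → ∀ x ∈ {x | η ≤ dista Ω x}, h x ≤ C * h x₀ by
    obtain ⟨C, hC, h⟩ := key
    exact ⟨C, hC, fun u hu x hx => h u hu x hx⟩
  refine hK.induction_on (p := fun S => ∃ C, 0 < C ∧ ∀ h, PH Ω h → ∀ x ∈ S, h x ≤ C * h x₀)
    ⟨1, one_pos, by simp⟩ (fun S T hST ⟨C, hC, h⟩ => ⟨C, hC, fun u hu x hx => h u hu x (hST hx)⟩) ?_ ?_
  · rintro S T ⟨C, hC, h⟩ ⟨C', hC', h'⟩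
    refine ⟨max C C', lt_max_of_lt_left hC, fun u hu x hx => ?_⟩
    have h0 := (hu.2 x₀ hx₀).le
    rcases hx with hx | hx
    · exact (h u hu x hx).trans (by gcongr; exact le_max_left _ _)
    · exact (h' u hu x hx).trans (by gcongr; exact le_max_right _ _)
  · intro x hx
    have hxΩ : x ∈ Ω := dista_mem (hη.trans_le hx)
    obtain ⟨C, hC, hb⟩ := hloc x hxΩ
    refine ⟨_, mem_nhdsWithin_of_mem_nhds (hnb x hxΩ), 2 ^ N * C, by positivity, fun h hh y hy => ?_⟩
    rw [mem_ball, dist_eq_norm] at hy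
    have := (harnack_pt G hxΩ hy hh).1
    calc h y ≤ _ := this
      _ ≤ 2 ^ N * (C * h x₀) := by gcongr; exact hb h hh
      _ = _ := by ring

/-- polynomial growth bound near the boundary -/
lemma growth {N : ℕ} {Ω : Set (ES N)} {r c : ℝ} (G : Geo Ω r c) {x₀ : ES N} (hx₀ : x₀ ∈ Ω) :
    ∃ γ : ℕ, 0 < γ ∧ ∃ C, 0 < C ∧ ∀ h, PH Ω h → ∀ x ∈ Ω, h x * dista Ω x ^ γ ≤ C * h x₀ := by
  have hc := G.c0
  have hr := G.r0
  obtain ⟨C0, hC0, hK⟩ := harnack_cpt G hx₀ (η := c * r) (by positivity)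
  have hq : 1 < 1 + c/4 := by linarith
  obtain ⟨γ0, hγ0⟩ := pow_unbounded_of_one_lt (2 ^ N : ℝ) hq
  set γ := γ0 + 1
  have hγ : (2 ^ N : ℝ) ≤ (1 + c/4) ^ γ := hγ0.le.trans (pow_le_pow_right₀ hq.le (Nat.le_succ _))
  obtain ⟨R, hR0, hR⟩ : ∃ R, 0 < R ∧ ∀ x, dista Ω x ≤ R := by
    obtain ⟨R, hR0, hR⟩ := G.bd.subset_closedBall_lt 0 x₀
    obtain ⟨q, hq⟩ := G.ne
    refine ⟨R + ‖x₀ - q‖, by positivity, fun x => ?_⟩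
    by_cases hx : x ∈ Ω
    · have h1 := hR hx
      rw [mem_closedBall, dist_eq_norm] at h1
      have := dista_le (x := x) hq
      have := norm_sub_le_norm_sub_add_norm_sub x x₀ q
      linarith
    · have : dista Ω x = 0 := infDist_zero_of_mem hx
      rw [this]; positivity
  refine ⟨γ, Nat.succ_pos _, C0 * R ^ γ + 2 ^ N * C0 * (2 * r) ^ γ, by positivity, fun h hh x hx => ?_⟩
  have hd := dista_pos G.op G.ne hx
  have h0 := hh.2 x₀ hx₀
  by_cases hxr : dista Ω x < r
  · obtain ⟨e, he, hitg⟩ := G.int x hx hxr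
    obtain ⟨n, hn1, hn2⟩ := exists_nat_pow_near (x := 2 * r / dista Ω x) (by rw [le_div_iff₀ hd]; linarith) hq
    rw [div_lt_iff₀ hd] at hn2
    have h1 := (chain G he hd hitg (u := h) (n + 1) r hr.le le_rfl (by linarith) (fun w hw => hh.1 w hw.1) (fun w hw => (hh.2 w hw.1).le)).2
    obtain ⟨h2, h3⟩ := hitg r hr.le le_rfl
    have h4 : h (x + r • e) ≤ C0 * h x₀ := hK h hh _ (by nlinarith)
    have h5 : ((2:ℝ) ^ N) ^ n * dista Ω x ^ γ ≤ (2 * r) ^ γ := by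
      calc ((2:ℝ) ^ N) ^ n * dista Ω x ^ γ ≤ ((1 + c/4) ^ γ) ^ n * dista Ω x ^ γ := by gcongr
        _ = ((1 + c/4) ^ n * dista Ω x) ^ γ := by rw [mul_pow, ← pow_mul, ← pow_mul, mul_comm γ n]
        _ ≤ _ := by
          rw [le_div_iff₀ hd] at hn1
          exact pow_le_pow_left₀ (by positivity) hn1 γ
    calc h x * dista Ω x ^ γ ≤ ((2 ^ N) ^ (n + 1) * (C0 * h x₀)) * dista Ω x ^ γ := by
          gcongr; exact h1.trans (by gcongr)
      _ = 2 ^ N * C0 * h x₀ * ((2 ^ N) ^ n * dista Ω x ^ γ) := by ring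
      _ ≤ 2 ^ N * C0 * h x₀ * (2 * r) ^ γ := by gcongr
      _ ≤ _ := by
        have : 0 ≤ C0 * R ^ γ * h x₀ := by positivity
        linarith
  · have h1 := hK h hh x (by nlinarith [G.c1, not_lt.1 hxr])
    calc h x * dista Ω x ^ γ ≤ (C0 * h x₀) * R ^ γ := by gcongr; exact hR x
      _ ≤ _ := by
        have : 0 ≤ 2 ^ N * C0 * (2 * r) ^ γ * h x₀ := by positivity
        linarith

/-- vanishing on the boundary part inside `D` -/
def Van {N : ℕ} (Ω D : Set (ES N)) (h : ES N → ℝ) : Prop := ∀ z ∈ D ∩ frontier Ω, Tendsto h (𝓝[Ω] z) (𝓝 0)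

lemma PH.pext {N : ℕ} {Ω D : Set (ES N)} (hΩ : IsOpen Ω) (hD : IsOpen D) {h : ES N → ℝ} (hh : PH Ω h) (hv : Van Ω D h) :
    ContinuousOn (pext Ω h) D ∧ SubM D (pext Ω h) := by
  refine pext_sub hΩ hD (fun x hx => ⟨(hh.1 x hx.1).1, (hh.1 x hx.1).2.ge⟩) fun z hz κ hκ => ?_
  exact (hv z ⟨hz.2, hz.1⟩).eventually (gt_mem_nhds hκ)

lemma carleson {N : ℕ} {Ω : Set (ES N)} {r c : ℝ} (G : Geo Ω r c) {x₀ : ES N} (hx₀ : x₀ ∈ Ω) {R : ℝ} (hR : 0 < R) :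
    ∃ C, 0 < C ∧ ∀ D z h, IsOpen D → closedBall z R ⊆ D → PH Ω h → Van Ω D h → ∀ x ∈ Ω, x ∈ ball z (R/2) → h x ≤ C * h x₀ := by
  obtain ⟨c', hc', hc'1, hdec⟩ := decay G
  obtain ⟨γ, hγ, C, hC, hgr⟩ := growth G hx₀
  have hr := G.r0
  set ε : ℝ := min (min (c' / (8 * γ)) (1/8)) (r / R) with hε
  have hγ' : (0:ℝ) < γ := by exact_mod_cast hγ
  have hε0 : 0 < ε := by positivity
  have hε1 : ε ≤ c' / (8 * γ) := (min_le_left _ _).trans (min_le_left _ _)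
  have hε2 : ε ≤ 1/8 := (min_le_left _ _).trans (min_le_right _ _)
  have hε3 : ε ≤ r / R := min_le_right _ _
  have hpow : 1 - c' < (1 - 4 * ε) ^ γ := by
    have h1 := one_add_mul_le_pow (a := -(4 * ε)) (by linarith) γ
    rw [le_div_iff₀ (by positivity)] at hε1
    have : (1 + -(4 * ε)) = 1 - 4 * ε := by ring
    rw [this] at h1
    nlinarith
  refine ⟨C * (2 / R / ε) ^ γ, by positivity, ?_⟩
  intro D z h hD hzD hh hv
  obtain ⟨hpc, hps⟩ := hh.pext G.op hD hv
  set p := pext Ω h with hp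
  have hp0 : ∀ x, 0 ≤ p x := pext_nonneg _ _
  have hpΩ : ∀ x ∈ Ω, p x = h x := fun x hx => by rw [hp, pext_of_mem h hx, max_eq_left (hh.2 x hx).le]
  have h00 := hh.2 x₀ hx₀
  obtain ⟨y, hy, hmax⟩ := (isCompact_closedBall z R).exists_isMaxOn ⟨z, mem_closedBall_self hR.le⟩
    (f := fun x => p x * (R - dist x z) ^ γ) ((hpc.mono hzD).mul (by fun_prop))
  have hmax' : ∀ x ∈ closedBall z R, p x * (R - dist x z) ^ γ ≤ p y * (R - dist y z) ^ γ := fun x hx => hmax hx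
  rw [mem_closedBall] at hy
  have hρ0 : 0 ≤ R - dist y z := by linarith
  have key : p y * (R - dist y z) ^ γ ≤ C * h x₀ * (1 / ε) ^ γ := by
    have hCn : 0 ≤ C * h x₀ * (1 / ε) ^ γ := by positivity
    by_cases hyΩ : y ∈ Ω
    swap
    · rw [hp, pext_of_notMem h hyΩ, zero_mul]; exact hCn
    rcases hρ0.eq_or_lt with hρ | hρ
    · rw [← hρ, zero_pow hγ.ne', mul_zero]; exact hCn
    set ρ := R - dist y z with hρd
    have hd := dista_pos G.op G.ne hyΩ
    by_cases hδ : dista Ω y < ε * ρ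
    · exfalso
      have hρR : ρ ≤ R := by rw [hρd]; linarith [dist_nonneg (x := y) (y := z)]
      have h4 : ∀ w ∈ closedBall y (4 * (ε * ρ)), w ∈ closedBall z R ∧ (1 - 4 * ε) * ρ ≤ R - dist w z := by
        intro w hw
        rw [mem_closedBall] at *
        have := dist_triangle w y z
        constructor <;> nlinarith
      have hMp : 0 ≤ p y / (1 - 4 * ε) ^ γ := div_nonneg (hp0 y) (pow_nonneg (by linarith) _)
      have h14 : 0 < (1 - 4 * ε) := by linarith
      have h5 := hdec D p hps hpc (fun x hx => pext_of_notMem h hx) y (ε * ρ) (p y / (1 - 4 * ε) ^ γ) (by positivity)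
        (by calc ε * ρ ≤ r / R * R := by gcongr
              _ = r := by field_simp) hδ (fun w hw => hzD (h4 w hw).1) hMp (fun w hw => ?_)
      · have hpy : 0 < p y := by rw [hpΩ y hyΩ]; exact hh.2 y hyΩ
        rw [← mul_div_assoc, le_div_iff₀ (by positivity)] at h5
        nlinarith
      · obtain ⟨h6, h7⟩ := h4 w (ball_subset_closedBall hw)
        have h8 := hmax' w h6
        rw [le_div_iff₀ (by positivity)]
        have h9 : p w * ((1 - 4 * ε) * ρ) ^ γ ≤ p y * ρ ^ γ := by
          refine le_trans ?_ h8
          have := hp0 w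
          gcongr
        rw [mul_pow, ← mul_assoc] at h9
        exact le_of_mul_le_mul_right h9 (by positivity)
    · have h1 := hgr h hh y hyΩ
      rw [hpΩ y hyΩ]
      have hle : ρ ≤ dista Ω y / ε := by rw [le_div_iff₀ hε0]; linarith [not_lt.1 hδ]
      have hhy := (hh.2 y hyΩ).le
      calc h y * ρ ^ γ ≤ h y * (dista Ω y / ε) ^ γ := by gcongr
        _ = (h y * dista Ω y ^ γ) * (1/ε) ^ γ := by rw [div_eq_mul_one_div, mul_pow]; ring
        _ ≤ _ := by gcongr
  intro x hxΩ hx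
  rw [mem_ball] at hx
  have h1 := hmax' x (by rw [mem_closedBall]; linarith)
  rw [hpΩ x hxΩ] at h1
  have hhx := (hh.2 x hxΩ).le
  have h2 : h x * (R / 2) ^ γ ≤ C * h x₀ * (1 / ε) ^ γ := by
    refine le_trans ?_ (h1.trans key)
    gcongr
    linarith
  have h3 : h x = h x * (R/2) ^ γ * (2/R) ^ γ := by
    rw [mul_assoc, ← mul_pow]
    have : R / 2 * (2 / R) = 1 := by field_simp
    rw [this]; simp
  rw [h3]
  calc _ ≤ C * h x₀ * (1 / ε) ^ γ * (2/R) ^ γ := by gcongr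
    _ = C * ((1/ε) * (2/R)) ^ γ * h x₀ := by rw [mul_pow]; ring
    _ = _ := by congr 3; ring

lemma bh_step {N : ℕ} {Ω : Set (ES N)} {r c : ℝ} (G : Geo Ω r c) : ∃ a M θ : ℝ, 0 < a ∧ 0 < M ∧ 0 < θ ∧ θ ≤ 1/4 ∧
    ∀ z s w, 0 < s → s ≤ r → Harm (Ω ∩ ball z s) w → Van Ω (ball z s) w → (∀ x ∈ Ω ∩ ball z s, -1 ≤ w x) →
    (∀ x ∈ Ω ∩ ball z s, θ * s ≤ dista Ω x → M ≤ w x) →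
    (∀ x ∈ Ω ∩ ball z (s/2), -a ≤ w x) ∧ (∀ x ∈ Ω ∩ ball z (s/2), θ * (s/2) ≤ dista Ω x → a * M ≤ w x) := by
  obtain ⟨c', hc', hc'1, hdec⟩ := decay G
  have hc := G.c0
  have hc1 := G.c1
  have hq : 1 < 1 + c/4 := by linarith
  obtain ⟨n, hn⟩ := pow_unbounded_of_one_lt (1 + 2 / c) hq
  set C1 : ℝ := (2 ^ N) ^ n with hC1
  have hC1p : 0 < C1 := by positivity
  have hC11 : 1 ≤ C1 := one_le_pow₀ (one_le_pow₀ (by norm_num))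
  obtain ⟨J, hJ⟩ := exists_pow_lt_of_lt_one (show 0 < 1 / (2 * C1) by positivity) (show 1 - c' < 1 by linarith)
  set θ : ℝ := min (c/8) (1 / (8 * (J + 1))) with hθ
  have hθ0 : 0 < θ := by positivity
  have hθ1 : θ ≤ c/8 := min_le_left _ _
  have hθ2 : θ * (8 * (J + 1)) ≤ 1 := by
    have : θ ≤ 1 / (8 * (J + 1)) := min_le_right _ _
    rwa [le_div_iff₀ (by positivity)] at this
  refine ⟨1 / (2 * C1), 2 * C1, θ, by positivity, by positivity, hθ0, by linarith, ?_⟩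
  intro z s w hs hsr hw hv hw1 hwM
  have hsub : ball z (s/2) ⊆ ball z s := ball_subset_ball (by linarith)
  constructor
  · -- lower bound
    have hD : IsOpen (ball z s) := isOpen_ball
    have hneg : ∀ x, SmAt w x → SmAt (fun y => -1 * w y) x := fun x hx => contDiffAt_const.mul hx
    obtain ⟨hpc, hps⟩ := pext_sub (w := fun y => -1 * w y) G.op hD (fun x hx => ⟨hneg x (hw x hx).1, by
        rw [lap_cmul _ (hw x hx).1, (hw x hx).2]; simp⟩) (fun y hy κ hκ => by
        have := hv y ⟨hy.2, hy.1⟩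
        have h2 : Tendsto (fun x => -1 * w x) (𝓝[Ω] y) (𝓝 (-1 * 0)) := this.const_mul _
        rw [mul_zero] at h2
        exact h2.eventually (gt_mem_nhds hκ))
    set p := pext Ω (fun y => -1 * w y) with hp
    have hp0 : ∀ x, x ∉ Ω → p x = 0 := fun x hx => pext_of_notMem _ hx
    have hiter : ∀ j : ℕ, ∀ x ∈ ball z (s - 4 * j * (θ * s)), p x ≤ (1 - c') ^ j := by
      intro j
      induction j with
      | zero =>
        intro x hx
        have hx' : x ∈ ball z s := by simpa using hx
        by_cases hxΩ : x ∈ Ω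
        · rw [hp, pext_of_mem _ hxΩ]
          have := hw1 x ⟨hxΩ, hx'⟩
          simp; linarith
        · rw [hp0 x hxΩ]; simp
      | succ j ih =>
        intro x hx
        have hθs : 0 < θ * s := by positivity
        push_cast at hx
        have h1 : closedBall x (4 * (θ * s)) ⊆ ball z (s - 4 * j * (θ * s)) := by
          intro y hy
          rw [mem_closedBall] at hy; rw [mem_ball] at *
          linarith [dist_triangle y x z]
        have h2 : ball z (s - 4 * j * (θ * s)) ⊆ ball z s := ball_subset_ball (by
          have : 0 ≤ 4 * j * (θ * s) := by positivity
          linarith)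
        have hc'' : 0 ≤ 1 - c' := by linarith
        by_cases hδ : dista Ω x < θ * s
        · have := hdec (ball z s) p hps hpc hp0 x (θ * s) ((1 - c') ^ j) hθs (by nlinarith) hδ (h1.trans h2) (by positivity)
            (fun y hy => ih y (h1 (ball_subset_closedBall hy)))
          rw [pow_succ]; linarith
        · have hxΩ : x ∈ Ω := dista_mem (hθs.trans_le (not_lt.1 hδ))
          have := hwM x ⟨hxΩ, h2 (h1 (mem_closedBall_self (by positivity)))⟩ (not_lt.1 hδ)
          rw [hp, pext_of_mem _ hxΩ, max_eq_right (by linarith)]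
          positivity
    intro x hx
    have h1 : x ∈ ball z (s - 4 * J * (θ * s)) := ball_subset_ball (by nlinarith) hx.2
    have h2 := hiter J x h1
    rw [hp, pext_of_mem _ hx.1] at h2
    have := le_max_left (-1 * w x) 0
    linarith
  · intro x hx hδ
    have e1 : 1 / (2 * C1) * (2 * C1) = 1 := by field_simp
    rw [e1]
    have hxs : x ∈ Ω ∩ ball z s := ⟨hx.1, hsub hx.2⟩
    by_cases hδ2 : θ * s ≤ dista Ω x
    · have := hwM x hxs hδ2
      linarith
    have hδ3 := not_le.1 hδ2
    have hθs : θ * s ≤ r := by nlinarith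
    obtain ⟨e, he, hitg⟩ := G.int x hx.1 (hδ3.trans_le hθs)
    have hd := dista_pos G.op G.ne hx.1
    set τ := θ * s / c with hτ
    have hτ0 : 0 ≤ τ := by positivity
    have hτs : τ ≤ s / 8 := by
      rw [hτ, div_le_iff₀ hc]; nlinarith
    have hτc : c * τ = θ * s := by rw [hτ]; field_simp
    have hθs8 : θ * s ≤ s / 8 := by nlinarith
    have hb : ball x (2 * (dista Ω x + τ)) ⊆ ball z s := by
      intro y hy
      have h2 := hx.2
      rw [mem_ball] at *
      linarith [dist_triangle y x z]
    have hsm : ∀ y ∈ Ω ∩ ball x (2 * (dista Ω x + τ)), y ∈ Ω ∩ ball z s := fun y hy => ⟨hy.1, hb hy.2⟩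
    have hch := (chain G he hd hitg (u := fun y => w y + 1) n τ hτ0 (by linarith) (by
        have h5 : dista Ω x + τ ≤ dista Ω x * (1 + 2 / c) := by
          have : τ ≤ dista Ω x * (2 / c) := by
            rw [hτ, ← mul_div_assoc]
            exact div_le_div_of_nonneg_right (by linarith) hc.le
          linarith
        exact h5.trans (by gcongr))
      (fun y hy => by
        have h6 := hw y (hsm y hy)
        refine ⟨h6.1.add contDiffAt_const, ?_⟩
        rw [lap_add h6.1 contDiffAt_const, h6.2]
        simp [lap]) (fun y hy => by have := hw1 y (hsm y hy); linarith)).1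
    obtain ⟨h7, h8⟩ := hitg τ hτ0 (by linarith)
    have h9 := hwM (x + τ • e) ⟨h7, hb (by
      rw [mem_ball, dist_eq_norm, add_sub_cancel_left, norm_smul, he, Real.norm_eq_abs, abs_of_nonneg hτ0]; linarith)⟩ (by nlinarith)
    rw [← hC1] at hch
    have h10 : 2 * C1 + 1 ≤ C1 * (w x + 1) := by linarith
    by_contra hcon
    have hcon' := not_le.1 hcon
    nlinarith

lemma bh_iter {N : ℕ} {Ω : Set (ES N)} {r c : ℝ} (G : Geo Ω r c) : ∃ M θ : ℝ, 0 < M ∧ 0 < θ ∧ θ ≤ 1/4 ∧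
    ∀ (k : ℕ) z s w, 0 < s → s ≤ r → Harm (Ω ∩ ball z s) w → Van Ω (ball z s) w → (∀ x ∈ Ω ∩ ball z s, -1 ≤ w x) →
    (∀ x ∈ Ω ∩ ball z s, θ * s ≤ dista Ω x → M ≤ w x) →
    ∀ x ∈ Ω ∩ ball z (s / 2 ^ k), θ * (s / 2 ^ k) ≤ dista Ω x → 0 < w x := by
  obtain ⟨a, M, θ, ha, hM, hθ, hθ4, H⟩ := bh_step G
  refine ⟨M, θ, hM, hθ, hθ4, fun k => ?_⟩
  induction k with
  | zero =>
    intro z s w hs hsr hw hv hw1 hwM x hx hδ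
    simp only [pow_zero, div_one] at hx hδ
    exact hM.trans_le (hwM x hx hδ)
  | succ k ih =>
    intro z s w hs hsr hw hv hw1 hwM x hx hδ
    obtain ⟨h1, h2⟩ := H z s w hs hsr hw hv hw1 hwM
    have hsub : ball z (s/2) ⊆ ball z s := ball_subset_ball (by linarith)
    have hss : Ω ∩ ball z (s/2) ⊆ Ω ∩ ball z s := inter_subset_inter_right _ hsub
    have e : s / 2 ^ (k + 1) = s / 2 / 2 ^ k := by rw [pow_succ]; field_simp
    rw [e] at hx hδ
    have := ih z (s/2) (fun y => a⁻¹ * w y) (by positivity) (by linarith) (fun y hy => ?_) (fun y hy => ?_) (fun y hy => ?_) (fun y hy hd => ?_) x hx hδ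
    · exact pos_of_mul_pos_right this (by positivity)
    · have h3 := hw y (hss hy)
      exact ⟨contDiffAt_const.mul h3.1, by rw [lap_cmul _ h3.1, h3.2, mul_zero]⟩
    · have := (hv y ⟨hsub hy.1, hy.2⟩).const_mul a⁻¹
      rwa [mul_zero] at this
    · have := h1 y hy
      rw [inv_mul_eq_div, le_div_iff₀ ha]; linarith
    · have := h2 y hy hd
      rw [inv_mul_eq_div, le_div_iff₀ ha]; linarith

lemma exists_lower {N : ℕ} {Ω : Set (ES N)} {r c : ℝ} (G : Geo Ω r c) {g : ES N → ℝ} (hg : Continuous g) (hpos : ∀ x ∈ Ω, 0 < g x)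
    {η : ℝ} (hη : 0 < η) : ∃ m, 0 < m ∧ ∀ x, η ≤ dista Ω x → m ≤ g x := by
  have hK : IsCompact {x | η ≤ dista Ω x} := by
    refine G.bd.isCompact_closure.of_isClosed_subset (isClosed_le continuous_const (dista_cont Ω)) fun x hx => subset_closure ?_
    exact dista_mem (hη.trans_le hx)
  rcases eq_empty_or_nonempty {x | η ≤ dista Ω x} with h | h
  · refine ⟨1, one_pos, fun x hx => ?_⟩
    have : x ∈ {x | η ≤ dista Ω x} := hx
    rw [h] at this; exact this.elim
  · obtain ⟨y, hy, hmin⟩ := hK.exists_isMinOn h hg.continuousOn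
    exact ⟨g y, hpos y (dista_mem (hη.trans_le hy)), fun x hx => hmin hx⟩

/-- one-sided boundary Harnack principle -/
lemma bh {N : ℕ} {Ω : Set (ES N)} {r c : ℝ} (G : Geo Ω r c) {g : ES N → ℝ} (hg : Continuous g) (hpos : ∀ x ∈ Ω, 0 < g x)
    (hg0 : ∀ x, x ∉ Ω → g x = 0) {η : ℝ} (hη : 0 < η) (hgh : ∀ x ∈ Ω, dista Ω x < η → SmAt g x ∧ lap g x = 0) 
    {x₀ : ES N} (hx₀ : x₀ ∈ Ω) {R : ℝ} (hR : 0 < R) :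
    ∃ C, 0 < C ∧ ∀ D h, IsOpen D → PH Ω h → Van Ω D h → ∀ x ∈ Ω, closedBall x (4 * R) ⊆ D → h x ≤ C * h x₀ * g x := by
  obtain ⟨M, θ, hM, hθ, hθ4, H⟩ := bh_iter G
  obtain ⟨C, hC, hcar⟩ := carleson G hx₀ (R := 2 * R) (by positivity)
  have hr := G.r0
  set s := min (min R η) r with hs
  have hs0 : 0 < s := by positivity
  have hsR : s ≤ R := (min_le_left _ _).trans (min_le_left _ _)
  have hsη : s ≤ η := (min_le_left _ _).trans (min_le_right _ _)
  have hsr : s ≤ r := min_le_right _ _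
  obtain ⟨C2, hC2, hcpt⟩ := harnack_cpt G hx₀ (η := s/2) (by positivity)
  obtain ⟨m, hm, hgm⟩ := exists_lower G hg hpos (η := θ * s) (by positivity)
  set K := (M + 1) * C / m with hK
  have hKp : 0 < K := by positivity
  refine ⟨max K (C2 / m), lt_max_of_lt_left hKp, ?_⟩
  intro D h hD hh hv x hx hxD
  have h00 := hh.2 x₀ hx₀
  have hgx := hpos x hx
  by_cases hδ : s/2 ≤ dista Ω x
  · have h1 := hcpt h hh x hδ
    have h2 := hgm x (by nlinarith)
    calc h x ≤ C2 * h x₀ := h1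
      _ = C2 / m * h x₀ * m := by field_simp
      _ ≤ max K (C2 / m) * h x₀ * g x := by gcongr; exact le_max_right _ _
  have hδ' := not_le.1 hδ
  obtain ⟨z, hz, hxz⟩ := exists_nearest G.op G.ne hx
  have hd := dista_pos G.op G.ne hx
  have hzΩ : z ∉ Ω := by rw [G.op.frontier_eq] at hz; exact hz.2
  rw [← dist_eq_norm] at hxz
  have hzD : closedBall z (2 * R) ⊆ D := by
    refine Subset.trans ?_ hxD
    intro y hy
    rw [mem_closedBall] at *
    have := dist_triangle y z x
    rw [dist_comm z x] at this
    linarith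
  have hub : ∀ y ∈ Ω ∩ ball z s, h y ≤ C * h x₀ := fun y hy => hcar D z h hD hzD hh hv y hy.1 (ball_subset_ball (by linarith) hy.2)
  have hdz : ∀ y ∈ ball z s, dista Ω y < s := fun y hy => by
    rw [mem_ball, dist_eq_norm] at hy
    exact (dista_le hzΩ).trans_lt hy
  set w : ES N → ℝ := fun y => (K / C) * g y - (1 / (C * h x₀)) * h y with hw
  obtain ⟨k, hk1, hk2⟩ := exists_nat_pow_near (x := s / 2 / dista Ω x) (y := 2) (by rw [le_div_iff₀ hd]; linarith) (by norm_num)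
  rw [le_div_iff₀ hd] at hk1
  rw [div_lt_iff₀ hd, pow_succ] at hk2
  have h2k : (0:ℝ) < 2 ^ k := by positivity
  have hpw : 0 < w x := by
    refine H k z s w hs0 hsr ?_ ?_ ?_ ?_ x ⟨hx, ?_⟩ ?_
    · intro y hy
      obtain ⟨a1, a2⟩ := hgh y hy.1 ((hdz y hy.2).trans_le hsη)
      obtain ⟨b1, b2⟩ := hh.1 y hy.1
      have s1 : SmAt (fun y => (K / C) * g y) y := contDiffAt_const.mul a1
      have s2 : SmAt (fun y => (1 / (C * h x₀)) * h y) y := contDiffAt_const.mul b1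
      refine ⟨s1.sub s2, ?_⟩
      rw [hw, lap_sub s1 s2, lap_cmul _ a1, lap_cmul _ b1, a2, b2]; simp
    · intro y hy
      have hyΩ : y ∉ Ω := by have := hy.2; rw [G.op.frontier_eq] at this; exact this.2
      have t1 : Tendsto g (𝓝[Ω] y) (𝓝 0) := by
        rw [← hg0 y hyΩ]; exact hg.continuousAt.tendsto.mono_left nhdsWithin_le_nhds
      have t2 := hv y ⟨hzD (closedBall_subset_closedBall (by linarith) (ball_subset_closedBall hy.1)), hy.2⟩
      have := (t1.const_mul (K / C)).sub (t2.const_mul (1 / (C * h x₀)))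
      rw [mul_zero, mul_zero, sub_zero] at this
      exact this
    · intro y hy
      have h1 := hub y hy
      have h2 := (hpos y hy.1).le
      have h3 : 1 / (C * h x₀) * h y ≤ 1 := by
        rw [one_div, inv_mul_eq_div, div_le_one (by positivity)]; exact h1
      have h4 : 0 ≤ K / C * g y := by positivity
      simp only [hw]; linarith
    · intro y hy hdy
      have h1 := hub y hy
      have h2 := hgm y hdy
      have h3 : 1 / (C * h x₀) * h y ≤ 1 := by
        rw [one_div, inv_mul_eq_div, div_le_one (by positivity)]; exact h1
      have h4 : K / C * m ≤ K / C * g y := by gcongr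
      have h5 : K / C * m = M + 1 := by rw [hK]; field_simp
      simp only [hw]; linarith
    · rw [mem_ball, hxz, lt_div_iff₀ h2k]; nlinarith
    · rw [← mul_div_assoc, div_le_iff₀ h2k]; nlinarith
  simp only [hw, sub_pos] at hpw
  rw [one_div, inv_mul_eq_div, div_lt_iff₀ (by positivity)] at hpw
  calc h x ≤ K / C * g x * (C * h x₀) := hpw.le
    _ = K * h x₀ * g x := by field_simp
    _ ≤ _ := by gcongr; exact le_max_left _ _


lemma pd_nsq {N : ℕ} (x₀ : ES N) (i : Fin N) : pd i (fun y : ES N => ‖y - x₀‖ ^ 2) = fun x => 2 * (x i - x₀ i) := by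
  funext x
  have h1 : HasFDerivAt (fun y : ES N => y - x₀) (ContinuousLinearMap.id ℝ (ES N)) x := (hasFDerivAt_id x).sub_const x₀
  have h2 := (hasStrictFDerivAt_norm_sq (x - x₀)).hasFDerivAt.comp x h1
  have h3 : fderiv ℝ (fun y : ES N => ‖y - x₀‖ ^ 2) x = _ := h2.fderiv
  rw [pd, h3]
  simp [bv, EuclideanSpace.inner_single_right]

lemma pd_coord {N : ℕ} (x₀ : ES N) (i : Fin N) (x : ES N) : pd i (fun y : ES N => 2 * (y i - x₀ i)) x = 2 := by
  have h1 : HasFDerivAt (fun y : ES N => 2 * (y i - x₀ i)) ((2:ℝ) • (EuclideanSpace.proj i : ES N →L[ℝ] ℝ)) x :=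
    (((EuclideanSpace.proj i : ES N →L[ℝ] ℝ).hasFDerivAt (x := x)).sub_const (x₀ i)).const_mul 2
  rw [pd, h1.fderiv]
  simp [bv]

lemma sm_nsq {N : ℕ} (x₀ : ES N) : Sm (fun y : ES N => ‖y - x₀‖ ^ 2) := (contDiff_norm_sq ℝ).comp (contDiff_id.sub contDiff_const)

lemma gsq_nsq {N : ℕ} (x₀ x : ES N) : gsq (fun y : ES N => ‖y - x₀‖ ^ 2) x = 4 * ‖x - x₀‖ ^ 2 := by
  simp only [gsq, pd_nsq]
  rw [EuclideanSpace.norm_sq_eq, Finset.mul_sum]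
  refine Finset.sum_congr rfl fun i _ => ?_
  rw [Real.norm_eq_abs, sq_abs, PiLp.sub_apply]; ring

lemma lap_nsq {N : ℕ} (x₀ x : ES N) : lap (fun y : ES N => ‖y - x₀‖ ^ 2) x = 2 * N := by
  simp only [lap_eq, pd_nsq, pd_coord]
  simp [mul_comm]

lemma exists_U {N : ℕ} (hN : 2 ≤ N) (x₀ : ES N) {ρ : ℝ} (hρ : 0 < ρ) : ∃ U : ES N → ℝ, Sm U ∧ (∀ x, lap U x ≤ 0) ∧
    (∀ x, ρ ≤ ‖x - x₀‖ → lap U x = 0) ∧ ∃ x ∈ ball x₀ ρ, lap U x < 0 := by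
  set q : ℝ := ρ ^ 2 / 2 with hq
  have hq0 : 0 < q := by positivity
  set kf : ℝ → ℝ := fun t => Real.smoothTransition ((t - q) / q) with hkf
  have sk : ContDiff ℝ (⊤ : ℕ∞) kf := by
    apply Real.smoothTransition.contDiff.comp
    fun_prop
  have mk : Monotone kf := by
    intro a b hab
    apply Real.smoothTransition.monotone
    gcongr
  have kz : ∀ t, t ≤ q → kf t = 0 := fun t ht => Real.smoothTransition.zero_of_nonpos (div_nonpos_of_nonpos_of_nonneg (by linarith) hq0.le)
  have ko : ∀ t, 2 * q ≤ t → kf t = 1 := fun t ht => Real.smoothTransition.one_of_one_le (by rw [le_div_iff₀ hq0]; linarith)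
  have dk : ∀ t, HasDerivAt kf (deriv kf t) t := fun t => ((sk.differentiable (by simp)) t).hasDerivAt
  have dk0 : ∀ t, 0 ≤ deriv kf t := fun t => mk.deriv_nonneg
  set α : ℝ := (N:ℝ) / 2 with hα
  set w : ℝ → ℝ := fun t => -(kf t * t ^ (-α)) with hw
  have sw : ContDiff ℝ (⊤ : ℕ∞) w := by
    rw [contDiff_iff_contDiffAt]
    intro t
    rcases lt_or_ge t q with h | h
    · have : w =ᶠ[𝓝 t] fun _ => 0 := by
        filter_upwards [Iio_mem_nhds h] with y hy
        simp [hw, kz y (le_of_lt hy)]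
      exact contDiffAt_const.congr_of_eventuallyEq this
    · exact (sk.contDiffAt.mul (Real.contDiffAt_rpow_const_of_ne (by linarith))).neg
  have dw : ∀ t, 0 < t → deriv w t = -(deriv kf t * t ^ (-α) + kf t * (-α * t ^ (-α - 1))) := by
    intro t ht
    exact ((dk t).mul (Real.hasDerivAt_rpow_const (Or.inl ht.ne'))).neg.deriv
  obtain ⟨φ, sφ, dφ, -⟩ := exists_primitive w sw
  have hl : ∀ x, lap (fun y => φ (‖y - x₀‖ ^ 2)) x = -(4 * deriv kf (‖x - x₀‖ ^ 2) * (‖x - x₀‖ ^ 2) ^ (1 - α)) := by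
    intro x
    rw [lap_comp ((sm_nsq x₀).at x) sφ, gsq_nsq, lap_nsq, dφ]
    rcases (sq_nonneg ‖x - x₀‖).eq_or_lt with h | h
    · have : deriv kf 0 = 0 := by
        have : kf =ᶠ[𝓝 0] fun _ => 0 := by
          filter_upwards [Iio_mem_nhds hq0] with y hy using kz y (le_of_lt hy)
        rw [this.deriv_eq]; simp
      rw [← h, this]; simp [hw, kz 0 hq0.le]
    · generalize ‖x - x₀‖ ^ 2 = t at h
      rw [dw t h]
      simp only [hw]
      rw [Real.rpow_sub h, Real.rpow_sub h, Real.rpow_neg h.le, Real.rpow_one, hα]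
      have : t ^ ((N:ℝ) / 2) ≠ 0 := (Real.rpow_pos_of_pos h _).ne'
      field_simp
      ring
  refine ⟨fun y => φ (‖y - x₀‖ ^ 2), sφ.comp (sm_nsq x₀), fun x => ?_, fun x hx => ?_, ?_⟩
  · rw [hl, neg_nonpos]
    have := dk0 (‖x - x₀‖ ^ 2)
    positivity
  · have h1 : 2 * q ≤ ‖x - x₀‖ ^ 2 := by rw [hq]; nlinarith
    have : deriv kf (‖x - x₀‖ ^ 2) = 0 := by
      have hm : IsLocalMax kf (‖x - x₀‖ ^ 2) := Eventually.of_forall fun y => by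
        rw [ko _ h1]; exact Real.smoothTransition.le_one _
      exact hm.deriv_eq_zero
    rw [hl, this]; simp
  · obtain ⟨t, ht, hd⟩ := exists_deriv_eq_slope kf (by linarith : q < 2 * q) sk.continuous.continuousOn
      (sk.differentiable (by simp)).differentiableOn
    rw [ko _ le_rfl, kz _ le_rfl] at hd
    have ht0 : 0 < t := by linarith [ht.1]
    refine ⟨x₀ + √t • bv ⟨0, by omega⟩, ?_, ?_⟩
    · rw [mem_ball, dist_eq_norm, add_sub_cancel_left, norm_smul]
      have : √t < ρ := by
        rw [Real.sqrt_lt' hρ]; have := ht.2; rw [hq] at this; linarith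
      simpa [bv, abs_of_nonneg (Real.sqrt_nonneg t)] using this
    · have e : ‖x₀ + √t • bv ⟨0, by omega⟩ - x₀‖ ^ 2 = t := by
        rw [add_sub_cancel_left, norm_smul, mul_pow]
        simp [bv, Real.sq_sqrt ht0.le]
      rw [hl, e, hd, neg_lt_zero]
      have : 0 < 2 * q - q := by linarith
      have := Real.rpow_pos_of_pos ht0 (1 - α)
      positivity


lemma cs {N : ℕ} {f g : ES N → ℝ} (hf : Integrable (fun x => f x ^ 2)) (hg : Integrable (fun x => g x ^ 2))
    (hfg : Integrable (fun x => f x * g x)) : (∫ x, f x * g x) ^ 2 ≤ (∫ x, f x ^ 2) * ∫ x, g x ^ 2 := by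
  have h : ∀ t : ℝ, 0 ≤ (∫ x, g x ^ 2) * (t * t) + (2 * ∫ x, f x * g x) * t + ∫ x, f x ^ 2 := by
    intro t
    have e : (∫ x, g x ^ 2) * (t * t) + (2 * ∫ x, f x * g x) * t + ∫ x, f x ^ 2 = ∫ x, ((t * t) * g x ^ 2 + (2 * t) * (f x * g x) + f x ^ 2) := by
      have i1 : Integrable (fun x => (t * t) * g x ^ 2 + (2 * t) * (f x * g x)) := (hg.const_mul _).add (hfg.const_mul _)
      rw [integral_add i1 hf, integral_add (hg.const_mul _) (hfg.const_mul _),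
        integral_const_mul, integral_const_mul]; ring
    rw [e]
    refine integral_nonneg fun x => ?_
    have : (0:ℝ) ≤ (f x + t * g x) ^ 2 := sq_nonneg _
    simp only [Pi.zero_apply]; linarith
  have := discrim_le_zero h
  rw [discrim] at this
  linarith

/-- Dirichlet form -/
def Di {N : ℕ} (u v : ES N → ℝ) : ℝ := ∫ x, ∑ i, pd i u x * pd i v x

lemma Di_int {N : ℕ} {u v : ES N → ℝ} (hu : Sm u) (hv : Sm v) (hc : HasCompactSupport v) :
    Integrable (fun x => ∑ i, pd i u x * pd i v x) :=
  integrable_finsetSum _ fun i _ => ((hu.pd i).continuous.mul (hv.pd i).continuous).integrable_of_hasCompactSupport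
    ((hcs_pd hc i).mul_left)

lemma Di_self {N : ℕ} (u : ES N → ℝ) : Di u u = ∫ x, gsq u x := by
  simp only [Di, gsq, pow_two]

lemma Di_add_left {N : ℕ} {u v w : ES N → ℝ} (hu : Sm u) (hv : Sm v) (hw : Sm w) (hc : HasCompactSupport w) (t : ℝ) :
    Di (fun x => u x + t * v x) w = Di u w + t * Di v w := by
  rw [Di, Di, Di, ← integral_const_mul, ← integral_add (Di_int hu hw hc) ((Di_int hv hw hc).const_mul _)]
  congr 1; funext x
  rw [Finset.mul_sum, ← Finset.sum_add_distrib]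
  refine Finset.sum_congr rfl fun i _ => ?_
  rw [pd_add i (hu.at x).diff (SmAt.diff (contDiffAt_const.mul (hv.at x))), pd_cmul]
  · ring
  · exact (hv.at x).diff

lemma Di_comm {N : ℕ} (u v : ES N → ℝ) : Di u v = Di v u := by
  simp only [Di, mul_comm]

lemma Di_self_add {N : ℕ} {u v : ES N → ℝ} (hu : Sm u) (hv : Sm v) (hcu : HasCompactSupport u) (hcv : HasCompactSupport v) (t : ℝ) :
    Di (fun x => u x + t * v x) (fun x => u x + t * v x) = Di u u + 2 * t * Di u v + t ^ 2 * Di v v := by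
  have h1 : Sm (fun x => u x + t * v x) := hu.add (contDiff_const.mul hv)
  have h2 : HasCompactSupport (fun x => u x + t * v x) := hcu.add (hcv.mul_left)
  rw [Di_add_left hu hv h1 h2, Di_comm u, Di_comm v, Di_add_left hu hv hu hcu, Di_add_left hu hv hv hcv, Di_comm v u]
  ring

lemma test_add {N : ℕ} {Ω : Set (ES N)} {u v : ES N → ℝ} (hu : IsTestFun Ω u) (hv : IsTestFun Ω v) (t : ℝ) :
    IsTestFun Ω (fun x => u x + t * v x) := by
  have hs : tsupport (fun x => u x + t * v x) ⊆ tsupport u ∪ tsupport v := by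
    rw [tsupport, tsupport, tsupport, ← closure_union]
    refine closure_mono fun x hx => ?_
    by_contra hcon
    simp only [mem_union, Function.mem_support, not_or, not_not] at hcon hx
    apply hx; rw [hcon.1, hcon.2]; simp
  exact ⟨hu.1.add (contDiff_const.mul hv.1), (hu.2.1.union hv.2.1).of_isClosed_subset (isClosed_tsupport _) hs,
    hs.trans (union_subset hu.2.2 hv.2.2)⟩

lemma Di_nonneg {N : ℕ} (u : ES N → ℝ) : 0 ≤ Di u u := by
  rw [Di_self]; exact integral_nonneg fun x => gsq_nonneg _ _

lemma approx_min {N : ℕ} (hN : 2 ≤ N) {Ω : Set (ES N)} (hbd : Bornology.IsBounded Ω) {b : ES N → ℝ} (hb : Continuous b)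
    (hbc : HasCompactSupport b) {e : ℝ} (he : 0 < e) :
    ∃ u, IsTestFun Ω u ∧ ∀ ψ, IsTestFun Ω ψ → (Di u ψ - ∫ x, b x * ψ x) ^ 2 ≤ e ^ 2 * Di ψ ψ := by
  obtain ⟨C, hC, hP⟩ := poincare hN hbd
  set J : (ES N → ℝ) → ℝ := fun u => Di u u - 2 * ∫ x, b x * u x with hJ
  have hib : ∀ u, IsTestFun Ω u → Integrable (fun x => b x * u x) := fun u hu =>
    (hb.mul hu.1.continuous).integrable_of_hasCompactSupport (hbc.mul_right)
  have hlow : ∀ u, IsTestFun Ω u → -(C * ∫ x, b x ^ 2) ≤ J u := by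
    intro u hu
    have h1 := cs (int_sq hb hbc) (int_sq hu.1.continuous hu.2.1) (hib u hu)
    have h2 := hP u hu
    rw [← Di_self] at h2
    have h3 : 0 ≤ ∫ x, b x ^ 2 := integral_nonneg fun x => sq_nonneg _
    have h4 : (∫ x, b x * u x) ^ 2 ≤ (C * ∫ x, b x ^ 2) * Di u u := h1.trans (by nlinarith)
    have h5 : 0 ≤ C * ∫ x, b x ^ 2 := by positivity
    have h6 := Di_nonneg u
    simp only [hJ]
    have h7 : 2 * |∫ x, b x * u x| ≤ (C * ∫ x, b x ^ 2) + Di u u := by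
      refine abs_le_of_sq_le_sq' ?_ (by positivity) |>.2
      rw [mul_pow, sq_abs]
      nlinarith [sq_nonneg ((C * ∫ x, b x ^ 2) - Di u u)]
    linarith [le_abs_self (∫ x, b x * u x)]
  set S := J '' {u | IsTestFun Ω u} with hS
  have hSb : BddBelow S := ⟨-(C * ∫ x, b x ^ 2), by rintro _ ⟨u, hu, rfl⟩; exact hlow u hu⟩
  have h0 : IsTestFun Ω (fun _ => 0) := by
    have : tsupport (fun _ : ES N => (0:ℝ)) = ∅ := by simp [tsupport, Function.support]
    refine ⟨contDiff_const, ?_, ?_⟩ <;> rw [this]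
    · exact isCompact_empty
    · exact empty_subset _
  have hSn : S.Nonempty := ⟨_, _, h0, rfl⟩
  obtain ⟨_, ⟨u, hu, rfl⟩, hlt⟩ := exists_lt_of_csInf_lt hSn (show sInf S < sInf S + e ^ 2 by nlinarith)
  refine ⟨u, hu, fun ψ hψ => ?_⟩
  have key : ∀ t : ℝ, 0 ≤ Di ψ ψ * (t * t) + (2 * (Di u ψ - ∫ x, b x * ψ x)) * t + e ^ 2 := by
    intro t
    have h1 := csInf_le hSb ⟨_, test_add hu hψ t, rfl⟩
    have h2 : J (fun x => u x + t * ψ x) = J u + 2 * t * (Di u ψ - ∫ x, b x * ψ x) + t ^ 2 * Di ψ ψ := by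
      simp only [hJ]
      rw [Di_self_add hu.1 hψ.1 hu.2.1 hψ.2.1]
      have : ∫ x, b x * (u x + t * ψ x) = (∫ x, b x * u x) + t * ∫ x, b x * ψ x := by
        rw [← integral_const_mul, ← integral_add (hib u hu) ((hib ψ hψ).const_mul _)]
        congr 1; funext x; ring
      rw [this]; ring
    linarith
  have := discrim_le_zero key
  rw [discrim] at this
  linarith

/-- truncated error estimate -/
lemma trunc_est {N : ℕ} {Ω : Set (ES N)} {u f U : ES N → ℝ} {e : ℝ} (he : 0 ≤ e) (hu : IsTestFun Ω u) (hf : Continuous f)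
    (h : ∀ ψ, IsTestFun Ω ψ → Di u ψ - ∫ x, f x * ψ x ≤ e * √(Di ψ ψ)) (hU : Sm U) (hU0 : ∀ x, 0 ≤ U x)
    (hl : ∀ x ∈ Ω, f x ≤ - lap U x) {κ : ℝ} (hκ : 0 < κ) {σ Φ Ψ : ℝ → ℝ} (T : Trunc κ σ Φ Ψ) :
    IsTestFun Ω (fun x => Φ (u x - U x)) ∧ Di (fun x => Φ (u x - U x)) (fun x => Φ (u x - U x)) ≤ e ^ 2 := by
  have hus : Sm u := hu.1
  have huc : HasCompactSupport u := hu.2.1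
  have hts : ∀ Θ : ℝ → ℝ, ContDiff ℝ (⊤ : ℕ∞) Θ → (∀ t ≤ κ, Θ t = 0) → IsTestFun Ω (fun x => Θ (u x - U x)) := by
    intro Θ hΘ hz
    have hs : tsupport (fun x => Θ (u x - U x)) ⊆ tsupport u := closure_mono fun x hx => by
      simp only [Function.mem_support] at *
      intro h0; exact hx (hz _ (by rw [h0]; linarith [hU0 x]))
    exact ⟨hΘ.comp (hus.sub hU), huc.of_isClosed_subset (isClosed_tsupport _) hs, hs.trans hu.2.2⟩
  have tΦ := hts Φ T.sΦ T.Φz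
  have tΨ := hts Ψ T.sΨ T.Ψz
  refine ⟨tΦ, ?_⟩
  set D := Di (fun x => Φ (u x - U x)) (fun x => Φ (u x - U x)) with hD
  have hw : Sm (fun x => u x + (-1) * U x) := hus.add (contDiff_const.mul hU)
  have hw' : Sm (fun x => u x - U x) := hus.sub hU
  have ew : (fun x => u x + (-1) * U x) = fun x => u x - U x := by funext x; ring
  have pΦ : ∀ i x, pd i (fun x => Φ (u x - U x)) x = σ (u x - U x) * pd i (fun x => u x - U x) x := fun i x => by
    rw [pd_comp i (hw'.at x).diff (T.sΦ.differentiable (by simp) _), T.dΦ]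
  have pΨ : ∀ i x, pd i (fun x => Ψ (u x - U x)) x = σ (u x - U x) ^ 2 * pd i (fun x => u x - U x) x := fun i x => by
    rw [pd_comp i (hw'.at x).diff (T.sΨ.differentiable (by simp) _), T.dΨ]
  have e1 : Di (fun x => u x - U x) (fun x => Ψ (u x - U x)) = D := by
    rw [hD, Di, Di]
    congr 1; funext x
    refine Finset.sum_congr rfl fun i _ => ?_
    rw [pΦ, pΨ]; ring
  have e2 : Di (fun x => Ψ (u x - U x)) (fun x => Ψ (u x - U x)) ≤ D := by
    rw [hD, Di, Di]
    refine integral_mono (Di_int tΨ.1 tΨ.1 tΨ.2.1) (Di_int tΦ.1 tΦ.1 tΦ.2.1) fun x => ?_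
    refine Finset.sum_le_sum fun i _ => ?_
    rw [pΦ, pΨ]
    have h0 := T.σ0 (u x - U x)
    have h1 := T.σ1 (u x - U x)
    have h2 : σ (u x - U x) ^ 2 ≤ 1 := by nlinarith
    have h3 : 0 ≤ (σ (u x - U x) * pd i (fun x => u x - U x) x) * (σ (u x - U x) * pd i (fun x => u x - U x) x) := mul_self_nonneg _
    nlinarith
  have e3 : D = Di u (fun x => Ψ (u x - U x)) + ∫ x, lap U x * Ψ (u x - U x) := by
    rw [← e1, ← ew, Di_add_left hus hU tΨ.1 tΨ.2.1]
    have : Di U (fun x => Ψ (u x - U x)) = _ := green1 hU tΨ.1 tΨ.2.1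
    rw [ew] at *
    rw [this]; ring
  have h4 := h _ tΨ
  have h5 : ∫ x, lap U x * Ψ (u x - U x) ≤ ∫ x, -(f x * Ψ (u x - U x)) := by
    refine integral_mono ?_ ?_ fun x => ?_
    · exact (hU.lap.continuous.mul tΨ.1.continuous).integrable_of_hasCompactSupport (HasCompactSupport.mul_left tΨ.2.1)
    · exact ((hf.mul tΨ.1.continuous).integrable_of_hasCompactSupport (HasCompactSupport.mul_left tΨ.2.1)).neg
    · by_cases hx : x ∈ Ω
      · have h0 : 0 ≤ Ψ (u x - U x) := by
          rcases le_total (u x - U x) κ with h | h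
          · rw [T.Ψz _ h]
          · rw [← T.Ψz κ le_rfl]; exact T.Ψm h
        have := hl x hx
        simp only; nlinarith
      · have : Ψ (u x - U x) = 0 := by
          have := image_eq_zero_of_notMem_tsupport (fun hh => hx (tΨ.2.2 hh))
          exact this
        simp only [this]; simp
  rw [integral_neg] at h5
  have h6 : D ≤ e * √D := by
    have : √(Di (fun x => Ψ (u x - U x)) (fun x => Ψ (u x - U x))) ≤ √D := Real.sqrt_le_sqrt e2
    nlinarith
  have hD0 : 0 ≤ D := Di_nonneg _
  have h7 := Real.sq_sqrt hD0
  have h8 := Real.sqrt_nonneg D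
  have h9 : √D ≤ e := by
    rcases h8.eq_or_lt with h | h
    · rw [← h]; exact he
    · by_contra hcon; have := not_le.1 hcon; nlinarith
  nlinarith


lemma eLp2 {N : ℕ} {f : ES N → ℝ} (hf : MemLp f 2) : eLpNorm f 2 volume = ENNReal.ofReal (√(∫ x, f x ^ 2)) := by
  rw [hf.eLpNorm_eq_integral_rpow_norm (by simp) (by simp), Real.sqrt_eq_rpow]
  simp

lemma root_bound {D a : ℝ} (hD : 0 ≤ D) (ha : 0 ≤ a) (h : D ≤ a * √D) : D ≤ a ^ 2 := by
  have h7 := Real.sq_sqrt hD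
  have h8 := Real.sqrt_nonneg D
  have h9 : √D ≤ a := by
    rcases h8.eq_or_lt with h | h
    · rw [← h]; exact ha
    · by_contra hcon; have := not_le.1 hcon; nlinarith
  nlinarith

lemma ae_le_of {N : ℕ} {Ω : Set (ES N)} {u : ℕ → ES N → ℝ} {g f U : ES N → ℝ} (hu : ∀ n, IsTestFun Ω (u n)) (hg : MemLp g 2)
    (hlim : Tendsto (fun n => ∫ x, (u n x - g x) ^ 2) atTop (𝓝 0)) {e : ℕ → ℝ} (he : ∀ n, 0 ≤ e n) (hel : Tendsto e atTop (𝓝 0))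
    {C : ℝ} (hP : ∀ u, IsTestFun Ω u → ∫ x, u x ^ 2 ≤ C * ∫ x, gsq u x) (hC : 0 ≤ C) (hf : Continuous f)
    (h : ∀ n ψ, IsTestFun Ω ψ → Di (u n) ψ - ∫ x, f x * ψ x ≤ e n * √(Di ψ ψ)) (hU : Sm U) (hU0 : ∀ x, 0 ≤ U x)
    (hl : ∀ x ∈ Ω, f x ≤ - lap U x) {κ : ℝ} (hκ : 0 < κ) : ∀ᵐ x, g x ≤ U x + 2 * κ := by
  obtain ⟨σ, Φ, Ψ, T⟩ := exists_trunc hκ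
  set w : ES N → ℝ := fun x => max (g x - U x - 2 * κ) 0 with hw
  have hum : ∀ n, MemLp (u n) 2 := fun n => (hu n).1.continuous.memLp_of_hasCompactSupport (hu n).2.1
  have hwm : AEStronglyMeasurable w volume :=
    ((((hg.1.sub hU.continuous.aestronglyMeasurable).sub aestronglyMeasurable_const)).sup aestronglyMeasurable_const)
  have hwi : Integrable (fun x => w x ^ 2) := by
    refine hg.integrable_sq.mono' (hwm.pow 2) (Eventually.of_forall fun x => ?_)
    rw [Real.norm_eq_abs, abs_of_nonneg (sq_nonneg _)]
    have h0 := hU0 x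
    simp only [hw]
    rcases le_total (g x - U x - 2 * κ) 0 with h1 | h1
    · rw [max_eq_right h1]; nlinarith
    · rw [max_eq_left h1]; nlinarith
  have hb : ∀ n, ∫ x, w x ^ 2 ≤ 2 * (C * e n ^ 2) + 2 * ∫ x, (u n x - g x) ^ 2 := by
    intro n
    obtain ⟨tΦ, hD⟩ := trunc_est (he n) (hu n) hf (h n) hU hU0 hl hκ T
    have h1 := hP _ tΦ
    rw [← Di_self] at h1
    have h2 : ∫ x, Φ (u n x - U x) ^ 2 ≤ C * e n ^ 2 := h1.trans (by gcongr)
    have i1 : Integrable (fun x => Φ (u n x - U x) ^ 2) := int_sq tΦ.1.continuous tΦ.2.1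
    have i2 : Integrable (fun x => (u n x - g x) ^ 2) := ((hum n).sub hg).integrable_sq
    have h3 : ∫ x, w x ^ 2 ≤ ∫ x, (2 * Φ (u n x - U x) ^ 2 + 2 * (u n x - g x) ^ 2) := by
      refine integral_mono hwi ((i1.const_mul 2).add (i2.const_mul 2)) fun x => ?_
      have a1 := T.Φl (u n x - U x)
      have a2 := T.Φ0 (u n x - U x)
      have a3 : w x ≤ Φ (u n x - U x) + |u n x - g x| := by
        simp only [hw]
        have := neg_abs_le (u n x - g x)
        have := abs_nonneg (u n x - g x)
        exact max_le (by linarith) (by linarith)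
      have a4 : 0 ≤ w x := le_max_right _ _
      have a5 := sq_abs (u n x - g x)
      have a6 := abs_nonneg (u n x - g x)
      simp only
      nlinarith [sq_nonneg (Φ (u n x - U x) - |u n x - g x|)]
    rw [integral_add (i1.const_mul 2) (i2.const_mul 2), integral_const_mul, integral_const_mul] at h3
    linarith
  have h0 : ∫ x, w x ^ 2 ≤ 0 := by
    have : Tendsto (fun n => 2 * (C * e n ^ 2) + 2 * ∫ x, (u n x - g x) ^ 2) atTop (𝓝 (2 * (C * 0 ^ 2) + 2 * 0)) :=
      ((((hel.pow 2).const_mul C)).const_mul 2).add (hlim.const_mul 2)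
    have := ge_of_tendsto' this hb
    simpa using this
  have h1 : ∫ x, w x ^ 2 = 0 := le_antisymm h0 (integral_nonneg fun x => sq_nonneg _)
  rw [integral_eq_zero_iff_of_nonneg (fun x => sq_nonneg _) hwi] at h1
  filter_upwards [h1] with x hx
  have hx : w x ^ 2 = 0 := hx
  have h2 : w x = 0 := by simpa using hx
  have h3 : g x - U x - 2 * κ ≤ w x := le_max_left _ _
  linarith

/-- `L²` limit of approximate minimizers -/
lemma exists_l2lim {N : ℕ} (hN : 2 ≤ N) {Ω : Set (ES N)} (hbd : Bornology.IsBounded Ω) {b : ES N → ℝ} (hb : Continuous b)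
    (hbc : HasCompactSupport b) : ∃ (u : ℕ → ES N → ℝ) (g : ES N → ℝ), (∀ n, IsTestFun Ω (u n)) ∧ MemLp g 2 ∧
    Tendsto (fun n => ∫ x, (u n x - g x) ^ 2) atTop (𝓝 0) ∧
    (∀ n ψ, IsTestFun Ω ψ → |Di (u n) ψ - ∫ x, b x * ψ x| ≤ (1/2) ^ n * √(Di ψ ψ)) := by
  obtain ⟨C, hC, hP⟩ := poincare hN hbd
  choose u hu hm using fun n : ℕ => approx_min hN hbd hb hbc (e := (1/2) ^ n) (by positivity)
  have hm' : ∀ n ψ, IsTestFun Ω ψ → |Di (u n) ψ - ∫ x, b x * ψ x| ≤ (1/2) ^ n * √(Di ψ ψ) := by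
    intro n ψ hψ
    have := Real.abs_le_sqrt (hm n ψ hψ)
    rwa [Real.sqrt_mul (by positivity), Real.sqrt_sq (by positivity)] at this
  have hum : ∀ n, MemLp (u n) 2 := fun n => (hu n).1.continuous.memLp_of_hasCompactSupport (hu n).2.1
  have hcau : ∀ n m, ∫ x, (u n x - u m x) ^ 2 ≤ C * ((1/2) ^ n + (1/2) ^ m) ^ 2 := by
    intro n m
    have tv := test_add (hu n) (hu m) (-1)
    have e : (fun x => u n x + (-1) * u m x) = fun x => u n x - u m x := by funext x; ring
    rw [e] at tv
    have h1 : Di (fun x => u n x - u m x) (fun x => u n x - u m x) = Di (u n) (fun x => u n x - u m x) - Di (u m) (fun x => u n x - u m x) := by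
      have := Di_add_left (hu n).1 (hu m).1 tv.1 tv.2.1 (-1)
      rw [e] at this
      rw [this]; ring
    have h2 := abs_le.1 (hm' n _ tv)
    have h3 := abs_le.1 (hm' m _ tv)
    have h4 := root_bound (Di_nonneg _) (a := (1/2) ^ n + (1/2) ^ m) (by positivity) (by rw [h1] at *; linarith [h2.2, h3.1])
    have := hP _ tv
    rw [← Di_self] at this
    exact this.trans (by gcongr)
  obtain ⟨g, hg, hlim⟩ := Lp.cauchy_complete_eLpNorm (p := 2) (μ := volume) (by simp) hum
    (B := fun n => ENNReal.ofReal ((√C * 3) * (1/2) ^ n)) (by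
      refine Summable.tsum_ofReal_ne_top ?_
      exact (summable_geometric_of_lt_one (by norm_num) (by norm_num)).mul_left _) (by
      intro k n m hn hm
      rw [eLp2 ((hum n).sub (hum m)), ENNReal.ofReal_lt_ofReal_iff (by positivity), Real.sqrt_lt' (by positivity)]
      have h1 := hcau n m
      have hn' : (1/2:ℝ) ^ n ≤ (1/2) ^ k := pow_le_pow_of_le_one (by norm_num) (by norm_num) hn
      have hm' : (1/2:ℝ) ^ m ≤ (1/2) ^ k := pow_le_pow_of_le_one (by norm_num) (by norm_num) hm
      have hk : (0:ℝ) < (1/2) ^ k := by positivity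
      have hn0 : (0:ℝ) < (1/2) ^ n := by positivity
      have hm0 : (0:ℝ) < (1/2) ^ m := by positivity
      have h2 : ((1/2:ℝ) ^ n + (1/2) ^ m) ^ 2 < 9 * ((1/2) ^ k) ^ 2 := by nlinarith
      have h3 : (√C * 3 * (1/2) ^ k) ^ 2 = C * (9 * ((1/2) ^ k) ^ 2) := by
        rw [mul_pow, mul_pow, Real.sq_sqrt hC.le]; ring
      rw [h3]
      refine lt_of_le_of_lt h1 ?_
      gcongr)
  refine ⟨u, g, hu, hg, ?_, hm'⟩
  have h1 : ∀ n, ∫ x, (u n x - g x) ^ 2 = ((eLpNorm (u n - g) 2 volume).toReal) ^ 2 := by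
    intro n
    rw [eLp2 ((hum n).sub hg), ENNReal.toReal_ofReal (Real.sqrt_nonneg _), Real.sq_sqrt (integral_nonneg fun x => sq_nonneg _)]
    rfl
  simp_rw [h1]
  have := ((ENNReal.tendsto_toReal (by simp : (0:ℝ≥0∞) ≠ ⊤)).comp hlim).pow 2
  simpa using this

/-- smooth approximation of the absolute value -/
lemma exists_abs {κ : ℝ} (hκ : 0 < κ) : ∃ H η : ℝ → ℝ, ContDiff ℝ (⊤ : ℕ∞) H ∧ ContDiff ℝ (⊤ : ℕ∞) η ∧ deriv H = η ∧ η 0 = 0 ∧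
    (∀ t, |η t| ≤ 1) ∧ (∀ t, 0 ≤ deriv η t ∧ deriv η t ≤ 1 / κ) ∧ (∀ t, |H t - abs t| ≤ κ) ∧ ∀ s t, |H s - H t| ≤ |s - t| := by
  have hp : ∀ t : ℝ, 0 < t ^ 2 + κ ^ 2 := fun t => by positivity
  have hq : ∀ t : ℝ, 0 < √(t ^ 2 + κ ^ 2) := fun t => Real.sqrt_pos.2 (hp t)
  have hsq : ∀ t : ℝ, √(t ^ 2 + κ ^ 2) ^ 2 = t ^ 2 + κ ^ 2 := fun t => Real.sq_sqrt (hp t).le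
  have hab : ∀ t : ℝ, |t| ≤ √(t ^ 2 + κ ^ 2) := fun t => Real.abs_le_sqrt (by nlinarith)
  have hkq : ∀ t : ℝ, κ ≤ √(t ^ 2 + κ ^ 2) := fun t => Real.le_sqrt_of_sq_le (by nlinarith)
  have sH : ContDiff ℝ (⊤ : ℕ∞) (fun t : ℝ => √(t ^ 2 + κ ^ 2)) := ContDiff.sqrt (by fun_prop) (fun t => (hp t).ne')
  have dH : ∀ t : ℝ, HasDerivAt (fun t : ℝ => √(t ^ 2 + κ ^ 2)) (t / √(t ^ 2 + κ ^ 2)) t := by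
    intro t
    have h1 : HasDerivAt (fun t : ℝ => t ^ 2 + κ ^ 2) (2 * t) t := by
      simpa using (hasDerivAt_pow 2 t).add_const (κ ^ 2)
    have h2 := h1.sqrt (hp t).ne'
    rwa [mul_div_mul_left _ _ (by norm_num : (2:ℝ) ≠ 0)] at h2
  have dη : ∀ t : ℝ, HasDerivAt (fun t : ℝ => t / √(t ^ 2 + κ ^ 2)) (κ ^ 2 / √(t ^ 2 + κ ^ 2) ^ 3) t := by
    intro t
    have h := (hasDerivAt_id' t).fun_div (dH t) (hq t).ne'
    have h1 := hsq t
    have h2 := (hq t).ne'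
    have e : κ ^ 2 / √(t ^ 2 + κ ^ 2) ^ 3 = (1 * √(t ^ 2 + κ ^ 2) - t * (t / √(t ^ 2 + κ ^ 2))) / √(t ^ 2 + κ ^ 2) ^ 2 := by
      generalize √(t ^ 2 + κ ^ 2) = q at h1 h2
      field_simp
      linarith
    rw [e]; exact h
  refine ⟨fun t => √(t ^ 2 + κ ^ 2), fun t => t / √(t ^ 2 + κ ^ 2), sH, contDiff_id.div sH (fun t => (hq t).ne'),
    funext fun t => (dH t).deriv, by simp, fun t => ?_, fun t => ?_, fun t => ?_, fun s t => ?_⟩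
  · rw [abs_div, abs_of_pos (hq t), div_le_one (hq t)]; exact hab t
  · rw [(dη t).deriv]
    refine ⟨by have := hq t; positivity, ?_⟩
    rw [div_le_div_iff₀ (by have := hq t; positivity) hκ]
    have := pow_le_pow_left₀ hκ.le (hkq t) 3
    linarith
  · rw [abs_le]
    refine ⟨by linarith [hab t], ?_⟩
    rw [tsub_le_iff_right, Real.sqrt_le_left (by positivity)]
    have := sq_abs t
    have := abs_nonneg t
    nlinarith
  · have h1 := hq s
    have h2 := hq t
    have h3 := hsq s
    have h4 := hsq t
    have h5 : |√(s ^ 2 + κ ^ 2) - √(t ^ 2 + κ ^ 2)| * (√(s ^ 2 + κ ^ 2) + √(t ^ 2 + κ ^ 2)) = |s - t| * |s + t| := by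
      rw [← abs_mul, ← abs_of_pos (add_pos h1 h2), ← abs_mul]
      congr 1; nlinarith
    have h6 : |s + t| ≤ √(s ^ 2 + κ ^ 2) + √(t ^ 2 + κ ^ 2) := (abs_add_le s t).trans (add_le_add (hab s) (hab t))
    refine le_of_mul_le_mul_right ?_ (add_pos h1 h2)
    rw [h5]
    exact mul_le_mul_of_nonneg_left h6 (abs_nonneg _)


lemma exists_barrier {N : ℕ} (hN : 2 ≤ N) {Ω : Set (ES N)} (hbd : Bornology.IsBounded Ω) {k : ℝ} (hk : 0 ≤ k) :
    ∃ (U : ES N → ℝ) (M : ℝ), Sm U ∧ (∀ x, 0 ≤ U x) ∧ (∀ x, U x ≤ M) ∧ ∀ x ∈ Ω, k ≤ - lap U x := by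
  obtain ⟨R, hR0, hR⟩ := hbd.subset_ball_lt 0 (0 : ES N)
  obtain ⟨χ, hχ, hχc, hχt, hχ01, hχ1⟩ := exists_plateau (0 : ES N) hR0
  have hb : Sm (fun x : ES N => k * (2 * R) ^ 2 - k * ‖x - 0‖ ^ 2) := contDiff_const.sub (contDiff_const.mul (sm_nsq 0))
  refine ⟨fun x => χ x * (k * (2 * R) ^ 2 - k * ‖x - 0‖ ^ 2), k * (2 * R) ^ 2, hχ.mul hb, fun x => ?_, fun x => ?_, fun x hx => ?_⟩
  · by_cases hx : x ∈ closedBall 0 (2 * R)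
    · rw [mem_closedBall, dist_eq_norm] at hx
      have : ‖x - 0‖ ^ 2 ≤ (2 * R) ^ 2 := by gcongr
      exact mul_nonneg (hχ01 x).1 (by nlinarith)
    · have h0 : χ x = 0 := image_eq_zero_of_notMem_tsupport (fun h => hx (hχt h))
      simp only [h0, zero_mul, le_refl]
  · have h1 : k * (2 * R) ^ 2 - k * ‖x - 0‖ ^ 2 ≤ k * (2 * R) ^ 2 := by
      have : 0 ≤ k * ‖x - 0‖ ^ 2 := by positivity
      linarith
    have h2 : 0 ≤ k * (2 * R) ^ 2 := by positivity
    calc χ x * (k * (2 * R) ^ 2 - k * ‖x - 0‖ ^ 2) ≤ χ x * (k * (2 * R) ^ 2) := mul_le_mul_of_nonneg_left h1 (hχ01 x).1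
      _ ≤ 1 * (k * (2 * R) ^ 2) := mul_le_mul_of_nonneg_right (hχ01 x).2 h2
      _ = _ := one_mul _
  · have hev : (fun x => χ x * (k * (2 * R) ^ 2 - k * ‖x - 0‖ ^ 2)) =ᶠ[𝓝 x] fun x => k * (2 * R) ^ 2 - k * ‖x - 0‖ ^ 2 := by
      filter_upwards [isOpen_ball.mem_nhds (hR hx)] with y hy
      rw [hχ1 y (ball_subset_closedBall hy), one_mul]
    rw [lap_congr hev]
    have e := lap_sub (f := fun _ => k * (2 * R) ^ 2) (g := fun x : ES N => k * ‖x - 0‖ ^ 2) (x := x) contDiffAt_const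
      (contDiffAt_const.mul ((sm_nsq 0).at x))
    have e2 : lap (fun _ : ES N => k * (2 * R) ^ 2) x = 0 := by simp [lap]
    rw [e, e2, lap_cmul _ ((sm_nsq 0).at x), lap_nsq]
    have : (2:ℝ) ≤ N := by exact_mod_cast hN
    nlinarith

lemma Di_zero {N : ℕ} (w : ES N → ℝ) : Di (fun _ => 0) w = 0 := by
  simp [Di, pd]

lemma sub_est {N : ℕ} {Ω : Set (ES N)} {u b φ : ES N → ℝ} {e κ F : ℝ} (he : 0 ≤ e) (hu : IsTestFun Ω u) (hb : Continuous b) (hb0 : ∀ x, 0 ≤ b x)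
    (h : ∀ ψ, IsTestFun Ω ψ → |Di u ψ - ∫ x, b x * ψ x| ≤ e * √(Di ψ ψ)) (hφ : Sm φ) (hφc : HasCompactSupport φ)
    (hφ0 : ∀ x, 0 ≤ φ x) (hφF : ∀ x, φ x ≤ F) (hκ : 0 < κ) {H η : ℝ → ℝ} (sH : ContDiff ℝ (⊤ : ℕ∞) H) (sη : ContDiff ℝ (⊤ : ℕ∞) η)
    (dH : deriv H = η) (η0 : η 0 = 0) (η1 : ∀ t, |η t| ≤ 1) (dη : ∀ t, 0 ≤ deriv η t ∧ deriv η t ≤ 1 / κ) :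
    -(∫ x, H (u x) * lap φ x) ≤ (∫ x, b x * φ x) + e * √(2 * Di φ φ + 2 * (F / κ) ^ 2 * Di u u) := by
  have hus : Sm u := hu.1
  have huc : HasCompactSupport u := hu.2.1
  have sηu : Sm (fun x => η (u x)) := sη.comp hus
  have sHu : Sm (fun x => H (u x)) := sH.comp hus
  have hs : tsupport (fun x => η (u x) * φ x) ⊆ tsupport u := closure_mono fun x hx => by
    simp only [Function.mem_support] at *
    intro h0; exact hx (by rw [h0, η0, zero_mul])
  have tψ : IsTestFun Ω (fun x => η (u x) * φ x) :=
    ⟨sηu.mul hφ, huc.of_isClosed_subset (isClosed_tsupport _) hs, hs.trans hu.2.2⟩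
  have pη : ∀ i x, pd i (fun x => η (u x)) x = deriv η (u x) * pd i u x := fun i x =>
    pd_comp i (hus.at x).diff (sη.differentiable (by simp) _)
  have pH : ∀ i x, pd i (fun x => H (u x)) x = η (u x) * pd i u x := fun i x => by
    rw [pd_comp i (hus.at x).diff (sH.differentiable (by simp) _), dH]
  have h1 : -(∫ x, H (u x) * lap φ x) ≤ Di u (fun x => η (u x) * φ x) := by
    rw [← green1' sHu hφ hφc]
    refine integral_mono (Di_int sHu hφ hφc) (Di_int hus tψ.1 tψ.2.1) fun x => Finset.sum_le_sum fun i _ => ?_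
    rw [pd_mul i (sηu.at x).diff (hφ.at x).diff, pH, pη]
    have : 0 ≤ φ x * deriv η (u x) * pd i u x ^ 2 := mul_nonneg (mul_nonneg (hφ0 x) (dη _).1) (sq_nonneg _)
    nlinarith
  have h2 := (abs_le.1 (h _ tψ)).2
  have h3 : ∫ x, b x * (η (u x) * φ x) ≤ ∫ x, b x * φ x := by
    refine integral_mono ?_ ?_ fun x => ?_
    · exact (hb.mul tψ.1.continuous).integrable_of_hasCompactSupport (HasCompactSupport.mul_left tψ.2.1)
    · exact (hb.mul hφ.continuous).integrable_of_hasCompactSupport (HasCompactSupport.mul_left hφc)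
    · have a1 := (abs_le.1 (η1 (u x))).2
      have a2 := hb0 x
      have a3 := hφ0 x
      have a4 : η (u x) * φ x ≤ φ x := by nlinarith
      exact mul_le_mul_of_nonneg_left a4 a2
  have h4 : Di (fun x => η (u x) * φ x) (fun x => η (u x) * φ x) ≤ 2 * Di φ φ + 2 * (F / κ) ^ 2 * Di u u := by
    rw [Di_self, Di_self, Di_self, ← integral_const_mul, ← integral_const_mul,
      ← integral_add ((gsq_int hφ hφc).const_mul _) ((gsq_int hus huc).const_mul _)]
    refine integral_mono (gsq_int tψ.1 tψ.2.1) (((gsq_int hφ hφc).const_mul _).add ((gsq_int hus huc).const_mul _)) fun x => ?_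
    refine (gsq_mul_le (sηu.at x).diff (hφ.at x).diff).trans ?_
    have a1 : gsq (fun x => η (u x)) x = deriv η (u x) ^ 2 * gsq u x := by
      simp only [gsq, pη, mul_pow, Finset.mul_sum]
    have a2 : η (u x) ^ 2 ≤ 1 := by
      have := η1 (u x); rw [← sq_abs]; have := abs_nonneg (η (u x)); nlinarith
    have a3 : φ x * deriv η (u x) ≤ F / κ := by
      rw [div_eq_mul_one_div]
      exact mul_le_mul (hφF x) (dη _).2 (dη _).1 ((hφ0 x).trans (hφF x))
    have a4 : 0 ≤ φ x * deriv η (u x) := mul_nonneg (hφ0 x) (dη _).1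
    have a5 : (φ x * deriv η (u x)) ^ 2 ≤ (F / κ) ^ 2 := by gcongr
    have g1 := gsq_nonneg u x
    have g2 := gsq_nonneg φ x
    rw [a1]
    have a6 : (φ x * deriv η (u x)) ^ 2 * gsq u x ≤ (F / κ) ^ 2 * gsq u x := by gcongr
    have a7 : η (u x) ^ 2 * gsq φ x ≤ 1 * gsq φ x := by gcongr
    nlinarith
  have h5 := Real.sqrt_le_sqrt h4
  have h6 := mul_le_mul_of_nonneg_left h5 he
  linarith

lemma exists_weak {N : ℕ} (hN : 2 ≤ N) {Ω : Set (ES N)} (hΩ : IsOpen Ω) (hbd : Bornology.IsBounded Ω) {b : ES N → ℝ} (hb : Continuous b)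
    (hbc : HasCompactSupport b) (hb0 : ∀ x, 0 ≤ b x) : ∃ g : ES N → ℝ, BM g ∧ (∀ x, 0 ≤ g x) ∧
    (∀ x, x ∉ Ω → g x = 0) ∧ (∀ φ, IsTestFun Ω φ → ∫ x, g x * lap φ x = -∫ x, b x * φ x) ∧
    (∀ φ, Sm φ → HasCompactSupport φ → (∀ x, 0 ≤ φ x) → -(∫ x, b x * φ x) ≤ ∫ x, g x * lap φ x) := by
  obtain ⟨C, hC, hP⟩ := poincare hN hbd
  obtain ⟨u, g1, hu, hg1, hlim1, hm⟩ := exists_l2lim hN (Ω := Ω) hbd hb hbc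
  have hum : ∀ n, MemLp (u n) 2 := fun n => (hu n).1.continuous.memLp_of_hasCompactSupport (hu n).2.1
  have hel : Tendsto (fun n : ℕ => (1/2:ℝ) ^ n) atTop (𝓝 0) := tendsto_pow_atTop_nhds_zero_of_lt_one (by norm_num) (by norm_num)
  obtain ⟨kb, hkb⟩ := (BM.of_cs hb hbc).bdd
  have hkb0 : 0 ≤ kb := (abs_nonneg _).trans (hkb 0)
  obtain ⟨U, M, hU, hU0, hUM, hUl⟩ := exists_barrier hN hbd hkb0
  have hup : ∀ᵐ x, g1 x ≤ M + 1 := by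
    have := ae_le_of hu hg1 hlim1 (fun n => by positivity) hel hP hC.le hb
      (fun n ψ hψ => (abs_le.1 (hm n ψ hψ)).2) hU hU0 (fun x hx => ((le_abs_self _).trans (hkb x)).trans (hUl x hx)) (κ := 1/2) (by norm_num)
    filter_upwards [this] with x hx
    linarith [hUM x]
  have hlow : ∀ᵐ x, 0 ≤ g1 x := by
    have hz : IsTestFun Ω (fun _ => 0) := by
      have : tsupport (fun _ : ES N => (0:ℝ)) = ∅ := by simp [tsupport, Function.support]
      refine ⟨contDiff_const, ?_, ?_⟩ <;> rw [this]
      · exact isCompact_empty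
      · exact empty_subset _
    have h1 : ∀ k : ℕ, ∀ᵐ x, 0 + (-1) * g1 x ≤ 0 + 2 * (1 / ((k:ℝ) + 1)) := by
      intro k
      refine ae_le_of (u := fun n x => 0 + (-1) * u n x) (g := fun x => 0 + (-1) * g1 x) (f := fun x => 0 + (-1) * b x) (U := fun _ => 0)
        (fun n => test_add hz (hu n) (-1)) ?_ ?_ (fun n => by positivity) hel hP hC.le (by fun_prop) ?_ contDiff_const (fun _ => le_rfl) ?_ (by positivity)
      · have := hg1.const_mul (-1)
        simpa only [zero_add] using this
      · refine hlim1.congr fun n => ?_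
        congr 1; funext x; ring
      · intro n ψ hψ
        rw [Di_add_left hz.1 (hu n).1 hψ.1 hψ.2.1, Di_zero]
        have e : ∫ x, (0 + (-1) * b x) * ψ x = -∫ x, b x * ψ x := by
          rw [← integral_neg]; congr 1; funext x; ring
        rw [e]
        have := (abs_le.1 (hm n ψ hψ)).1
        linarith
      · intro x _
        have : lap (fun _ : ES N => (0:ℝ)) x = 0 := by simp [lap]
        rw [this]; linarith [hb0 x]
    filter_upwards [ae_all_iff.2 h1] with x hx
    by_contra hneg
    obtain ⟨k, hk⟩ := exists_nat_one_div_lt (show 0 < -(g1 x) / 2 by linarith [not_le.1 hneg])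
    linarith [hx k]
  have hoff : ∀ᵐ x, x ∉ Ω → g1 x = 0 := by
    set w : ES N → ℝ := Ωᶜ.indicator g1 with hw
    have hwm : MemLp w 2 := hg1.indicator hΩ.measurableSet.compl
    have hb : ∀ n, ∫ x, w x ^ 2 ≤ ∫ x, (u n x - g1 x) ^ 2 := fun n => by
      refine integral_mono hwm.integrable_sq ((hum n).sub hg1).integrable_sq fun x => ?_
      by_cases hx : x ∈ Ω
      · have : w x = 0 := by simp [hw, hx]
        simp only [this]; nlinarith [sq_nonneg (u n x - g1 x)]
      · have : w x = g1 x := by simp [hw, hx]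
        have h2 : u n x = 0 := image_eq_zero_of_notMem_tsupport fun h => hx ((hu n).2.2 h)
        simp only [this, h2]; nlinarith
    have h1 : ∫ x, w x ^ 2 = 0 := le_antisymm (ge_of_tendsto' hlim1 hb) (integral_nonneg fun x => sq_nonneg _)
    rw [integral_eq_zero_iff_of_nonneg (fun x => sq_nonneg _) hwm.integrable_sq] at h1
    filter_upwards [h1] with x hx hxΩ
    have hx : w x ^ 2 = 0 := hx
    have h2 : w x = 0 := by simpa using hx
    rw [← h2]; simp [hw, hxΩ]
  set g2 := hg1.1.mk g1 with hg2
  have hg2m : Measurable g2 := hg1.1.stronglyMeasurable_mk.measurable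
  set g : ES N → ℝ := Ω.indicator (fun x => max 0 (min (g2 x) (M + 1))) with hg
  have hM0 : 0 ≤ M := (hU0 0).trans (hUM 0)
  have hgg : g =ᵐ[volume] g1 := by
    filter_upwards [hup, hlow, hoff, hg1.1.ae_eq_mk] with x h1 h2 h3 h4
    by_cases hx : x ∈ Ω
    · simp only [hg, indicator_of_mem hx]
      rw [hg2, ← h4, min_eq_left h1, max_eq_right h2]
    · simp only [hg, indicator_of_notMem hx]
      rw [h3 hx]
  have hg0 : ∀ x, 0 ≤ g x := fun x => indicator_nonneg (fun x _ => le_max_left _ _) x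
  have hgM : ∀ x, g x ≤ M + 1 := fun x => indicator_apply_le' (fun _ => max_le (by linarith) (min_le_right _ _)) (fun _ => by linarith)
  obtain ⟨R, hR⟩ := hbd.subset_closedBall (0 : ES N)
  have hbm : BM g := ⟨(measurable_const.max (hg2m.min measurable_const)).indicator hΩ.measurableSet,
    ⟨M + 1, fun x => by rw [abs_of_nonneg (hg0 x)]; exact hgM x⟩, R, fun x hx => by
      refine indicator_of_notMem (fun h => ?_) _
      have := hR h
      rw [mem_closedBall, dist_zero_right] at this
      linarith⟩
  have hgm : MemLp g 2 := (memLp_congr_ae hgg).2 hg1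
  have hlim : Tendsto (fun n => ∫ x, (u n x - g x) ^ 2) atTop (𝓝 0) := by
    refine hlim1.congr fun n => integral_congr_ae ?_
    filter_upwards [hgg] with x hx
    rw [hx]
  have hlapm : ∀ φ : ES N → ℝ, Sm φ → HasCompactSupport φ → MemLp (lap φ) 2 := fun φ hφ hφc =>
    hφ.lap.continuous.memLp_of_hasCompactSupport (hcs_lap hφc)
  refine ⟨g, hbm, hg0, fun x hx => indicator_of_notMem hx _, fun φ hφ => ?_, fun φ hφ hφc hφ0 => ?_⟩
  · have hφs : Sm φ := hφ.1
    have hφc : HasCompactSupport φ := hφ.2.1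
    have hl := hlapm φ hφ.1 hφ.2.1
    have t1 : Tendsto (fun n => Di (u n) φ) atTop (𝓝 (∫ x, b x * φ x)) := by
      rw [tendsto_iff_dist_tendsto_zero]
      have t0 : Tendsto (fun n : ℕ => (1/2:ℝ) ^ n * √(Di φ φ)) atTop (𝓝 0) := by
        have := hel.mul_const (√(Di φ φ)); rwa [zero_mul] at this
      exact squeeze_zero (fun n => dist_nonneg) (fun n => hm n φ hφ) t0
    have t2 : Tendsto (fun n => ∫ x, u n x * lap φ x) atTop (𝓝 (∫ x, g x * lap φ x)) := by
      rw [tendsto_iff_dist_tendsto_zero]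
      have hle : ∀ n, dist (∫ x, u n x * lap φ x) (∫ x, g x * lap φ x) ≤ √((∫ x, (u n x - g x) ^ 2) * ∫ x, lap φ x ^ 2) := fun n => by
        have := cs (f := fun x => u n x - g x) ((hum n).sub hgm).integrable_sq hl.integrable_sq (((hum n).sub hgm).integrable_mul hl)
        have e : ∫ x, (u n x - g x) * lap φ x = (∫ x, u n x * lap φ x) - ∫ x, g x * lap φ x := by
          have i1 : Integrable (fun x => u n x * lap φ x) := (hum n).integrable_mul hl
          have i2 : Integrable (fun x => g x * lap φ x) := hgm.integrable_mul hl
          rw [← integral_sub i1 i2]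
          congr 1; funext x; ring
        rw [e] at this
        rw [Real.dist_eq]
        exact Real.abs_le_sqrt this
      refine squeeze_zero (fun n => dist_nonneg) hle ?_
      have := ((hlim.mul_const (∫ x, lap φ x ^ 2))).sqrt
      simpa using this
    have e : ∀ n, ∫ x, u n x * lap φ x = - Di (u n) φ := fun n => by
      rw [Di, green1' (hu n).1 hφs hφc, neg_neg]
    simp_rw [e] at t2
    exact tendsto_nhds_unique t2 t1.neg
  · have hl := hlapm φ hφ hφc
    obtain ⟨F, hF⟩ := (BM.of_cs hφ.continuous hφc).bdd
    set A := ∫ x, |lap φ x| with hA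
    have hA0 : 0 ≤ A := integral_nonneg fun x => abs_nonneg _
    have hil : Integrable (lap φ) := hφ.lap.continuous.integrable_of_hasCompactSupport (hcs_lap hφc)
    set B := √(C * ∫ x, b x ^ 2) + 1 with hB
    have hDb : ∀ n, Di (u n) (u n) ≤ B ^ 2 := by
      intro n
      refine root_bound (Di_nonneg _) (by positivity) ?_
      have h1 := (abs_le.1 (hm n _ (hu n))).2
      have h2 := cs (int_sq hb hbc) (int_sq (hu n).1.continuous (hu n).2.1) ((hb.mul (hu n).1.continuous).integrable_of_hasCompactSupport (hbc.mul_right))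
      have h3 := hP _ (hu n)
      rw [← Di_self] at h3
      have hbn : 0 ≤ ∫ x, b x ^ 2 := integral_nonneg fun x => sq_nonneg _
      have h4 : (∫ x, b x * u n x) ^ 2 ≤ (C * ∫ x, b x ^ 2) * Di (u n) (u n) := h2.trans (by nlinarith)
      have h5 := Real.abs_le_sqrt h4
      rw [Real.sqrt_mul (by positivity)] at h5
      have h6 := (le_abs_self _).trans h5
      have h7 : ((1/2:ℝ)) ^ n ≤ 1 := pow_le_one₀ (by norm_num) (by norm_num)
      have h8 := Real.sqrt_nonneg (Di (u n) (u n))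
      rw [hB]
      nlinarith
    have main : ∀ κ > 0, -(∫ x, b x * φ x) - κ * A ≤ ∫ x, g x * lap φ x := by
      intro κ hκ
      obtain ⟨H, η, sH, sη, dH, η0, η1, dη, hHa, hHl⟩ := exists_abs hκ
      set K := √(2 * Di φ φ + 2 * (F / κ) ^ 2 * B ^ 2) with hK
      have hn : ∀ n, -(∫ x, b x * φ x) - κ * A - (1/2) ^ n * K - √((∫ x, (u n x - g x) ^ 2) * ∫ x, lap φ x ^ 2) ≤ ∫ x, g x * lap φ x := by
        intro n
        have h1 := sub_est (by positivity) (hu n) hb hb0 (hm n) hφ hφc hφ0 (fun x => (le_abs_self _).trans (hF x)) hκ sH sη dH η0 η1 dη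
        have h2 : √(2 * Di φ φ + 2 * (F / κ) ^ 2 * Di (u n) (u n)) ≤ K := by
          apply Real.sqrt_le_sqrt
          have := hDb n
          gcongr
        have h3 : (1/2:ℝ) ^ n * √(2 * Di φ φ + 2 * (F / κ) ^ 2 * Di (u n) (u n)) ≤ (1/2) ^ n * K := by gcongr
        have m1 : MemLp (fun x => |u n x - g x|) 2 := ((hum n).sub hgm).abs
        have m2 : MemLp (fun x => |lap φ x|) 2 := hl.abs
        have im : Integrable (fun x => |u n x - g x| * |lap φ x|) := m1.integrable_mul m2
        have h4 := cs m1.integrable_sq m2.integrable_sq im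
        simp only [sq_abs] at h4
        have h5 := (le_abs_self _).trans (Real.abs_le_sqrt h4)
        have iH : Integrable (fun x => H (u n x) * lap φ x) :=
          ((sH.continuous.comp (hu n).1.continuous).mul hφ.lap.continuous).integrable_of_hasCompactSupport ((hcs_lap hφc).mul_left)
        have ig : Integrable (fun x => g x * lap φ x) := hgm.integrable_mul hl
        have h6 : ∫ x, H (u n x) * lap φ x ≤ ∫ x, (g x * lap φ x + (κ * |lap φ x| + |u n x - g x| * |lap φ x|)) := by
          refine integral_mono iH (ig.add ((hil.abs.const_mul κ).add im)) fun x => ?_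
          have a1 := hHa (g x)
          rw [abs_of_nonneg (hg0 x)] at a1
          have a2 := hHl (u n x) (g x)
          have a3 : |H (u n x) - g x| ≤ κ + |u n x - g x| := by
            have := abs_sub_le (H (u n x)) (H (g x)) (g x); linarith
          have a4 : (H (u n x) - g x) * lap φ x ≤ (κ + |u n x - g x|) * |lap φ x| := by
            refine (le_abs_self _).trans ?_
            rw [abs_mul]
            gcongr
          simp only
          nlinarith
        have i3 : Integrable (fun x => κ * |lap φ x| + |u n x - g x| * |lap φ x|) := (hil.abs.const_mul κ).add im
        rw [integral_add ig i3, integral_add (hil.abs.const_mul κ) im, integral_const_mul] at h6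
        linarith
      have t : Tendsto (fun n : ℕ => -(∫ x, b x * φ x) - κ * A - (1/2) ^ n * K - √((∫ x, (u n x - g x) ^ 2) * ∫ x, lap φ x ^ 2)) atTop
          (𝓝 (-(∫ x, b x * φ x) - κ * A - 0 * K - √(0 * ∫ x, lap φ x ^ 2))) :=
        (tendsto_const_nhds.sub (hel.mul_const K)).sub ((hlim.mul_const _).sqrt)
      have := le_of_tendsto' t hn
      simpa using this
    refine le_of_forall_pos_le_add fun ε hε => ?_
    have := main (ε / (A + 1)) (by positivity)
    have h2 : ε / (A + 1) * A ≤ ε := by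
      rw [div_mul_eq_mul_div, div_le_iff₀ (by positivity)]; nlinarith
    linarith


lemma ae_le_open {N : ℕ} {Ω : Set (ES N)} (hΩ : IsOpen Ω) {f : ES N → ℝ} {a : ℝ} (hf : ContinuousOn f Ω)
    (h : ∀ᵐ x, x ∈ Ω → f x ≤ a) : ∀ x ∈ Ω, f x ≤ a := by
  intro x hx
  by_contra hc
  have ho : IsOpen (Ω ∩ f ⁻¹' Ioi a) := hf.isOpen_inter_preimage hΩ isOpen_Ioi
  have hp := ho.measure_pos volume ⟨x, hx, not_le.1 hc⟩
  have h0 : volume (Ω ∩ f ⁻¹' Ioi a) = 0 := by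
    refine measure_mono_null (fun y hy => ?_) h
    simp only [mem_compl_iff, mem_setOf_eq]
    intro hh
    exact absurd (hh hy.1) (not_le.2 hy.2)
  exact hp.ne' h0

lemma exists_reg {N : ℕ} (hN : 2 ≤ N) {Ω : Set (ES N)} (hΩ : IsOpen Ω) (hbd : Bornology.IsBounded Ω) {U : ES N → ℝ} (hU : Sm U)
    (hUc : HasCompactSupport (lap U)) (hU0 : ∀ x, lap U x ≤ 0) : ∃ g : ES N → ℝ, BM g ∧ (∀ x, 0 ≤ g x) ∧
    (∀ x, x ∉ Ω → g x = 0) ∧ (∀ x ∈ Ω, SmAt g x ∧ lap g x = lap U x) ∧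
    (∀ φ, Sm φ → HasCompactSupport φ → (∀ x, 0 ≤ φ x) → ∫ x, lap U x * φ x ≤ ∫ x, g x * lap φ x) := by
  obtain ⟨g0, hg0, hg00, hg0o, hw, hi⟩ := exists_weak hN hΩ hbd (b := fun x => -lap U x) hU.lap.continuous.neg
    (hUc.neg) (fun x => by linarith [hU0 x])
  obtain ⟨R, hR⟩ := hbd.subset_closedBall (0 : ES N)
  set V : ES N → ℝ := (closedBall 0 R).indicator U with hV
  have hVm : Measurable V := meas_ind hU.continuous.continuousOn isClosed_closedBall.measurableSet
  obtain ⟨C1, hC1⟩ := hg0.bdd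
  obtain ⟨R1, hR1⟩ := hg0.supp
  obtain ⟨C2, hC2⟩ := (isCompact_closedBall (0 : ES N) R).exists_bound_of_continuousOn hU.continuous.continuousOn
  have hVb : ∀ x, |V x| ≤ |C2| := fun x => by
    by_cases hx : x ∈ closedBall 0 R
    · rw [hV, indicator_of_mem hx]; exact (hC2 x hx).trans (le_abs_self _)
    · rw [hV, indicator_of_notMem hx, abs_zero]; exact abs_nonneg _
  have hVs : ∀ x, R < ‖x‖ → V x = 0 := fun x hx => by
    rw [hV]; refine indicator_of_notMem (fun h => ?_) _
    rw [mem_closedBall, dist_zero_right] at h; linarith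
  have hf : BM (fun x => g0 x - V x) := ⟨hg0.meas.sub hVm, ⟨C1 + |C2|, fun x => (abs_sub _ _).trans (add_le_add (hC1 x) (hVb x))⟩,
    max R R1, fun x hx => by
      rw [hVs x ((le_max_left _ _).trans_lt hx), hR1 x ((le_max_right _ _).trans_lt hx), sub_zero]⟩
  obtain ⟨F, hF, hFe⟩ := weyl hf hΩ (by
    intro ψ hψ
    have hψs : Sm ψ := hψ.1
    have hψc : HasCompactSupport ψ := hψ.2.1
    have i1 : Integrable (fun x => g0 x * lap ψ x) := by
      refine (hψs.lap.continuous.integrable_of_hasCompactSupport (hcs_lap hψc)).bdd_mul (c := C1) hg0.meas.aestronglyMeasurable ?_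
      exact Eventually.of_forall hC1
    have i2 : Integrable (fun x => U x * lap ψ x) :=
      (hU.continuous.mul hψs.lap.continuous).integrable_of_hasCompactSupport ((hcs_lap hψc).mul_left)
    have e : ∀ x, (g0 x - V x) * lap ψ x = g0 x * lap ψ x - U x * lap ψ x := fun x => by
      by_cases hx : x ∈ closedBall 0 R
      · rw [hV, indicator_of_mem hx]; ring
      · have : lap ψ x = 0 := image_eq_zero_of_notMem_tsupport fun h => hx (hR (hψ.2.2 (tsupport_lap ψ h)))
        rw [this]; ring
    simp_rw [e]
    rw [integral_sub i1 i2, hw ψ hψ, ← green2 hU hψs hψc]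
    simp only [neg_mul, integral_neg]
    ring)
  set g : ES N → ℝ := Ω.indicator (fun x => F x + U x) with hg
  have hs : ∀ x ∈ Ω, SmAt (fun x => F x + U x) x := fun x hx => (hF x hx).1.add (hU.at x)
  have hco : ContinuousOn (fun x => F x + U x) Ω := fun x hx => (hs x hx).continuousAt.continuousWithinAt
  have hae : ∀ᵐ x, g x = g0 x := by
    filter_upwards [hFe] with x hx
    by_cases hxΩ : x ∈ Ω
    · have h1 := hx hxΩ
      rw [hV, indicator_of_mem (hR hxΩ)] at h1
      rw [hg, indicator_of_mem hxΩ, ← h1]; ring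
    · rw [hg, indicator_of_notMem hxΩ, hg0o x hxΩ]
  have h1 : ∀ x ∈ Ω, F x + U x ≤ C1 := ae_le_open hΩ hco (by
    filter_upwards [hae] with x hx hxΩ
    rw [hg, indicator_of_mem hxΩ] at hx
    rw [hx]; exact (le_abs_self _).trans (hC1 x))
  have h2 : ∀ x ∈ Ω, -(F x + U x) ≤ 0 := ae_le_open hΩ hco.neg (by
    filter_upwards [hae] with x hx hxΩ
    rw [hg, indicator_of_mem hxΩ] at hx
    rw [hx]; linarith [hg00 x])
  have hgn : ∀ x, 0 ≤ g x := fun x => indicator_nonneg (fun x hx => by linarith [h2 x hx]) x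
  have hC10 : 0 ≤ C1 := (abs_nonneg _).trans (hC1 0)
  refine ⟨g, ⟨meas_ind hco hΩ.measurableSet, ⟨C1, fun x => ?_⟩, R, fun x hx => ?_⟩, hgn, fun x hx => indicator_of_notMem hx _, fun x hx => ?_, fun φ hφ hφc hφ0 => ?_⟩
  · rw [abs_of_nonneg (hgn x)]
    exact indicator_apply_le' (fun hx => h1 x hx) (fun _ => hC10)
  · refine indicator_of_notMem (fun h => ?_) _
    have := hR h
    rw [mem_closedBall, dist_zero_right] at this; linarith
  · have ev : g =ᶠ[𝓝 x] fun x => F x + U x := by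
      filter_upwards [hΩ.mem_nhds hx] with y hy
      rw [hg, indicator_of_mem hy]
    refine ⟨(hs x hx).congr_of_eventuallyEq ev, ?_⟩
    rw [lap_congr ev, lap_add (hF x hx).1 (hU.at x), (hF x hx).2, zero_add]
  · have := hi φ hφ hφc hφ0
    simp only [neg_mul, integral_neg, neg_neg] at this
    refine this.trans (le_of_eq (integral_congr_ae ?_))
    filter_upwards [hae] with x hx
    rw [hx]

lemma sub_of_weak {N : ℕ} {Ω : Set (ES N)} {g : ES N → ℝ} (hg : BM g) (hg0 : ∀ x, 0 ≤ g x) (hgo : ∀ x, x ∉ Ω → g x = 0)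
    (hgs : ∀ x ∈ Ω, ContinuousAt g x) {D : Set (ES N)} (hD : IsOpen D)
    (h : ∀ ψ, IsTestFun D ψ → (∀ y, 0 ≤ ψ y) → 0 ≤ ∫ y, g y * lap ψ y) : SubM D g := by
  intro x t ht hx
  by_cases hxΩ : x ∈ Ω
  swap
  · rw [hgo x hxΩ]
    exact le_ml ht ((rho_ker N).int_bm hg _ _) fun y _ => hg0 y
  obtain ⟨ε0, hε0, hsub⟩ := (isCompact_closedBall x t).exists_cthickening_subset_open hD hx
  have h1 : ∀ ε, 0 < ε → ε < ε0 → ml ε g x ≤ ml ε (ml t g) x := by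
    intro ε hε hεε
    have hl : ∀ y ∈ closedBall x t, 0 ≤ lap (ml ε g) y := fun y hy => by
      refine ml_lap_nonneg hg hD h hε fun z hz => hsub (mem_cthickening_of_dist_le z y ε0 _ hy ?_)
      exact (mem_closedBall.1 hz).trans hεε.le
    have := mn_sub (rho_ker N) isOpen_univ ht (subset_univ _) (fun y _ => (ml_sm hg.integrable.locallyIntegrable hε).at y) hl
    rw [rho_int, mul_one] at this
    exact this.trans_eq (mn_comm (rho_ker N) (rho_ker N) hg t ε x)
  have hsm := ml_sm hg.integrable.locallyIntegrable ht
  refine le_of_tendsto_of_tendsto (ml_tendsto hg (hgs x hxΩ)) (ml_tendsto (ml_bm hg ht) hsm.continuous.continuousAt) ?_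
  filter_upwards [Ioo_mem_nhdsGT hε0] with ε hε
  exact h1 ε hε.1 hε.2

lemma cont_of_decay {N : ℕ} {Ω : Set (ES N)} {r c : ℝ} (G : Geo Ω r c) {g : ES N → ℝ} (hg : BM g) (hg0 : ∀ x, 0 ≤ g x)
    (hgo : ∀ x, x ∉ Ω → g x = 0) (hgs : ∀ x ∈ Ω, ContinuousAt g x) {x₀ : ES N} {ρ : ℝ} (hρ : 0 < ρ)
    (hsub : closedBall x₀ (5 * ρ) ⊆ Ω) (hS : SubM (closedBall x₀ ρ)ᶜ g) : Continuous g := by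
  obtain ⟨c', hc0, hc1, hdec⟩ := decay' G
  obtain ⟨M, hM⟩ := hg.bdd
  have hM0 : 0 ≤ M := (abs_nonneg _).trans (hM 0)
  set s0 := min r (ρ / 2) with hs0
  have hs0p : 0 < s0 := lt_min G.r0 (by linarith)
  have hball : ∀ x s, dista Ω x < s → s ≤ s0 → closedBall x (4 * s) ⊆ (closedBall x₀ ρ)ᶜ := by
    intro x s hx hs y hy hy2
    have h1 : 4 * ρ ≤ dista Ω y := by
      by_contra hcon
      obtain ⟨z, hz, hyz⟩ := exists_nearest G.op G.ne (hsub (closedBall_subset_closedBall (by linarith) hy2))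
      have hzΩ : z ∈ Ω := hsub (by
        rw [mem_closedBall, dist_eq_norm] at *
        have := norm_sub_le_norm_sub_add_norm_sub z y x₀
        rw [norm_sub_rev z y] at this
        linarith)
      exact (G.op.frontier_eq ▸ hz : z ∈ closure Ω \ Ω).2 hzΩ
    have h2 := dista_lip Ω y x
    rw [mem_closedBall, dist_eq_norm] at hy
    have h3 := min_le_right r (ρ / 2)
    linarith
  have hk : ∀ k : ℕ, ∀ x, dista Ω x < s0 / 5 ^ k → g x ≤ (1 - c') ^ k * M := by
    intro k
    induction k with
    | zero => intro x _; simpa using (le_abs_self _).trans (hM x)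
    | succ k ih =>
      intro x hx
      have hp : s0 / 5 ^ (k + 1) ≤ s0 := div_le_self hs0p.le (one_le_pow₀ (by norm_num))
      have := hdec _ g hS (fun x t _ _ => (rho_ker N).int_bm hg _ _) hgo x (s0 / 5 ^ (k + 1)) ((1 - c') ^ k * M) (by positivity)
        (hp.trans (min_le_left _ _)) hx (hball x _ hx hp) (by have : 0 ≤ 1 - c' := by linarith
                                                              positivity) (fun y hy => ih y (by
          have h2 := dista_lip Ω y x
          rw [mem_ball, dist_eq_norm] at hy
          have : s0 / 5 ^ k = 5 * (s0 / 5 ^ (k + 1)) := by rw [pow_succ]; field_simp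
          rw [this]; linarith))
      rw [pow_succ]; linarith
  rw [continuous_iff_continuousAt]
  intro z
  by_cases hz : z ∈ Ω
  · exact hgs z hz
  have hdz : dista Ω z = 0 := le_antisymm (by simpa using dista_le (x := z) hz) (dista_nonneg _ _)
  rw [Metric.continuousAt_iff']
  intro ε hε
  have ht : Tendsto (fun k : ℕ => (1 - c') ^ k * M) atTop (𝓝 0) := by
    have := (tendsto_pow_atTop_nhds_zero_of_lt_one (r := 1 - c') (by linarith) (by linarith)).mul_const M
    rwa [zero_mul] at this
  obtain ⟨k, hkε⟩ := (ht.eventually (gt_mem_nhds hε)).exists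
  have hev : ∀ᶠ x in 𝓝 z, dista Ω x < s0 / 5 ^ k :=
    (dista_cont Ω).continuousAt.eventually (gt_mem_nhds (by rw [hdz]; positivity))
  filter_upwards [hev] with x hx
  rw [hgo z hz, Real.dist_eq, sub_zero, abs_of_nonneg (hg0 x)]
  exact (hk k x hx).trans_lt hkε

lemma pos_of_super {N : ℕ} {Ω : Set (ES N)} (hΩ : IsOpen Ω) (hc : IsConnected Ω) {g : ES N → ℝ} (hg : Continuous g) (hg0 : ∀ x, 0 ≤ g x)
    (hgs : ∀ x ∈ Ω, SmAt g x ∧ lap g x ≤ 0) {x₁ : ES N} (hx₁ : x₁ ∈ Ω) (hl : lap g x₁ < 0) : ∀ x ∈ Ω, 0 < g x := by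
  by_contra hcon
  push Not at hcon
  obtain ⟨x₂, hx₂, hx₂0⟩ := hcon
  have hx₂z : g x₂ = 0 := le_antisymm hx₂0 (hg0 _)
  have hZ : ∀ x ∈ Ω, g x = 0 → ∀ᶠ y in 𝓝 x, y ∈ Ω ∧ g y = 0 := by
    intro x hx hx0
    obtain ⟨t, ht, hts⟩ := Metric.nhds_basis_closedBall.mem_iff.1 (hΩ.mem_nhds hx)
    have h1 := mn_super (rho_ker N) hΩ ht hts (fun y hy => (hgs y hy).1) (fun y hy => (hgs y (hts hy)).2)
    rw [hx0, zero_mul] at h1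
    filter_upwards [ball_mem_nhds x ht] with y hy
    refine ⟨hts (ball_subset_closedBall hy), ?_⟩
    by_contra hne
    have hpos : 0 < ∫ z, rho N z * g (x + t • z) := by
      refine Continuous.integral_pos_of_hasCompactSupport_nonneg_nonzero (x := t⁻¹ • (y - x)) ?_ ?_ ?_ ?_
      · exact (rho_sm N).continuous.mul (hg.comp (by fun_prop))
      · exact (rho_ker N).ρcs.mul_right
      · intro z; exact mul_nonneg ((rho_ker N).ρn z) (hg0 _)
      · have e : x + t • t⁻¹ • (y - x) = y := by rw [smul_smul, mul_inv_cancel₀ ht.ne', one_smul]; abel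
        rw [e]
        refine mul_ne_zero (rho_pos _ ?_).ne' hne
        rw [norm_smul, norm_inv, Real.norm_of_nonneg ht.le, inv_mul_lt_iff₀ ht, mul_one, ← dist_eq_norm]
        exact hy
    exact absurd h1 (not_le.2 hpos)
  have ho : IsOpen {y | y ∈ Ω ∧ g y = 0} := isOpen_iff_mem_nhds.2 fun x hx => hZ x hx.1 hx.2
  have hx₁p : 0 < g x₁ := by
    by_contra hn
    have hz : g x₁ = 0 := le_antisymm (not_lt.1 hn) (hg0 _)
    have hev : g =ᶠ[𝓝 x₁] fun _ => 0 := (hZ x₁ hx₁ hz).mono fun y hy => hy.2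
    rw [lap_congr hev] at hl
    simp [lap] at hl
  obtain ⟨y, _, hy1, hy2⟩ := hc.isPreconnected {y | 0 < g y} {y | y ∈ Ω ∧ g y = 0} (isOpen_lt continuous_const hg) ho
    (fun y hy => by
      rcases (hg0 y).lt_or_eq with h | h
      · exact Or.inl h
      · exact Or.inr ⟨hy, h.symm⟩) ⟨x₁, hx₁, hx₁p⟩ ⟨x₂, hx₂, hx₂, hx₂z⟩
  exact (hy1 : 0 < g y).ne' hy2.2

lemma exists_green {N : ℕ} (hN : 2 ≤ N) {Ω : Set (ES N)} {r c : ℝ} (G : Geo Ω r c) {x₀ : ES N} {ρ : ℝ} (hρ : 0 < ρ)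
    (hsub : closedBall x₀ (5 * ρ) ⊆ Ω) : ∃ g U : ES N → ℝ, Continuous g ∧ BM g ∧ (∀ x, 0 ≤ g x) ∧ (∀ x ∈ Ω, 0 < g x) ∧
      (∀ x, x ∉ Ω → g x = 0) ∧ (∀ x ∈ Ω, SmAt g x ∧ lap g x = lap U x) ∧ Sm U ∧ (∀ x, lap U x ≤ 0) ∧
      (∀ x, ρ ≤ ‖x - x₀‖ → lap U x = 0) := by
  obtain ⟨U, hU, hU0, hUz, x₁, hx₁, hlx₁⟩ := exists_U hN x₀ hρ
  have hUc : HasCompactSupport (lap U) := HasCompactSupport.intro (isCompact_closedBall x₀ ρ) fun x hx => hUz x (by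
    rw [mem_closedBall, dist_eq_norm] at hx; linarith)
  obtain ⟨g, hg, hg0, hgo, hgs, hgw⟩ := exists_reg hN G.op G.bd hU hUc hU0
  have hca : ∀ x ∈ Ω, ContinuousAt g x := fun x hx => (hgs x hx).1.continuousAt
  have hS : SubM (closedBall x₀ ρ)ᶜ g := by
    refine sub_of_weak hg hg0 hgo hca isClosed_closedBall.isOpen_compl fun ψ hψ hψ0 => ?_
    refine le_trans (le_of_eq ?_) (hgw ψ hψ.1 hψ.2.1 hψ0)
    symm
    refine integral_eq_zero_of_ae (Eventually.of_forall fun x => ?_)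
    by_cases hx : x ∈ closedBall x₀ ρ
    · have : ψ x = 0 := image_eq_zero_of_notMem_tsupport fun h => hψ.2.2 h hx
      simp [this]
    · rw [mem_closedBall, dist_eq_norm] at hx
      simp [hUz x (by linarith)]
  have hgc := cont_of_decay G hg hg0 hgo hca hρ hsub hS
  have hx₁Ω : x₁ ∈ Ω := hsub (ball_subset_closedBall (ball_subset_ball (by linarith) hx₁))
  exact ⟨g, U, hgc, hg, hg0, pos_of_super G.op G.conn hgc hg0 (fun x hx => ⟨(hgs x hx).1, (hgs x hx).2.trans_le (hU0 x)⟩)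
    hx₁Ω ((hgs x₁ hx₁Ω).2.trans_lt hlx₁), hgo, hgs, hU, hU0, hUz⟩


/-- the comparison potential -/
structure Pt {N : ℕ} (Ω : Set (ES N)) (γ : ES N → ℝ) (x₀ : ES N) (ρ L : ℝ) : Prop where
  ct : Continuous γ
  bm : BM γ
  nn : ∀ x, 0 ≤ γ x
  off : ∀ x, x ∉ Ω → γ x = 0
  sm : ∀ x ∈ Ω, SmAt γ x
  sup : ∀ x ∈ Ω, lap γ x ≤ 0
  low : ∀ x ∈ Ω, -L ≤ lap γ x
  zer : ∀ x ∈ Ω, ρ ≤ ‖x - x₀‖ → lap γ x = 0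

/-- minimum of `s` and `γ`, extended by zero -/
def vm {N : ℕ} (Ω : Set (ES N)) (s γ : ES N → ℝ) : ES N → ℝ := Ω.indicator fun x => min (s x) (γ x)

section vm
variable {N : ℕ} {Ω : Set (ES N)} {s γ : ES N → ℝ} {x₀ : ES N} {ρ L : ℝ}

lemma vm_nonneg (P : Pt Ω γ x₀ ρ L) (hs0 : ∀ x ∈ Ω, 0 ≤ s x) (x : ES N) : 0 ≤ vm Ω s γ x :=
  indicator_nonneg (fun y hy => le_min (hs0 y hy) (P.nn y)) x

lemma vm_le (P : Pt Ω γ x₀ ρ L) (x : ES N) : vm Ω s γ x ≤ γ x :=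
  indicator_apply_le' (fun _ => min_le_right _ _) (fun _ => P.nn x)

lemma vm_lsc (hΩ : IsOpen Ω) (P : Pt Ω γ x₀ ρ L) (hs : IsSuperharmonicOn Ω s) (hs0 : ∀ x ∈ Ω, 0 ≤ s x) : LowerSemicontinuous (vm Ω s γ) := by
  intro x y hy
  by_cases hx : x ∈ Ω
  · rw [vm, indicator_of_mem hx, gt_iff_lt, lt_min_iff] at hy
    have h1 := hs.1 x hx y hy.1
    rw [hΩ.nhdsWithin_eq hx] at h1
    filter_upwards [h1, P.ct.continuousAt.eventually (lt_mem_nhds hy.2), hΩ.mem_nhds hx] with z h1 h2 h3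
    show y < vm Ω s γ z
    rw [vm, indicator_of_mem h3]
    exact lt_min h1 h2
  · rw [vm, indicator_of_notMem hx] at hy
    exact Eventually.of_forall fun z => lt_of_lt_of_le hy (vm_nonneg P hs0 z)

lemma vm_bm (hΩ : IsOpen Ω) (P : Pt Ω γ x₀ ρ L) (hs : IsSuperharmonicOn Ω s) (hs0 : ∀ x ∈ Ω, 0 ≤ s x) : BM (vm Ω s γ) := by
  obtain ⟨C, hC⟩ := P.bm.bdd
  obtain ⟨R, hR⟩ := P.bm.supp
  refine ⟨(vm_lsc hΩ P hs hs0).measurable, ⟨C, fun x => ?_⟩, R, fun x hx => ?_⟩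
  · rw [abs_of_nonneg (vm_nonneg P hs0 x)]
    exact (vm_le P x).trans ((le_abs_self _).trans (hC x))
  · exact le_antisymm ((vm_le P x).trans_eq (hR x hx)) (vm_nonneg P hs0 x)

lemma vm_mean (hΩ : IsOpen Ω) (P : Pt Ω γ x₀ ρ L) (hs : IsSuperharmonicOn Ω s) (hs0 : ∀ x ∈ Ω, 0 ≤ s x) {x : ES N} {t : ℝ} (ht : 0 < t)
    (hx : closedBall x t ⊆ Ω) : mn (bρ N) t (vm Ω s γ) x ≤ vm Ω s γ x * vb N := by
  have hv := vm_bm hΩ P hs hs0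
  have hxΩ : x ∈ Ω := hx (mem_closedBall_self ht.le)
  have hp : 0 ≤ (t ^ N)⁻¹ := by positivity
  have h1 : mn (bρ N) t (vm Ω s γ) x ≤ s x * vb N := by
    have h2 : mn (bρ N) t s x ≤ s x * vb N := by
      rw [avg_ball s ht, mul_comm]
      exact mul_le_mul_of_nonneg_right (hs.2.2 x hxΩ t ht hx) (vb_pos N).le
    refine le_trans ?_ h2
    rw [mn_ball _ ht, mn_ball _ ht]
    refine mul_le_mul_of_nonneg_left ?_ hp
    refine setIntegral_mono_on hv.integrable.integrableOn ?_ measurableSet_ball fun y hy => ?_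
    · exact (hs.2.1.integrableOn_compact_subset hx (isCompact_closedBall x t)).mono_set ball_subset_closedBall
    · rw [vm, indicator_of_mem (hx (ball_subset_closedBall hy))]
      exact min_le_left _ _
  have h2 : mn (bρ N) t (vm Ω s γ) x ≤ γ x * vb N := by
    have h3 := mn_super (isKer_ball N) hΩ ht hx P.sm (fun y hy => P.sup y (hx hy))
    rw [int_bρ] at h3
    refine le_trans ?_ h3
    exact integral_mono ((isKer_ball N).int_bm hv _ _) ((isKer_ball N).int_bm P.bm _ _) fun z =>
      mul_le_mul_of_nonneg_left (vm_le P _) ((isKer_ball N).ρn z)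
  rw [vm, indicator_of_mem hxΩ, ← vm]
  rcases min_choice (s x) (γ x) with h | h <;> rw [h] <;> assumption

lemma vm_lap (hΩ : IsOpen Ω) (P : Pt Ω γ x₀ ρ L) (hs : IsSuperharmonicOn Ω s) (hs0 : ∀ x ∈ Ω, 0 ≤ s x) {x : ES N} {ε : ℝ} (hε : 0 < ε)
    (hx : ε < dista Ω x) : lap (ml ε (vm Ω s γ)) x ≤ 0 := by
  have hv := vm_bm hΩ P hs hs0
  refine lap_nonpos_of_mn (isKer_ball N) (bK_zero N) (ml_sm hv.integrable.locallyIntegrable hε) (sub_pos.2 hx) fun t ht htr => ?_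
  rw [int_bρ]
  have e : mn (bρ N) t (ml ε (vm Ω s γ)) x = mn (rho N) ε (mn (bρ N) t (vm Ω s γ)) x := mn_comm (isKer_ball N) (rho_ker N) hv t ε x
  rw [e, ml, mn, mn, ← integral_mul_const]
  have hi : Integrable (fun z => rho N z * vm Ω s γ (x + ε • z) * vb N) := ((rho_ker N).int_bm hv ε x).mul_const _
  refine integral_mono_of_nonneg (Eventually.of_forall fun z => mul_nonneg ((rho_ker N).ρn z) ?_) hi (Eventually.of_forall fun z => ?_)
  · exact integral_nonneg fun w => mul_nonneg ((isKer_ball N).ρn w) (vm_nonneg P hs0 _)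
  · by_cases hz : 1 ≤ ‖z‖
    · simp [(rho_ker N).ρs z hz]
    · simp only
      rw [mul_assoc]
      refine mul_le_mul_of_nonneg_left (vm_mean hΩ P hs hs0 ht fun y hy => dista_mem ?_) ((rho_ker N).ρn z)
      have h1 := dista_lip Ω x y
      have h2 : ‖x - y‖ ≤ ε + t := by
        rw [mem_closedBall, dist_comm, dist_eq_norm] at hy
        have h3 := norm_sub_le_norm_sub_add_norm_sub x (x + ε • z) y
        have h4 : ‖x - (x + ε • z)‖ ≤ ε := by
          rw [sub_add_cancel_left, norm_neg, norm_smul, Real.norm_of_nonneg hε.le]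
          have := not_le.1 hz
          nlinarith
        linarith
      linarith

lemma pt_small (hΩ : IsOpen Ω) (hne : Ωᶜ.Nonempty) (P : Pt Ω γ x₀ ρ L) {κ : ℝ} (hκ : 0 < κ) : ∃ ε0, 0 < ε0 ∧ ∀ ε, 0 < ε → ε < ε0 →
    ∀ x, κ ≤ ml ε γ x → 2 * ε < dista Ω x := by
  set K := {x | κ / 2 ≤ γ x} with hK
  obtain ⟨R, hR⟩ := P.bm.supp
  have hKc : IsCompact K := by
    refine (isCompact_closedBall (0 : ES N) R).of_isClosed_subset (isClosed_le continuous_const P.ct) fun x hx => ?_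
    rw [mem_closedBall, dist_zero_right]
    by_contra hc
    have h1 := hR x (not_le.1 hc)
    have h2 : κ / 2 ≤ γ x := hx
    linarith
  have hKΩ : K ⊆ Ω := fun x hx => by
    by_contra hc
    have h1 := P.off x hc
    have h2 : κ / 2 ≤ γ x := hx
    linarith
  obtain ⟨η, hη, hηK⟩ : ∃ η, 0 < η ∧ ∀ x ∈ K, η ≤ dista Ω x := by
    rcases K.eq_empty_or_nonempty with h | h
    · exact ⟨1, one_pos, by simp [h]⟩
    · obtain ⟨x, hx, hm⟩ := hKc.exists_isMinOn h (dista_cont Ω).continuousOn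
      exact ⟨dista Ω x, dista_pos hΩ hne (hKΩ hx), fun y hy => hm hy⟩
  refine ⟨η / 3, by positivity, fun ε hε hεη x hx => ?_⟩
  obtain ⟨y, hy, hyK⟩ : ∃ y ∈ ball x ε, y ∈ K := by
    by_contra hc
    push Not at hc
    have := ml_le (a := κ / 2) hε ((rho_ker N).int_bm P.bm ε x) fun y hy => (not_le.1 (hc y hy)).le
    linarith
  have h1 := dista_lip Ω y x
  have h2 := hηK y hyK
  rw [mem_ball, dist_eq_norm] at hy
  linarith

lemma vm_mass (hΩ : IsOpen Ω) (P : Pt Ω γ x₀ ρ L) (hs : IsSuperharmonicOn Ω s) (hs0 : ∀ x ∈ Ω, 0 ≤ s x) (hsub : closedBall x₀ (3 * ρ) ⊆ Ω)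
    {ε : ℝ} (hε : 0 < ε) (hερ : ε ≤ ρ) : ∫ x in ball x₀ (2 * ρ), ml ε (vm Ω s γ) x ≤ ∫ x in ball x₀ (3 * ρ), s x := by
  have hv := vm_bm hΩ P hs hs0
  set χ : ES N → ℝ := (ball x₀ (2 * ρ)).indicator (fun _ => 1) with hχ
  have hχ1 : ∀ x, χ x ≤ 1 := fun x => indicator_apply_le' (fun _ => le_rfl) (fun _ => zero_le_one)
  have hχ0 : ∀ x, 0 ≤ χ x := fun x => indicator_nonneg (fun _ _ => zero_le_one) x
  have hχb : BM χ := ⟨measurable_const.indicator measurableSet_ball, ⟨1, fun x => by rw [abs_of_nonneg (hχ0 x)]; exact hχ1 x⟩,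
    ‖x₀‖ + 2 * ρ, fun x hx => indicator_of_notMem (fun h => by
      rw [mem_ball, dist_eq_norm] at h
      have := norm_sub_norm_le x x₀
      linarith) _⟩
  have e1 : ∫ x in ball x₀ (2 * ρ), ml ε (vm Ω s γ) x = ∫ x, ml ε (vm Ω s γ) x * χ x := by
    rw [← integral_indicator measurableSet_ball]
    congr 1; funext x
    by_cases hx : x ∈ ball x₀ (2 * ρ)
    · rw [hχ, indicator_of_mem hx, indicator_of_mem hx, mul_one]
    · rw [hχ, indicator_of_notMem hx, indicator_of_notMem hx, mul_zero]
  rw [e1, ml_symm hv.integrable hχb hε, ← integral_indicator measurableSet_ball]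
  have hi : IntegrableOn s (ball x₀ (3 * ρ)) :=
    (hs.2.1.integrableOn_compact_subset hsub (isCompact_closedBall _ _)).mono_set ball_subset_closedBall
  have hm1 : ∀ x, ml ε χ x ≤ 1 := fun x => ml_le hε ((rho_ker N).int_bm hχb _ _) fun y _ => hχ1 y
  have hm0 : ∀ x, 0 ≤ ml ε χ x := fun x => le_ml hε ((rho_ker N).int_bm hχb _ _) fun y _ => hχ0 y
  refine integral_mono_of_nonneg (Eventually.of_forall fun x => mul_nonneg (vm_nonneg P hs0 x) (hm0 x))
    (hi.integrable_indicator measurableSet_ball) (Eventually.of_forall fun x => ?_)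
  by_cases hx : x ∈ ball x₀ (3 * ρ)
  · rw [indicator_of_mem hx]
    have hxΩ := hsub (ball_subset_closedBall hx)
    have h1 : vm Ω s γ x ≤ s x := by rw [vm, indicator_of_mem hxΩ]; exact min_le_left _ _
    have h2 := vm_nonneg P hs0 x
    have h3 := hm1 x
    simp only
    nlinarith
  · rw [indicator_of_notMem hx]
    have : ml ε χ x = ml ε (fun _ => 0) x := ml_congr hε fun y hy => indicator_of_notMem (fun h => hx ?_) _
    · simp only [this]; simp [ml, mn]
    · rw [mem_ball] at *
      have := dist_triangle x y x₀
      rw [dist_comm x y] at this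
      linarith

end vm


section energy
variable {N : ℕ} {Ω : Set (ES N)} {s γ : ES N → ℝ} {x₀ : ES N} {ρ L : ℝ}

lemma trunc_test (hne : Ωᶜ.Nonempty) {f w : ES N → ℝ} {κ ε : ℝ} (hε : 0 < ε) (hf : Sm f) (hw : Continuous w) (hwb : BM w) (hfw : ∀ x, f x ≤ w x)
    (hsm : ∀ x, κ ≤ w x → 2 * ε < dista Ω x) (hκ : 0 < κ) {Φ : ℝ → ℝ} (hΦ : ContDiff ℝ (⊤ : ℕ∞) Φ) (hΦz : ∀ t, t ≤ κ → Φ t = 0) :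
    IsTestFun Ω (fun x => Φ (f x)) := by
  have hcl : IsClosed {x | κ ≤ w x} := isClosed_le continuous_const hw
  have hsub : tsupport (fun x => Φ (f x)) ⊆ {x | κ ≤ w x} := closure_minimal (fun x hx => by
    by_contra hc
    exact hx (hΦz _ ((hfw x).trans (not_le.1 hc).le))) hcl
  obtain ⟨R, hR⟩ := hwb.supp
  refine ⟨hΦ.comp hf, ?_, fun x hx => dista_mem (by linarith [hsm x (hsub hx)])⟩
  refine (isCompact_closedBall (0 : ES N) R).of_isClosed_subset (isClosed_tsupport _) fun x hx => ?_
  rw [mem_closedBall, dist_zero_right]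
  by_contra hc
  have h1 := hR x (not_le.1 hc)
  have h2 : κ ≤ w x := hsub hx
  linarith

lemma energy (hΩ : IsOpen Ω) (hne : Ωᶜ.Nonempty) (P : Pt Ω γ x₀ ρ L) (hL : 0 ≤ L) (hs : IsSuperharmonicOn Ω s) (hs0 : ∀ x ∈ Ω, 0 ≤ s x)
    (hsub : closedBall x₀ (3 * ρ) ⊆ Ω) {ε κ : ℝ} (hε : 0 < ε) (hερ : ε ≤ ρ) (hκ : 0 < κ)
    (hsm : ∀ x, κ ≤ ml ε γ x → 2 * ε < dista Ω x) {σ Φ Ψ : ℝ → ℝ} (T : Trunc κ σ Φ Ψ) :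
    IsTestFun Ω (fun x => Φ (ml ε (vm Ω s γ) x)) ∧
      ∫ x, gsq (fun x => Φ (ml ε (vm Ω s γ) x)) x ≤ L * ∫ x in ball x₀ (3 * ρ), s x := by
  have hv := vm_bm hΩ P hs hs0
  set v := ml ε (vm Ω s γ) with hvd
  set w := ml ε γ with hwd
  have sv : Sm v := ml_sm hv.integrable.locallyIntegrable hε
  have sw : Sm w := ml_sm P.bm.integrable.locallyIntegrable hε
  have bw : BM w := ml_bm P.bm hε
  have hvw : ∀ x, v x ≤ w x := fun x => ml_mono_cb hε ((rho_ker N).int_bm hv _ _) ((rho_ker N).int_bm P.bm _ _) fun y _ => vm_le P y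
  have hv0 : ∀ x, 0 ≤ v x := fun x => le_ml hε ((rho_ker N).int_bm hv _ _) fun y _ => vm_nonneg P hs0 y
  have t1 := trunc_test hne hε sv sw.continuous bw hvw hsm hκ T.sΦ T.Φz
  have t2 := trunc_test hne hε sv sw.continuous bw hvw hsm hκ T.sΨ T.Ψz
  have t3 := trunc_test hne hε sw sw.continuous bw (fun x => le_rfl) hsm hκ T.sΨ T.Ψz
  refine ⟨t1, ?_⟩
  have c2 : HasCompactSupport (fun x => Ψ (v x)) := t2.2.1
  have c3 : HasCompactSupport (fun x => Ψ (w x)) := t3.2.1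
  have s2 : Sm (fun x => Ψ (v x)) := t2.1
  have s3 : Sm (fun x => Ψ (w x)) := t3.1
  have e1 : ∀ x, gsq (fun x => Φ (v x)) x = ∑ i, pd i v x * pd i (fun x => Ψ (v x)) x := fun x => by
    rw [gsq]
    refine Finset.sum_congr rfl fun i _ => ?_
    rw [pd_comp i (sv.at x).diff (T.sΦ.differentiable (by simp) _), pd_comp i (sv.at x).diff (T.sΨ.differentiable (by simp) _), T.dΦ, T.dΨ]
    ring
  simp_rw [e1]
  rw [green1 sv s2 c2, ← integral_neg]
  have h1 : ∫ x, -(lap v x * Ψ (v x)) ≤ ∫ x, -(lap v x * Ψ (w x)) := by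
    refine integral_mono ?_ ?_ fun x => ?_
    · exact ((sv.lap.continuous.mul s2.continuous).integrable_of_hasCompactSupport (HasCompactSupport.mul_left c2)).neg
    · exact ((sv.lap.continuous.mul s3.continuous).integrable_of_hasCompactSupport (HasCompactSupport.mul_left c3)).neg
    · simp only
      by_cases hx : κ ≤ w x
      · have h2 : lap v x ≤ 0 := vm_lap hΩ P hs hs0 hε (by linarith [hsm x hx])
        have h3 := T.Ψm (hvw x)
        nlinarith
      · rw [T.Ψz _ (not_le.1 hx).le, T.Ψz _ ((hvw x).trans (not_le.1 hx).le)]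
  refine h1.trans ?_
  rw [integral_neg, green2 sv s3 c3, ← integral_neg]
  have h2 : ∀ x, -(v x * lap (fun x => Ψ (w x)) x) ≤ (ball x₀ (2 * ρ)).indicator (fun x => L * v x) x := by
    intro x
    have e2 : lap (fun x => Ψ (w x)) x = 2 * σ (w x) * deriv σ (w x) * gsq w x + σ (w x) ^ 2 * lap w x := by
      rw [lap_comp (sw.at x) T.sΨ, T.dΨ]
      congr 2
      rw [deriv_fun_pow (T.sσ.differentiable (by simp) _)]
      simp
    have hin : 0 ≤ (ball x₀ (2 * ρ)).indicator (fun x => L * v x) x := indicator_nonneg (fun y _ => mul_nonneg hL (hv0 y)) x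
    by_cases hx : κ ≤ w x
    swap
    · have h0 := T.σz _ (not_le.1 hx).le
      rw [e2, h0]; simpa using hin
    have hd := hsm x hx
    have hcb : closedBall x ε ⊆ Ω := fun y hy => dista_mem (by
      have := dista_lip Ω x y
      rw [mem_closedBall, dist_comm, dist_eq_norm] at hy
      linarith)
    have hlw : lap w x = ml ε (lap γ) x := ml_lap_loc hΩ hε hcb P.sm
    have hcont : ContinuousOn (lap γ) Ω := fun y hy => ((P.sm y hy).lap).continuousAt.continuousWithinAt
    have hitg := ml_int_cont hcont hε hcb
    have a0 : 0 ≤ 2 * σ (w x) * deriv σ (w x) * gsq w x :=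
      mul_nonneg (mul_nonneg (mul_nonneg (by norm_num) (T.σ0 _)) (T.σd _)) (gsq_nonneg _ _)
    have a1 := T.σ0 (w x)
    have a2 : σ (w x) ^ 2 ≤ 1 := by have := T.σ1 (w x); nlinarith
    have a3 := hv0 x
    rw [e2]
    by_cases hb : x ∈ ball x₀ (2 * ρ)
    · rw [indicator_of_mem hb]
      have h3 : -L ≤ lap w x := by
        rw [hlw]; exact le_ml hε hitg fun y hy => P.low y (hcb (ball_subset_closedBall hy))
      have h4 : -L ≤ σ (w x) ^ 2 * lap w x := by nlinarith [sq_nonneg (σ (w x))]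
      nlinarith
    · rw [indicator_of_notMem hb]
      have h3 : lap w x = 0 := by
        rw [hlw]
        have : ml ε (lap γ) x = ml ε (fun _ => 0) x := ml_congr hε fun y hy => P.zer y (hcb (ball_subset_closedBall hy)) (by
          rw [mem_ball, dist_eq_norm] at *
          have := norm_sub_le_norm_sub_add_norm_sub x y x₀
          rw [norm_sub_rev x y] at this
          linarith)
        rw [this]; simp [ml, mn]
      rw [h3]
      have := mul_nonneg a3 a0
      linarith
  have i3 : Integrable (fun x => -(v x * lap (fun x => Ψ (w x)) x)) :=
    ((sv.continuous.mul s3.lap.continuous).integrable_of_hasCompactSupport (HasCompactSupport.mul_left (hcs_lap c3))).neg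
  have hvi : Integrable v := (ml_bm hv hε).integrable
  refine (integral_mono i3 ((hvi.const_mul L).indicator measurableSet_ball) h2).trans ?_
  rw [integral_indicator measurableSet_ball, integral_const_mul]
  exact mul_le_mul_of_nonneg_left (vm_mass hΩ P hs hs0 hsub hε hερ) hL

lemma hardy_vm (hΩ : IsOpen Ω) (hne : Ωᶜ.Nonempty) {CH : ℝ} (hCH : 0 < CH)
    (hH : ∀ u, IsTestFun Ω u → ∫ x, (u x / dista Ω x) ^ 2 ≤ CH * ∫ x, gsq u x)
    (P : Pt Ω γ x₀ ρ L) (hρ : 0 < ρ) (hL : 0 ≤ L) (hs : IsSuperharmonicOn Ω s) (hs0 : ∀ x ∈ Ω, 0 ≤ s x)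
    (hsub : closedBall x₀ (3 * ρ) ⊆ Ω) :
    ∫⁻ x, ENNReal.ofReal ((vm Ω s γ x / dista Ω x) ^ 2) ≤ ENNReal.ofReal (CH * (L * ∫ x in ball x₀ (3 * ρ), s x)) := by
  have hv := vm_bm hΩ P hs hs0
  have hch : ∀ n : ℕ, ∃ ε : ℝ, ∃ Φ : ℝ → ℝ, 0 < ε ∧ ε < 1 / ((n:ℝ) + 1) ∧ (∀ t, t - 2 * (1 / ((n:ℝ) + 1)) ≤ Φ t) ∧ (∀ t, 0 ≤ Φ t) ∧
      IsTestFun Ω (fun x => Φ (ml ε (vm Ω s γ) x)) ∧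
      ∫ x, gsq (fun x => Φ (ml ε (vm Ω s γ) x)) x ≤ L * ∫ x in ball x₀ (3 * ρ), s x := by
    intro n
    have hκ : (0:ℝ) < 1 / ((n:ℝ) + 1) := by positivity
    obtain ⟨σ, Φ, Ψ, T⟩ := exists_trunc hκ
    obtain ⟨ε0, hε0, hsm⟩ := pt_small hΩ hne P hκ
    set m := min ε0 (min ρ (1 / ((n:ℝ) + 1))) with hm
    have hmp : 0 < m := lt_min hε0 (lt_min hρ hκ)
    have m1 : m ≤ ε0 := min_le_left _ _
    have m2 : m ≤ ρ := (min_le_right _ _).trans (min_le_left _ _)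
    have m3 : m ≤ 1 / ((n:ℝ) + 1) := (min_le_right _ _).trans (min_le_right _ _)
    have hE := energy hΩ hne P hL hs hs0 hsub (ε := m / 2) (by linarith) (by linarith) hκ (hsm (m / 2) (by linarith) (by linarith)) T
    exact ⟨m / 2, Φ, by linarith, by linarith, T.Φl, T.Φ0, hE⟩
  choose ε Φ hε hε1 hΦl hΦ0 htest hen using hch
  set f : ℕ → ES N → ℝ≥0∞ := fun n x => ENNReal.ofReal ((Φ n (ml (ε n) (vm Ω s γ) x) / dista Ω x) ^ 2) with hf
  have hcd : ∀ n, Continuous (fun x => Φ n (ml (ε n) (vm Ω s γ) x) / dista Ω x) := fun n =>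
    cont_div (htest n).1.continuous (dista_cont Ω) fun x hx => dista_pos hΩ hne ((htest n).2.2 hx)
  have hfm : ∀ n, Measurable (f n) := fun n => ((hcd n).pow 2).measurable.ennreal_ofReal
  have hfb : ∀ n, ∫⁻ x, f n x ≤ ENNReal.ofReal (CH * (L * ∫ x in ball x₀ (3 * ρ), s x)) := by
    intro n
    have hc : HasCompactSupport (fun x => Φ n (ml (ε n) (vm Ω s γ) x)) := (htest n).2.1
    rw [hf, ← ofReal_integral_eq_lintegral_ofReal (int_sq (hcd n) (hcs_div hc)) (Eventually.of_forall fun x => sq_nonneg _)]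
    exact ENNReal.ofReal_le_ofReal ((hH _ (htest n)).trans (mul_le_mul_of_nonneg_left (hen n) hCH.le))
  have hkl : Tendsto (fun n : ℕ => 1 / ((n:ℝ) + 1)) atTop (𝓝 0) := tendsto_one_div_add_atTop_nhds_zero_nat
  have hpt : ∀ x, ENNReal.ofReal ((vm Ω s γ x / dista Ω x) ^ 2) ≤ liminf (fun n => f n x) atTop := by
    intro x
    rcases (vm_nonneg P hs0 x).lt_or_eq with hpos | hz
    swap
    · rw [← hz]; simp
    have hb : ∀ b, 0 ≤ b → b < vm Ω s γ x → ENNReal.ofReal ((b / dista Ω x) ^ 2) ≤ liminf (fun n => f n x) atTop := by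
      intro b hb0 hbv
      obtain ⟨a, hba, hav⟩ := exists_between hbv
      obtain ⟨η, hη, hηs⟩ := Metric.eventually_nhds_iff_ball.1 (vm_lsc hΩ P hs hs0 x a hav)
      have ev1 : ∀ᶠ n : ℕ in atTop, 1 / ((n:ℝ) + 1) < η := hkl.eventually (gt_mem_nhds hη)
      have ev2 : ∀ᶠ n : ℕ in atTop, 1 / ((n:ℝ) + 1) < (a - b) / 2 := hkl.eventually (gt_mem_nhds (by linarith))
      refine le_liminf_of_le (by isBoundedDefault) ?_
      filter_upwards [ev1, ev2] with n h1 h2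
      have h3 : a ≤ ml (ε n) (vm Ω s γ) x := le_ml (hε n) ((rho_ker N).int_bm hv _ _) fun y hy =>
        le_of_lt (hηs y (ball_subset_ball ((hε1 n).trans h1).le hy))
      have h4 := hΦl n (ml (ε n) (vm Ω s γ) x)
      have h5 : b ≤ Φ n (ml (ε n) (vm Ω s γ) x) := by linarith
      have h6 := dista_nonneg Ω x
      apply ENNReal.ofReal_le_ofReal
      gcongr
    have ht : Tendsto (fun b : ℝ => ENNReal.ofReal ((b / dista Ω x) ^ 2)) (𝓝[<] (vm Ω s γ x)) (𝓝 (ENNReal.ofReal ((vm Ω s γ x / dista Ω x) ^ 2))) := by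
      refine (ENNReal.continuous_ofReal.tendsto _).comp (Tendsto.mono_left ?_ nhdsWithin_le_nhds)
      exact ((continuous_id.div_const _).pow 2).tendsto _
    refine le_of_tendsto ht ?_
    filter_upwards [Ioo_mem_nhdsLT hpos] with b hb'
    exact hb b hb'.1.le hb'.2
  calc ∫⁻ x, ENNReal.ofReal ((vm Ω s γ x / dista Ω x) ^ 2) ≤ ∫⁻ x, liminf (fun n => f n x) atTop := lintegral_mono hpt
    _ ≤ liminf (fun n => ∫⁻ x, f n x) atTop := lintegral_liminf_le hfm
    _ ≤ _ := liminf_le_of_le (by isBoundedDefault) fun b hb => by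
      obtain ⟨n, hn⟩ := hb.exists
      exact hn.trans (hfb n)

end energy


lemma harm_super {N : ℕ} {Ω : Set (ES N)} (hΩ : IsOpen Ω) {h : ES N → ℝ} (hh : Harm Ω h) : IsSuperharmonicOn Ω h := by
  have hc : ContinuousOn h Ω := fun x hx => (hh x hx).1.continuousAt.continuousWithinAt
  refine ⟨hc.lowerSemicontinuousOn, hc.locallyIntegrableOn hΩ.measurableSet, fun x _ t ht hsub => ?_⟩
  have h1 := mn_super (isKer_ball N) hΩ ht hsub (fun y hy => (hh y hy).1) (fun y hy => (hh y (hsub hy)).2.le)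
  rw [int_bρ, avg_ball h ht, mul_comm] at h1
  exact le_of_mul_le_mul_right h1 (vb_pos N)

lemma mass_le {N : ℕ} {Ω : Set (ES N)} {s : ES N → ℝ} (hs : IsSuperharmonicOn Ω s) (hs0 : ∀ x ∈ Ω, 0 ≤ s x) {x₀ x : ES N} {ρ : ℝ} (hρ : 0 < ρ)
    (hsub : closedBall x₀ (5 * ρ) ⊆ Ω) (hx : x ∈ ball x₀ ρ) : ∫ y in ball x₀ (3 * ρ), s y ≤ (4 * ρ) ^ N * vb N * s x := by
  rw [mem_ball] at hx
  have hs4 : closedBall x (4 * ρ) ⊆ Ω := (closedBall_subset_closedBall' (by linarith)).trans hsub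
  have h3 : ball x₀ (3 * ρ) ⊆ ball x (4 * ρ) := ball_subset_ball' (by rw [dist_comm]; linarith)
  have hp : 0 < 4 * ρ := by linarith
  have h1 := hs.2.2 x (hs4 (mem_closedBall_self hp.le)) (4 * ρ) hp hs4
  have hi : IntegrableOn s (ball x (4 * ρ)) :=
    (hs.2.1.integrableOn_compact_subset hs4 (isCompact_closedBall _ _)).mono_set ball_subset_closedBall
  have h2 : ∫ y in ball x₀ (3 * ρ), s y ≤ ∫ y in ball x (4 * ρ), s y := by
    refine setIntegral_mono_set hi ?_ h3.eventuallyLE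
    filter_upwards [self_mem_ae_restrict measurableSet_ball] with y hy
    exact hs0 y (hs4 (ball_subset_closedBall hy))
  have e := (mn_ball s hp x).symm.trans (avg_ball s hp x)
  rw [inv_mul_eq_iff_eq_mul₀ (by positivity)] at e
  refine h2.trans ?_
  rw [e, mul_assoc]
  have := (vb_pos N).le
  gcongr

/-- Corollary `maincorogene`. Let `ω, ω'` be open with
`closure ω' ⊆ ω` and `x₀ ∈ Ω ∖ closure ω`. There is `C = C(Ω,ω,ω',x₀)` such that
for every positive harmonic `h` in `Ω` vanishing on `ω ∩ ∂Ω` and every measurable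
`A ⊆ ω'`: `∫_A (h/δ_Ω)² dx ≤ C h(x₀) R̂_h^A(x₀)`. -/
theorem statement17 {N : ℕ} (hN : 2 ≤ N) (Ω ω ω' : Set (ES N))
    (hΩ : IsLipschitzDomain Ω) (hbd : Bornology.IsBounded Ω)
    (hω : IsOpen ω) (hω' : IsOpen ω') (hsub : closure ω' ⊆ ω)
    (x₀ : ES N) (hx₀ : x₀ ∈ Ω \ closure ω) :
    ∃ C : ℝ, 0 < C ∧
      ∀ h : ES N → ℝ, LVHarmonic Ω (fun _ => 0) h → (∀ x ∈ Ω, 0 < h x) →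
        (∀ z ∈ ω ∩ frontier Ω, Tendsto h (𝓝[Ω] z) (𝓝 0)) →
        ∀ A : Set (ES N), MeasurableSet A → A ⊆ ω' ∩ Ω →
          ∫⁻ x in A, ENNReal.ofReal ((h x / dista Ω x) ^ 2)
            ≤ ENNReal.ofReal (C * h x₀ * reduiteReg Ω h A x₀) := by
  have hsub' := hsub
  have hx₀Ω : x₀ ∈ Ω := hx₀.1
  obtain ⟨r, c, G⟩ := exists_geo hN hΩ hbd
  have hop : IsOpen Ω := G.op
  obtain ⟨CH, hCH, hH⟩ := hardy hN hΩ hbd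
  obtain ⟨ρ, hρd⟩ : ∃ ρ, ρ = dista Ω x₀ / 6 := ⟨_, rfl⟩
  have hd0 := dista_pos hop G.ne hx₀Ω
  have hρ : 0 < ρ := by rw [hρd]; positivity
  have hsub : closedBall x₀ (5 * ρ) ⊆ Ω := (closedBall_subset_ball (by rw [hρd]; linarith)).trans dista_ball
  obtain ⟨g, U, gc, gb, gn, gp, go, gs, sU, U0, Uz⟩ := exists_green hN G hρ hsub
  have hUc : HasCompactSupport (lap U) := HasCompactSupport.intro (isCompact_closedBall x₀ ρ) fun x hx => Uz x (by
    rw [mem_closedBall, dist_eq_norm] at hx; linarith)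
  obtain ⟨B0, hB0⟩ := (BM.of_cs sU.lap.continuous hUc).bdd
  have hB00 : 0 ≤ B0 := (abs_nonneg _).trans (hB0 0)
  obtain ⟨B, hBd⟩ : ∃ B, B = B0 + 1 := ⟨_, rfl⟩
  have hB : 0 < B := by linarith
  have hBl : ∀ x, -B ≤ lap U x := fun x => by have := (abs_le.1 (hB0 x)).1; linarith
  have hcpt : IsCompact (closure ω' ∩ closure Ω) := hbd.isCompact_closure.inter_left isClosed_closure
  obtain ⟨δ, hδ, hδs⟩ := hcpt.exists_cthickening_subset_open hω (inter_subset_left.trans hsub')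
  obtain ⟨C1, hC1, hbh⟩ := bh G gc gp go hρ (fun x hx hxd => ⟨(gs x hx).1, by
    rw [(gs x hx).2]
    refine Uz x ?_
    have := dista_lip Ω x₀ x
    rw [norm_sub_rev] at this
    linarith⟩) hx₀Ω (R := δ / 4) (by positivity)
  have hvb := vb_pos N
  refine ⟨CH * (C1 * B * ((4 * ρ) ^ N * vb N)), by positivity, fun h hh hpos hvan A hA hAs => ?_⟩
  obtain ⟨K, hK⟩ : ∃ K, K = CH * (C1 * B * ((4 * ρ) ^ N * vb N)) := ⟨_, rfl⟩
  have hK0 : 0 < K := by rw [hK]; positivity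
  rw [← hK]
  have hhm : Harm Ω h := harm_of_LV hop hh
  have hh0 := hpos x₀ hx₀Ω
  obtain ⟨l, hl⟩ : ∃ l, l = C1 * h x₀ := ⟨_, rfl⟩
  have hl0 : 0 < l := by rw [hl]; positivity
  have hle : ∀ x ∈ ω' ∩ Ω, h x ≤ l * g x := fun x hx => by
    rw [hl]
    refine hbh ω h hω ⟨hhm, hpos⟩ hvan x hx.2 fun y hy => hδs ?_
    refine mem_cthickening_of_dist_le y x δ _ ⟨subset_closure hx.1, subset_closure hx.2⟩ ?_
    rw [mem_closedBall] at hy; linarith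
  have P : Pt Ω (fun x => l * g x) x₀ ρ (l * B) := by
    obtain ⟨M, hM⟩ := gb.bdd
    obtain ⟨R, hR⟩ := gb.supp
    have el : ∀ x ∈ Ω, lap (fun x => l * g x) x = l * lap U x := fun x hx => by rw [lap_cmul l (gs x hx).1, (gs x hx).2]
    refine ⟨gc.const_mul l, ⟨gb.meas.const_mul l, ⟨l * M, fun x => ?_⟩, R, fun x hx => ?_⟩, fun x => mul_nonneg hl0.le (gn x), fun x hx => ?_,
      fun x hx => contDiffAt_const.mul (gs x hx).1, fun x hx => ?_, fun x hx => ?_, fun x hx hxr => ?_⟩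
    · rw [abs_mul, abs_of_pos hl0]; exact mul_le_mul_of_nonneg_left (hM x) hl0.le
    · rw [hR x hx, mul_zero]
    · rw [go x hx, mul_zero]
    · rw [el x hx]; exact mul_nonpos_of_nonneg_of_nonpos hl0.le (U0 x)
    · rw [el x hx]; have := mul_le_mul_of_nonneg_left (hBl x) hl0.le; linarith
    · rw [el x hx, Uz x hxr, mul_zero]
  set I := ∫⁻ x in A, ENNReal.ofReal ((h x / dista Ω x) ^ 2) with hI
  have key : ∀ s, IsSuperharmonicOn Ω s → (∀ z ∈ Ω, 0 ≤ s z) → (∀ z ∈ A, h z ≤ s z) → ∀ x ∈ ball x₀ ρ, I ≤ ENNReal.ofReal (K * h x₀ * s x) := by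
    intro s hs hs0 hsA x hx
    have h1 := hardy_vm hop G.ne hCH hH P hρ (by positivity) hs hs0 ((closedBall_subset_closedBall (by linarith)).trans hsub)
    calc I ≤ ∫⁻ x in A, ENNReal.ofReal ((vm Ω s (fun x => l * g x) x / dista Ω x) ^ 2) := by
          refine setLIntegral_mono' hA fun y hy => ENNReal.ofReal_le_ofReal ?_
          have hyΩ := (hAs hy).2
          have a1 : h y ≤ vm Ω s (fun x => l * g x) y := by
            rw [vm, indicator_of_mem hyΩ]; exact le_min (hsA y hy) (hle y (hAs hy))
          have a2 := hpos y hyΩ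
          have a3 := dista_nonneg Ω y
          gcongr
      _ ≤ ∫⁻ x, ENNReal.ofReal ((vm Ω s (fun x => l * g x) x / dista Ω x) ^ 2) := setLIntegral_le_lintegral _ _
      _ ≤ _ := h1
      _ ≤ _ := by
          refine ENNReal.ofReal_le_ofReal ?_
          have h2 := mass_le hs hs0 hρ hsub hx
          calc CH * (l * B * ∫ y in ball x₀ (3 * ρ), s y) ≤ CH * (l * B * ((4 * ρ) ^ N * vb N * s x)) := by gcongr
            _ = _ := by rw [hK, hl]; ring
  have hsh := harm_super hop hhm
  have hIt : I ≠ ⊤ := ne_top_of_le_ne_top ENNReal.ofReal_ne_top (key h hsh (fun z hz => (hpos z hz).le) (fun _ _ => le_rfl) x₀ (mem_ball_self hρ))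
  have hKh : 0 < K * h x₀ := by positivity
  have hred : ∀ x ∈ ball x₀ ρ, I.toReal / (K * h x₀) ≤ reduite Ω h A x := by
    intro x hx
    refine le_csInf ⟨h x, h, hsh, fun z hz => (hpos z hz).le, fun _ _ => le_rfl, rfl⟩ ?_
    rintro _ ⟨s, hs, hs0, hsA, rfl⟩
    rw [div_le_iff₀' hKh]
    have hxΩ : x ∈ Ω := hsub (ball_subset_closedBall (ball_subset_ball (by linarith) hx))
    exact ENNReal.toReal_le_of_le_ofReal (mul_nonneg hKh.le (hs0 x hxΩ)) (key s hs hs0 hsA x hx)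
  have hredle : ∀ x ∈ Ω, reduite Ω h A x ≤ h x := fun x hx => by
    refine csInf_le ⟨0, ?_⟩ ⟨h, hsh, fun z hz => (hpos z hz).le, fun _ _ => le_rfl, rfl⟩
    rintro _ ⟨s, hs, hs0, hsA, rfl⟩
    exact hs0 x hx
  have hne : (𝓝[Ω] x₀).NeBot := mem_closure_iff_nhdsWithin_neBot.1 (subset_closure hx₀Ω)
  have hbound : IsBoundedUnder (· ≤ ·) (𝓝[Ω] x₀) (reduite Ω h A) := by
    refine ⟨h x₀ + 1, ?_⟩
    rw [eventually_map]
    have hev : ∀ᶠ x in 𝓝 x₀, h x < h x₀ + 1 := (hhm x₀ hx₀Ω).1.continuousAt.eventually (gt_mem_nhds (by linarith))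
    filter_upwards [mem_nhdsWithin_of_mem_nhds hev, self_mem_nhdsWithin] with x h1 h2
    exact (hredle x h2).trans (le_of_lt h1)
  have hfin : I.toReal / (K * h x₀) ≤ reduiteReg Ω h A x₀ := by
    refine le_liminf_of_le hbound.isCoboundedUnder_ge ?_
    filter_upwards [mem_nhdsWithin_of_mem_nhds (ball_mem_nhds x₀ hρ)] with x hx
    exact hred x hx
  rw [div_le_iff₀' hKh] at hfin
  rw [← ENNReal.ofReal_toReal hIt]
  exact ENNReal.ofReal_le_ofReal hfin
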